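/- (Vinogradov-type inequality over ℤ[i]) For every interval ω ⊆ 𝕋 there exist a constant C_ω and a threshold N_ω such that: for all integers N > N_ω, all α ∈ ℂ, and all a, q ∈ ℤ[i] with 0 < N(a) < N(q) < √N, gcd(a, q) = 1 and N(α − a/q) < 1/N(q)²: |Σ_{n ∈ ℤ[i], N(n) < N, arg(n) ∈ ω} Λ(n) e(⟨n, α⟩)| ≤ C_ω ( N (log N)² / N(q)^{1/2} + N^{99/100} ). -/

import Mathlib

open Complex GaussianInt MeasureTheory
open scoped Real ENNReal

noncomputable section
attribute [local instance] Classical.propDecidable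

/-- The real inner product on `ℂ ≅ ℝ²`: `⟨z, w⟩ = Re z · Re w + Im z · Im w`. -/
def cip (z w : ℂ) : ℝ := z.re * w.re + z.im * w.im

/-- `e(t) = exp(2πit)`. -/
def e2 (t : ℝ) : ℂ := Complex.exp (2 * Real.pi * Complex.I * t)

/-- The fundamental box `B_q` of residues modulo `q`:
`B_q = {r : 0 ≤ ⟨r,q⟩ < N(q), 0 ≤ ⟨r,iq⟩ < N(q)}`. -/
def Bq (q : GaussianInt) : Set GaussianInt :=
  {r | 0 ≤ cip (toComplex r) (toComplex q) ∧
       cip (toComplex r) (toComplex q) < Complex.normSq (toComplex q) ∧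
       0 ≤ cip (toComplex r) (Complex.I * toComplex q) ∧
       cip (toComplex r) (Complex.I * toComplex q) < Complex.normSq (toComplex q)}

/-- `𝔸_q`, the reduced residues in `B_q` (gcd with `q` a unit). -/
def Aq (q : GaussianInt) : Set GaussianInt :=
  {r | r ∈ Bq q ∧ IsUnit (EuclideanDomain.gcd r q)}

/-- The Euler totient on `ℤ[i]`: `φ(q) = |𝔸_q|`. -/
def gphi (q : GaussianInt) : ℕ := Nat.card (Aq q)

/-- The Gaussian Ramanujan sum `τ_q(x) = Σ_{n ∈ 𝔸_q} e(⟨x, n/q⟩)`. -/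
def gtau (q x : GaussianInt) : ℂ :=
  ∑' n : Aq q, e2 (cip (toComplex x) (toComplex (n : GaussianInt) / toComplex q))

/-- The Möbius function on `ℤ[i]`: `(-1)^k` on squarefree numbers with `k`
pairwise non-associate prime factors (so `1` on units), and `0` otherwise. -/
def gmu (n : GaussianInt) : ℤ :=
  if n ≠ 0 ∧ Squarefree n then (-1) ^ (UniqueFactorizationMonoid.factors n).card else 0

/-- The von Mangoldt function on `ℤ[i]`: `Λ(n) = log N(ρ)` if `n` is a unit times
`ρ^k` for a Gaussian prime `ρ` and `k ≥ 1`, and `0` otherwise. -/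
def gvm (n : GaussianInt) : ℝ :=
  if h : ∃ ρ : GaussianInt, Irreducible ρ ∧
      ∃ k : ℕ, 1 ≤ k ∧ ∃ u : GaussianInt, IsUnit u ∧ n = u * ρ ^ k
  then Real.log (Complex.normSq (toComplex h.choose)) else 0

/-- `ω ⊆ 𝕋 = ℝ/2πℤ` is an interval (arc) of length `l`. -/
def IsArc (ω : Set Real.Angle) (l : ℝ) : Prop :=
  ∃ a : ℝ, ω = (fun θ : ℝ => (θ : Real.Angle)) '' Set.Ico a (a + l)

/-- `arg z ∈ ω`, as a condition in `𝕋`. -/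
def argIn (z : ℂ) (ω : Set Real.Angle) : Prop := (↑(Complex.arg z) : Real.Angle) ∈ ω

/-- The normalized sector average kernel `M_N^ω`. -/
def Msec (ω : Set Real.Angle) (l : ℝ) (N : ℕ) (n : GaussianInt) : ℝ :=
  if Zsqrtd.norm n < (N : ℤ) ∧ argIn (toComplex n) ω then 2 * Real.pi / (l * N) else 0

/-- The weighted sector average kernel `A_N^ω` (with von Mangoldt weights). -/
def Asec (ω : Set Real.Angle) (l : ℝ) (N : ℕ) (n : GaussianInt) : ℂ :=
  if Zsqrtd.norm n < (N : ℤ) ∧ argIn (toComplex n) ω then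
    ((2 * Real.pi / (l * N) : ℝ) : ℂ) * (gvm n : ℂ) else 0

/-- The canonical representative of a nonzero associate class in `ℤ[i]`. -/
def IsCanon (z : GaussianInt) : Prop := 0 < z.re ∧ 0 ≤ z.im

/-- `Φ(a, q) = τ_q(a)/φ(q)`. -/
def Phi (a q : GaussianInt) : ℂ := gtau q a / (gphi q : ℂ)

/-- `Â_N^ω(α)`: the Fourier transform of the weighted sector average. -/
def Ahat (ω : Set Real.Angle) (l : ℝ) (N : ℕ) (α : ℂ) : ℂ :=
  ((2 * Real.pi / (l * N) : ℝ) : ℂ) *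
    ∑' n : {m : GaussianInt // Zsqrtd.norm m < (N : ℤ) ∧ argIn (toComplex m) ω},
      (gvm (n : GaussianInt) : ℂ) * e2 (cip (toComplex (n : GaussianInt)) α)

/-- `M̂_N^ω(β)`: the Fourier transform of the sector average. -/
def Mhat (ω : Set Real.Angle) (l : ℝ) (N : ℕ) (β : ℂ) : ℂ :=
  ((2 * Real.pi / (l * N) : ℝ) : ℂ) *
    ∑' n : {m : GaussianInt // Zsqrtd.norm m < (N : ℤ) ∧ argIn (toComplex m) ω},
      e2 (cip (toComplex (n : GaussianInt)) β)

/-- The tensor Fejér-type bump `η(ξ₁+iξ₂) = (1-|ξ₁|)₊ (1-|ξ₂|)₊`. -/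
def eta (ξ : ℂ) : ℝ := max 0 (1 - |ξ.re|) * max 0 (1 - |ξ.im|)

/-- `Δ_s(ξ) = η(16^s ξ)`. -/
def Delta (s : ℕ) (ξ : ℂ) : ℝ := eta ((16 : ℂ) ^ s * ξ)

/-- `Δ̌_{q₀}(n) = ∫_{[-1/2,1/2)²} Δ_{q₀}(ξ) e(⟨n, ξ⟩) dξ`. -/
def DeltaCheck (q₀ : ℕ) (n : GaussianInt) : ℂ :=
  ∫ p in (Set.Ico (-(1:ℝ)/2) (1/2)) ×ˢ (Set.Ico (-(1:ℝ)/2) (1/2)),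
    ((Delta q₀ ((p.1 : ℂ) + (p.2 : ℂ) * Complex.I) : ℝ) : ℂ) *
      e2 (cip (toComplex n) ((p.1 : ℂ) + (p.2 : ℂ) * Complex.I))

/-- The Low part `Lo_{Q,N}^ω` with `Q = 2^{q₀}`. -/
def Lo (ω : Set Real.Angle) (l : ℝ) (N : ℕ) (q₀ : ℕ) (x : GaussianInt) : ℂ :=
  (∑' y : GaussianInt, ((Msec ω l N y : ℝ) : ℂ) * DeltaCheck q₀ (x - y)) *
    ∑' q : {q : GaussianInt // IsCanon q ∧ (Zsqrtd.norm q : ℝ) < 2 ^ q₀},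
      ∑' a : Aq (q : GaussianInt),
        Phi (a : GaussianInt) (star (q : GaussianInt)) *
          e2 (cip (toComplex x) (toComplex (a : GaussianInt) / toComplex (q : GaussianInt)))

/-- Distance from `β ∈ ℂ` to the nearest Gaussian integer. -/
def distZi (β : ℂ) : ℝ := Metric.infDist β (Set.range fun n : GaussianInt => toComplex n)

/-- `q` is `Q`-smooth: squarefree with all prime factors of norm at most `Q`. -/
def QSmooth (Q : ℝ) (q : GaussianInt) : Prop :=
  Squarefree q ∧ ∀ ρ : GaussianInt, Irreducible ρ → ρ ∣ q → (Zsqrtd.norm ρ : ℝ) ≤ Q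

/-- The norm of a Gaussian integer, as a natural number. -/
def gnorm (z : GaussianInt) : ℕ := (Zsqrtd.norm z).natAbs

lemma gnorm_cast_int (z : GaussianInt) : (gnorm z : ℤ) = Zsqrtd.norm z :=
  abs_natCast_norm z

lemma gnorm_cast_real (z : GaussianInt) : (gnorm z : ℝ) = (Zsqrtd.norm z : ℝ) := by
  rw [← gnorm_cast_int]; simp

lemma gnorm_eq_normSq (z : GaussianInt) : (gnorm z : ℝ) = Complex.normSq (toComplex z) := by
  rw [gnorm_cast_real, intCast_real_norm]

lemma gnorm_eq_norm_sq (z : GaussianInt) : (gnorm z : ℝ) = ‖toComplex z‖ ^ 2 := by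
  rw [gnorm_eq_normSq, Complex.normSq_eq_norm_sq]

lemma gnorm_eq_sq_add_sq (z : GaussianInt) : (gnorm z : ℤ) = z.re ^ 2 + z.im ^ 2 := by
  rw [gnorm_cast_int, Zsqrtd.norm_def]; ring

@[simp] lemma gnorm_zero : gnorm 0 = 0 := by simp [gnorm]

@[simp] lemma gnorm_mul (z w : GaussianInt) : gnorm (z * w) = gnorm z * gnorm w := by
  simp [gnorm, Zsqrtd.norm_mul, Int.natAbs_mul]

lemma gnorm_eq_zero {z : GaussianInt} : gnorm z = 0 ↔ z = 0 := by
  rw [gnorm, Int.natAbs_eq_zero, GaussianInt.norm_eq_zero]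

lemma gnorm_pos {z : GaussianInt} (hz : z ≠ 0) : 0 < gnorm z :=
  Nat.pos_of_ne_zero (mt gnorm_eq_zero.1 hz)

lemma one_le_gnorm {z : GaussianInt} (hz : z ≠ 0) : (1 : ℝ) ≤ gnorm z := by
  exact_mod_cast gnorm_pos hz

lemma gnorm_eq_one {z : GaussianInt} : gnorm z = 1 ↔ IsUnit z := Zsqrtd.norm_eq_one_iff

lemma gnorm_star (z : GaussianInt) : gnorm (star z) = gnorm z := by
  simp [gnorm, Zsqrtd.norm_conj]

/-- The sup norm of a Gaussian integer. -/
def gsup (z : GaussianInt) : ℕ := max z.re.natAbs z.im.natAbs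

lemma gsup_sq_le (z : GaussianInt) : gsup z ^ 2 ≤ gnorm z := by
  zify
  rw [gnorm_eq_sq_add_sq]
  rcases max_choice z.re.natAbs z.im.natAbs with h | h <;> rw [gsup, h] <;>
    simp only [Int.natCast_natAbs, sq_abs] <;> nlinarith [sq_nonneg z.re, sq_nonneg z.im]

lemma gsup_eq_zero {z : GaussianInt} : gsup z = 0 ↔ z = 0 := by
  constructor
  · intro h
    have h1 : z.re = 0 ∧ z.im = 0 := by simp only [gsup] at h; omega
    exact Zsqrtd.ext h1.1 h1.2
  · rintro rfl; simp [gsup]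

lemma card_filter_gsup_le (s : Finset GaussianInt) {k : ℕ} (hk : k ≠ 0) :
    (s.filter fun z => gsup z = k).card ≤ 8 * k := by
  rw [← Int.card_box hk]
  refine Finset.card_le_card_of_injOn (fun z => (z.re, z.im)) ?_ ?_
  · intro z hz
    simp only [Finset.coe_filter, Set.mem_ofPred_eq] at hz
    simp only [Finset.mem_coe, Int.mem_box]
    exact hz.2
  · intro z _ w _ h
    simp only [Prod.mk.injEq] at h
    exact Zsqrtd.ext h.1 h.2

/-- Sums over Gaussian integers are dominated by sums over sup-norm shells. -/
lemma sum_le_sum_shells (s : Finset GaussianInt) (K : ℕ) (f : GaussianInt → ℝ) (g : ℕ → ℝ)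
    (h0 : ∀ z ∈ s, z ≠ 0) (hK : ∀ z ∈ s, gsup z ≤ K) (hf : ∀ z ∈ s, f z ≤ g (gsup z))
    (hg : ∀ k, 0 ≤ g k) :
    ∑ z ∈ s, f z ≤ ∑ k ∈ Finset.Icc 1 K, 8 * (k : ℝ) * g k := by
  have hmaps : ∀ z ∈ s, gsup z ∈ Finset.Icc 1 K := fun z hz => by
    rw [Finset.mem_Icc]
    exact ⟨Nat.pos_of_ne_zero (mt gsup_eq_zero.1 (h0 z hz)), hK z hz⟩
  rw [← Finset.sum_fiberwise_of_maps_to hmaps]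
  refine Finset.sum_le_sum fun k hk => ?_
  have hk0 : k ≠ 0 := by rw [Finset.mem_Icc] at hk; omega
  calc ∑ z ∈ s with gsup z = k, f z ≤ ∑ z ∈ s with gsup z = k, g k := by
        refine Finset.sum_le_sum fun z hz => ?_
        rw [Finset.mem_filter] at hz
        rw [← hz.2]; exact hf z hz.1
    _ = ((s.filter fun z => gsup z = k).card : ℝ) * g k := by simp
    _ ≤ 8 * (k : ℝ) * g k := by
        gcongr
        · exact hg k
        · exact_mod_cast card_filter_gsup_le s hk0

lemma gsup_le_sqrt {z : GaussianInt} {x : ℝ} (hx : (gnorm z : ℝ) ≤ x) : gsup z ≤ ⌊√x⌋₊ := by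
  apply Nat.le_floor
  apply Real.le_sqrt_of_sq_le
  refine le_trans ?_ hx
  exact_mod_cast gsup_sq_le z

lemma finite_gnorm_le (x : ℝ) : {z : GaussianInt | z ≠ 0 ∧ (gnorm z : ℝ) ≤ x}.Finite := by
  have h : Set.Finite ((Finset.Icc (-(⌊√x⌋₊ : ℤ)) ⌊√x⌋₊ ×ˢ Finset.Icc (-(⌊√x⌋₊ : ℤ)) ⌊√x⌋₊ :
      Finset (ℤ × ℤ)) : Set (ℤ × ℤ)) := Finset.finite_toSet _
  refine Set.Finite.of_finite_image (f := fun z : GaussianInt => (z.re, z.im)) (h.subset ?_) ?_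
  · rintro _ ⟨z, hz, rfl⟩
    have := gsup_le_sqrt hz.2
    simp only [gsup] at this
    simp only [Finset.coe_product, Finset.coe_Icc, Set.mem_prod, Set.mem_Icc]
    omega
  · intro z _ w _ h
    simp only [Prod.mk.injEq] at h
    exact Zsqrtd.ext h.1 h.2

/-- The nonzero Gaussian integers of norm at most `x`. -/
def gball (x : ℝ) : Finset GaussianInt := (finite_gnorm_le x).toFinset

@[simp] lemma mem_gball {x : ℝ} {z : GaussianInt} : z ∈ gball x ↔ z ≠ 0 ∧ (gnorm z : ℝ) ≤ x := by
  simp [gball]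

lemma gball_mono {x y : ℝ} (h : x ≤ y) : gball x ⊆ gball y := fun z hz => by
  rw [mem_gball] at *; exact ⟨hz.1, hz.2.trans h⟩

lemma gball_eq_empty {x : ℝ} (h : x < 1) : gball x = ∅ := by
  ext z
  simp only [mem_gball, Finset.notMem_empty, iff_false, not_and, not_le]
  intro hz; exact h.trans_le (one_le_gnorm hz)

lemma card_gball_le {x : ℝ} (hx : 0 ≤ x) : ((gball x).card : ℝ) ≤ 8 * x := by
  have h := sum_le_sum_shells (gball x) ⌊√x⌋₊ (fun _ => 1) (fun _ => 1)
    (fun z hz => (mem_gball.1 hz).1) (fun z hz => gsup_le_sqrt (mem_gball.1 hz).2)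
    (fun _ _ => le_rfl) (fun _ => zero_le_one)
  simp only [Finset.sum_const, nsmul_eq_mul, mul_one] at h
  refine h.trans ?_
  calc ∑ k ∈ Finset.Icc 1 ⌊√x⌋₊, 8 * (k : ℝ) ≤ ∑ k ∈ Finset.Icc 1 ⌊√x⌋₊, 8 * √x := by
        refine Finset.sum_le_sum fun k hk => ?_
        have := (Nat.le_floor_iff (Real.sqrt_nonneg x)).1 (Finset.mem_Icc.1 hk).2
        linarith
    _ = ⌊√x⌋₊ * (8 * √x) := by simp
    _ ≤ √x * (8 * √x) := by gcongr; exact Nat.floor_le (Real.sqrt_nonneg x)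
    _ = 8 * x := by nlinarith [Real.mul_self_sqrt hx]

/-- The divisors of a nonzero Gaussian integer. -/
def gdivs (n : GaussianInt) : Finset GaussianInt := (gball (gnorm n)).filter (· ∣ n)

lemma gnorm_le_of_dvd {d n : GaussianInt} (hn : n ≠ 0) (h : d ∣ n) : gnorm d ≤ gnorm n := by
  obtain ⟨e, rfl⟩ := h
  rw [gnorm_mul]
  exact Nat.le_mul_of_pos_right _ (gnorm_pos (right_ne_zero_of_mul hn))

lemma mem_gdivs {d n : GaussianInt} (hn : n ≠ 0) : d ∈ gdivs n ↔ d ∣ n := by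
  rw [gdivs, Finset.mem_filter, mem_gball]
  refine ⟨fun h => h.2, fun h => ⟨⟨ne_zero_of_dvd_ne_zero hn h, ?_⟩, h⟩⟩
  exact_mod_cast gnorm_le_of_dvd hn h

/-- Reindexing the multiples of `d` in a ball. -/
lemma sum_gball_filter_dvd {M : Type*} [AddCommMonoid M] (y : ℝ) {d : GaussianInt} (hd : d ≠ 0)
    (g : GaussianInt → M) :
    ∑ m ∈ gball y with d ∣ m, g m = ∑ f ∈ gball (y / gnorm d), g (d * f) := by
  have hd' : (0 : ℝ) < gnorm d := by exact_mod_cast gnorm_pos hd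
  symm
  refine Finset.sum_bij (fun f _ => d * f) ?_ ?_ ?_ ?_
  · intro f hf
    rw [mem_gball, le_div_iff₀ hd'] at hf
    rw [Finset.mem_filter, mem_gball, gnorm_mul]
    push_cast
    exact ⟨⟨mul_ne_zero hd hf.1, by linarith [hf.2]⟩, dvd_mul_right _ _⟩
  · intro f _ f' _ h; exact mul_left_cancel₀ hd h
  · intro m hm
    rw [Finset.mem_filter, mem_gball] at hm
    obtain ⟨⟨hm0, hm1⟩, f, rfl⟩ := hm
    refine ⟨f, ?_, rfl⟩
    rw [mem_gball, le_div_iff₀ hd']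
    rw [gnorm_mul] at hm1
    push_cast at hm1
    exact ⟨right_ne_zero_of_mul hm0, by linarith⟩
  · intros; rfl

lemma sum_gball_gdivs {M : Type*} [AddCommMonoid M] (y : ℝ) (H : GaussianInt → GaussianInt → M) :
    ∑ m ∈ gball y, ∑ d ∈ gdivs m, H d m =
      ∑ d ∈ gball y, ∑ f ∈ gball (y / gnorm d), H d (d * f) := by
  have h1 : ∀ d ∈ gball y, ∑ f ∈ gball (y / gnorm d), H d (d * f) =
      ∑ m ∈ gball y with d ∣ m, H d m := fun d hd =>
    (sum_gball_filter_dvd y (mem_gball.1 hd).1 (H d)).symm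
  rw [Finset.sum_congr rfl h1]
  refine Finset.sum_comm' fun m d => ?_
  rw [Finset.mem_filter]
  constructor
  · rintro ⟨hm, hd⟩
    have hm' := mem_gball.1 hm
    rw [mem_gdivs hm'.1] at hd
    refine ⟨⟨hm, hd⟩, mem_gball.2 ⟨ne_zero_of_dvd_ne_zero hm'.1 hd, le_trans ?_ hm'.2⟩⟩
    exact_mod_cast gnorm_le_of_dvd hm'.1 hd
  · rintro ⟨⟨hm, hd⟩, _⟩
    exact ⟨hm, (mem_gdivs (mem_gball.1 hm).1).2 hd⟩

/-- Divisors of `p * n`: those of `n` prime to `p`, and `p` times the divisors of `n`. -/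
lemma sum_gdivs_prime_mul {M : Type*} [AddCommMonoid M] {p n : GaussianInt} (hp : Prime p)
    (hn : n ≠ 0) (f : GaussianInt → M) :
    ∑ d ∈ gdivs (p * n), f d = ∑ d ∈ gdivs n with ¬ p ∣ d, f d + ∑ d ∈ gdivs n, f (p * d) := by
  have hpn : p * n ≠ 0 := mul_ne_zero hp.ne_zero hn
  rw [← Finset.sum_filter_not_add_sum_filter (gdivs (p * n)) (fun d => p ∣ d)]
  congr 1
  · refine Finset.sum_congr ?_ fun _ _ => rfl
    ext d
    rw [Finset.mem_filter, Finset.mem_filter, mem_gdivs hpn, mem_gdivs hn]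
    refine and_congr_left fun hpd => ⟨fun h => ?_, fun h => h.mul_left p⟩
    obtain ⟨e, he⟩ := h
    have hpe : p ∣ d * e := ⟨n, he.symm⟩
    obtain ⟨e', rfl⟩ := (hp.dvd_or_dvd hpe).resolve_left hpd
    refine ⟨e', mul_left_cancel₀ hp.ne_zero ?_⟩
    rw [he]; ring
  · symm
    refine Finset.sum_bij (fun d _ => p * d) ?_ ?_ ?_ ?_
    · intro d hd
      rw [mem_gdivs hn] at hd
      rw [Finset.mem_filter, mem_gdivs hpn]
      exact ⟨mul_dvd_mul_left p hd, dvd_mul_right _ _⟩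
    · intro d _ d' _ h; exact mul_left_cancel₀ hp.ne_zero h
    · intro d hd
      rw [Finset.mem_filter, mem_gdivs hpn] at hd
      obtain ⟨hd, e, rfl⟩ := hd
      exact ⟨e, (mem_gdivs hn).2 ((mul_dvd_mul_iff_left hp.ne_zero).1 hd), rfl⟩
    · intros; rfl

/-- The number of units of `ℤ[i]`. -/
def unitCount : ℝ := ((gball 1).card : ℝ)

lemma mem_gball_one {z : GaussianInt} : z ∈ gball 1 ↔ IsUnit z := by
  rw [mem_gball, ← gnorm_eq_one]
  constructor
  · rintro ⟨h0, h1⟩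
    have h2 : gnorm z ≤ 1 := by exact_mod_cast h1
    have := gnorm_pos h0
    omega
  · intro h
    refine ⟨?_, by simp [h]⟩
    rintro rfl; simp at h

lemma one_le_unitCount : 1 ≤ unitCount := by
  have h : (1 : GaussianInt) ∈ gball 1 := mem_gball_one.2 isUnit_one
  have : 0 < (gball 1).card := Finset.card_pos.2 ⟨1, h⟩
  rw [unitCount]; exact_mod_cast this

lemma unitCount_pos : 0 < unitCount := zero_lt_one.trans_le one_le_unitCount

lemma unitCount_le : unitCount ≤ 8 := by
  simpa [unitCount] using card_gball_le zero_le_one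

lemma gdivs_unit {u : GaussianInt} (hu : IsUnit u) : gdivs u = gball 1 := by
  ext d
  rw [mem_gdivs hu.ne_zero, mem_gball_one]
  exact ⟨fun h => isUnit_of_dvd_unit h hu, fun h => h.dvd⟩

/-- The real-valued Möbius function on `ℤ[i]`. -/
def gmob (z : GaussianInt) : ℝ := (UniqueFactorizationMonoid.moebius z : ℝ)

lemma abs_gmob_le (z : GaussianInt) : |gmob z| ≤ 1 := by
  by_cases h : Squarefree z
  · simp [gmob, h.moebius_eq]
  · simp [gmob, UniqueFactorizationMonoid.moebius_of_not_squarefree h]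

lemma gmob_unit {u : GaussianInt} (hu : IsUnit u) : gmob u = 1 := by
  simp [gmob, hu.moebius_eq]

lemma gmob_mul {r d : GaussianInt} (h : IsRelPrime r d) : gmob (r * d) = gmob r * gmob d := by
  simp [gmob, h.moebius_mul]

lemma gmob_mul_of_not_isRelPrime {r d : GaussianInt} (h : ¬ IsRelPrime r d) :
    gmob (r * d) = 0 := by
  rw [gmob, UniqueFactorizationMonoid.moebius_of_not_squarefree, Int.cast_zero]
  intro hs
  exact h (squarefree_mul_iff.1 hs).1

lemma isRelPrime_prime_iff {p d : GaussianInt} (hp : Prime p) : IsRelPrime p d ↔ ¬ p ∣ d :=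
  hp.irreducible.isRelPrime_iff_not_dvd

lemma gmob_prime_mul {p d : GaussianInt} (hp : Prime p) :
    gmob (p * d) = if p ∣ d then 0 else - gmob d := by
  split_ifs with h
  · exact gmob_mul_of_not_isRelPrime (fun h' => (isRelPrime_prime_iff hp).1 h' h)
  · rw [gmob_mul ((isRelPrime_prime_iff hp).2 h), gmob, hp.irreducible.moebius_eq]
    simp

lemma sum_gmob {n : GaussianInt} (hn : n ≠ 0) :
    ∑ d ∈ gdivs n, gmob d = if IsUnit n then unitCount else 0 := by
  induction n using UniqueFactorizationMonoid.induction_on_prime with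
  | h₁ => exact absurd rfl hn
  | h₂ u hu =>
    rw [if_pos hu, gdivs_unit hu, Finset.sum_congr rfl fun d hd => gmob_unit (mem_gball_one.1 hd)]
    simp [unitCount]
  | h₃ n p hn0 hp _ =>
    rw [if_neg (fun h => hp.not_isUnit (isUnit_of_mul_isUnit_left h)), sum_gdivs_prime_mul hp hn0,
      Finset.sum_filter, ← Finset.sum_add_distrib]
    refine Finset.sum_eq_zero fun d _ => ?_
    rw [gmob_prime_mul hp]
    split_ifs <;> simp

lemma sum_gmob_isRelPrime_mem {n : GaussianInt} (r : GaussianInt) (hn : n ≠ 0) :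
    0 ≤ ∑ d ∈ gdivs n, (if IsRelPrime d r then gmob d else 0) ∧
      ∑ d ∈ gdivs n, (if IsRelPrime d r then gmob d else 0) ≤ unitCount := by
  induction n using UniqueFactorizationMonoid.induction_on_prime with
  | h₁ => exact absurd rfl hn
  | h₂ u hu =>
    have h1 : ∀ d ∈ gball 1, (if IsRelPrime d r then gmob d else 0) = 1 := fun d hd => by
      have hd' := mem_gball_one.1 hd
      rw [if_pos hd'.isRelPrime_left, gmob_unit hd']
    rw [gdivs_unit hu, Finset.sum_congr rfl h1]
    simp [unitCount]
  | h₃ n p hn0 hp ih =>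
    rw [sum_gdivs_prime_mul hp hn0, Finset.sum_filter, ← Finset.sum_add_distrib]
    by_cases hpr : p ∣ r
    · rw [Finset.sum_congr rfl (g := fun d => if IsRelPrime d r then gmob d else 0)]
      · exact ih hn0
      · intro d _
        have h1 : ¬ IsRelPrime (p * d) r := fun h =>
          hp.not_isUnit (h (dvd_mul_right _ _) hpr)
        rw [if_neg h1, add_zero]
        split_ifs with h2 h3 h3
        · exact absurd (h3 h2 hpr) hp.not_isUnit
        · rfl
        · rfl
        · rfl
    · rw [Finset.sum_eq_zero]
      · exact ⟨le_rfl, unitCount_pos.le⟩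
      · intro d _
        have h1 : IsRelPrime (p * d) r ↔ IsRelPrime d r := by
          rw [IsRelPrime.mul_left_iff]
          exact and_iff_right ((isRelPrime_prime_iff hp).2 hpr)
        rw [gmob_prime_mul hp, h1]
        split_ifs <;> simp

lemma gvm_eq {n ρ u : GaussianInt} {k : ℕ} (hρ : Irreducible ρ) (hk : 1 ≤ k) (hu : IsUnit u)
    (hn : n = u * ρ ^ k) : gvm n = Real.log (gnorm ρ) := by
  have h : ∃ ρ : GaussianInt, Irreducible ρ ∧
      ∃ k : ℕ, 1 ≤ k ∧ ∃ u : GaussianInt, IsUnit u ∧ n = u * ρ ^ k := ⟨ρ, hρ, k, hk, u, hu, hn⟩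
  rw [gvm, dif_pos h, ← gnorm_eq_normSq]
  obtain ⟨hρ', k', hk', u', hu', hn'⟩ := h.choose_spec
  generalize h.choose = ρ' at *
  have hd : ρ ∣ ρ' := by
    have h1 : ρ ∣ u' * ρ' ^ k' := by
      rw [← hn', hn]; exact (dvd_pow_self ρ (by omega)).mul_left u
    rcases hρ.prime.dvd_or_dvd h1 with h2 | h2
    · exact absurd (isUnit_of_dvd_unit h2 hu') hρ.not_isUnit
    · exact hρ.prime.dvd_of_dvd_pow h2
  obtain ⟨v, rfl⟩ := hd
  have hv : IsUnit v := (hρ'.isUnit_or_isUnit rfl).resolve_left hρ.not_isUnit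
  rw [gnorm_mul, gnorm_eq_one.2 hv, mul_one]

lemma gvm_eq_zero {n : GaussianInt} (h : ¬ ∃ ρ : GaussianInt, Irreducible ρ ∧
      ∃ k : ℕ, 1 ≤ k ∧ ∃ u : GaussianInt, IsUnit u ∧ n = u * ρ ^ k) : gvm n = 0 := by
  rw [gvm, dif_neg h]

lemma gvm_unit {u : GaussianInt} (hu : IsUnit u) : gvm u = 0 := by
  refine gvm_eq_zero ?_
  rintro ⟨ρ, hρ, k, hk, v, _, rfl⟩
  have := isUnit_of_mul_isUnit_right hu
  exact hρ.not_isUnit ((isUnit_pow_iff (by omega)).1 this)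

lemma gvm_zero : gvm 0 = 0 := by
  refine gvm_eq_zero ?_
  rintro ⟨ρ, hρ, k, _, v, hv, h⟩
  exact mul_ne_zero hv.ne_zero (pow_ne_zero _ hρ.ne_zero) h.symm

lemma gvm_nonneg (n : GaussianInt) : 0 ≤ gvm n := by
  by_cases h : ∃ ρ : GaussianInt, Irreducible ρ ∧
      ∃ k : ℕ, 1 ≤ k ∧ ∃ u : GaussianInt, IsUnit u ∧ n = u * ρ ^ k
  · obtain ⟨ρ, hρ, k, hk, u, hu, hn⟩ := h
    rw [gvm_eq hρ hk hu hn]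
    exact Real.log_natCast_nonneg _
  · rw [gvm_eq_zero h]

lemma gvm_prime_mul_of_dvd {p d : GaussianInt} (hp : Prime p) (h : p ∣ d) :
    gvm (p * d) = gvm d := by
  by_cases hd : ∃ ρ : GaussianInt, Irreducible ρ ∧
      ∃ k : ℕ, 1 ≤ k ∧ ∃ u : GaussianInt, IsUnit u ∧ d = u * ρ ^ k
  · obtain ⟨ρ, hρ, k, hk, u, hu, rfl⟩ := hd
    rw [gvm_eq hρ hk hu rfl]
    have h1 : p ∣ ρ := by
      rcases hp.dvd_or_dvd h with h2 | h2
      · exact absurd (isUnit_of_dvd_unit h2 hu) hp.not_isUnit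
      · exact hp.dvd_of_dvd_pow h2
    obtain ⟨v, hv⟩ := (hp.irreducible.associated_of_dvd hρ h1).symm
    rw [gvm_eq (u := u * v) (k := k + 1) hρ (by omega) (hu.mul v.isUnit)]
    rw [← hv]; ring
  · rw [gvm_eq_zero hd, gvm_eq_zero]
    rintro ⟨ρ, hρ, k, hk, u, hu, hpd⟩
    have h1 : p ∣ ρ := by
      rcases hp.dvd_or_dvd (show p ∣ u * ρ ^ k from hpd ▸ dvd_mul_right _ _) with h2 | h2
      · exact absurd (isUnit_of_dvd_unit h2 hu) hp.not_isUnit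
      · exact hp.dvd_of_dvd_pow h2
    obtain ⟨v, rfl⟩ := hp.irreducible.associated_of_dvd hρ h1
    obtain ⟨k, rfl⟩ : ∃ j, k = j + 1 := ⟨k - 1, by omega⟩
    have h3 : d = u * v ^ (k + 1) * p ^ k := by
      apply mul_left_cancel₀ hp.ne_zero
      rw [hpd]; ring
    refine hd ⟨p, hp.irreducible, k, ?_, u * v ^ (k + 1), hu.mul (v.isUnit.pow _), h3⟩
    rcases Nat.eq_zero_or_pos k with rfl | hk
    · rw [h3, pow_zero, mul_one] at h
      exact absurd (isUnit_of_dvd_unit h (hu.mul (v.isUnit.pow _))) hp.not_isUnit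
    · exact hk

lemma gvm_prime_mul_of_not_dvd {p d : GaussianInt} (hp : Prime p) (h : ¬ p ∣ d) :
    gvm (p * d) = if IsUnit d then Real.log (gnorm p) else 0 := by
  split_ifs with hd
  · exact gvm_eq (k := 1) hp.irreducible le_rfl hd (by ring)
  · refine gvm_eq_zero ?_
    rintro ⟨ρ, hρ, k, hk, u, hu, hpd⟩
    have h1 : p ∣ ρ := by
      rcases hp.dvd_or_dvd (show p ∣ u * ρ ^ k from hpd ▸ dvd_mul_right _ _) with h2 | h2
      · exact absurd (isUnit_of_dvd_unit h2 hu) hp.not_isUnit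
      · exact hp.dvd_of_dvd_pow h2
    obtain ⟨v, rfl⟩ := hp.irreducible.associated_of_dvd hρ h1
    obtain ⟨k, rfl⟩ : ∃ j, k = j + 1 := ⟨k - 1, by omega⟩
    have h3 : d = u * v ^ (k + 1) * p ^ k := by
      apply mul_left_cancel₀ hp.ne_zero
      rw [hpd]; ring
    rcases Nat.eq_zero_or_pos k with rfl | hk
    · rw [h3, pow_zero, mul_one] at hd
      exact hd (hu.mul (v.isUnit.pow _))
    · exact h (h3 ▸ (dvd_pow_self p hk.ne').mul_left _)

lemma sum_gvm {n : GaussianInt} (hn : n ≠ 0) :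
    ∑ d ∈ gdivs n, gvm d = unitCount * Real.log (gnorm n) := by
  induction n using UniqueFactorizationMonoid.induction_on_prime with
  | h₁ => exact absurd rfl hn
  | h₂ u hu =>
    rw [gdivs_unit hu, Finset.sum_congr rfl fun d hd => gvm_unit (mem_gball_one.1 hd),
      gnorm_eq_one.2 hu]
    simp
  | h₃ n p hn0 hp ih =>
    have h1 : ∀ d ∈ gdivs n, (if ¬ p ∣ d then gvm d else 0) + gvm (p * d) =
        gvm d + if IsUnit d then Real.log (gnorm p) else 0 := fun d _ => by
      by_cases h : p ∣ d
      · rw [if_neg (not_not.2 h), gvm_prime_mul_of_dvd hp h, if_neg, zero_add, add_zero]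
        exact fun hd => hp.not_isUnit (isUnit_of_dvd_unit h hd)
      · rw [if_pos h, gvm_prime_mul_of_not_dvd hp h]
    have h2 : ∑ d ∈ gdivs n, (if IsUnit d then Real.log (gnorm p) else 0) =
        unitCount * Real.log (gnorm p) := by
      rw [← Finset.sum_filter, Finset.sum_const, nsmul_eq_mul, unitCount]
      congr 3
      ext d
      rw [Finset.mem_filter, mem_gdivs hn0, mem_gball_one]
      exact ⟨fun h => h.2, fun h => ⟨h.dvd, h⟩⟩
    rw [sum_gdivs_prime_mul hp hn0, Finset.sum_filter, ← Finset.sum_add_distrib,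
      Finset.sum_congr rfl h1, Finset.sum_add_distrib, ih hn0, h2, gnorm_mul, Nat.cast_mul,
      Real.log_mul]
    · ring
    · exact_mod_cast (gnorm_pos hp.ne_zero).ne'
    · exact_mod_cast (gnorm_pos hn0).ne'

lemma gvm_le_log {n : GaussianInt} (hn : n ≠ 0) : gvm n ≤ Real.log (gnorm n) := by
  by_cases h : ∃ ρ : GaussianInt, Irreducible ρ ∧
      ∃ k : ℕ, 1 ≤ k ∧ ∃ u : GaussianInt, IsUnit u ∧ n = u * ρ ^ k
  · obtain ⟨ρ, hρ, k, hk, u, hu, h⟩ := h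
    rw [gvm_eq hρ hk hu h]
    have h1 : ρ ∣ n := by rw [h]; exact (dvd_pow_self ρ (by omega)).mul_left u
    apply Real.log_le_log
    · exact_mod_cast gnorm_pos hρ.ne_zero
    · exact_mod_cast gnorm_le_of_dvd hn h1
  · rw [gvm_eq_zero h]
    exact Real.log_natCast_nonneg _

/-- The Dirichlet series `∑ μ(d) N(d)^{-s}` over the divisors of `r`. -/
def mobSum (s : ℝ) (r : GaussianInt) : ℝ := ∑ d ∈ gdivs r, gmob d * (gnorm d : ℝ) ^ (-s)

lemma mobSum_prime_mul {s : ℝ} {p r : GaussianInt} (hp : Prime p) (hr : r ≠ 0) :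
    mobSum s (p * r) = if p ∣ r then mobSum s r else (1 - (gnorm p : ℝ) ^ (-s)) * mobSum s r := by
  have key : ∀ n : GaussianInt, n ≠ 0 → mobSum s (p * n) =
      (1 - (gnorm p : ℝ) ^ (-s)) * ∑ d ∈ gdivs n with ¬ p ∣ d, gmob d * (gnorm d : ℝ) ^ (-s) := by
    intro n hn
    rw [mobSum, sum_gdivs_prime_mul hp hn, sub_mul, one_mul, sub_eq_add_neg]
    congr 1
    rw [Finset.sum_filter, Finset.mul_sum, ← Finset.sum_neg_distrib]
    refine Finset.sum_congr rfl fun d _ => ?_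
    rw [gmob_prime_mul hp, gnorm_mul, Nat.cast_mul,
      Real.mul_rpow (Nat.cast_nonneg _) (Nat.cast_nonneg _)]
    split_ifs <;> simp_all
    ring
  split_ifs with h
  · obtain ⟨r, rfl⟩ := h
    have hr0 : r ≠ 0 := right_ne_zero_of_mul hr
    rw [key _ hr, key _ hr0, Finset.sum_filter, sum_gdivs_prime_mul hp hr0]
    have h0 : ∑ d ∈ gdivs r, (if ¬ p ∣ p * d then
        gmob (p * d) * (gnorm (p * d) : ℝ) ^ (-s) else 0) = 0 :=
      Finset.sum_eq_zero fun d _ => if_neg (not_not.2 (dvd_mul_right p d))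
    rw [h0, add_zero, Finset.sum_filter, Finset.sum_filter]
    congr 1
    refine Finset.sum_congr rfl fun d _ => ?_
    split_ifs <;> rfl
  · rw [key _ hr, mobSum, Finset.filter_true_of_mem]
    intro d hd hpd
    exact h (hpd.trans ((mem_gdivs hr).1 hd))

lemma mobSum_unit {s : ℝ} {u : GaussianInt} (hu : IsUnit u) : mobSum s u = unitCount := by
  have h1 : ∀ d ∈ gball 1, gmob d * (gnorm d : ℝ) ^ (-s) = 1 := fun d hd => by
    have hd' := mem_gball_one.1 hd
    rw [gmob_unit hd', gnorm_eq_one.2 hd']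
    simp
  rw [mobSum, gdivs_unit hu, Finset.sum_congr rfl h1]
  simp [unitCount]

lemma one_lt_gnorm {p : GaussianInt} (hp : Prime p) : (1 : ℝ) < gnorm p := by
  have h1 := gnorm_pos hp.ne_zero
  have h2 : gnorm p ≠ 1 := fun h => hp.not_isUnit (gnorm_eq_one.1 h)
  exact_mod_cast (show 1 < gnorm p by omega)

lemma mobSum_mem {s : ℝ} (hs : 0 < s) {r : GaussianInt} (hr : r ≠ 0) :
    0 ≤ mobSum s r ∧ mobSum s r ≤ unitCount := by
  induction r using UniqueFactorizationMonoid.induction_on_prime with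
  | h₁ => exact absurd rfl hr
  | h₂ u hu => rw [mobSum_unit hu]; exact ⟨unitCount_pos.le, le_rfl⟩
  | h₃ n p hn0 hp ih =>
    rw [mobSum_prime_mul hp hn0]
    split_ifs
    · exact ih hn0
    · obtain ⟨h1, h2⟩ := ih hn0
      have h3 : (gnorm p : ℝ) ^ (-s) ≤ 1 :=
        Real.rpow_le_one_of_one_le_of_nonpos (one_lt_gnorm hp).le (by linarith)
      have h4 : 0 ≤ (gnorm p : ℝ) ^ (-s) := by positivity
      constructor
      · exact mul_nonneg (by linarith) h1
      · nlinarith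

/-- The Jordan totient: the Dirichlet inverse transform of `N(·)^s`. -/
lemma sum_jordan {s : ℝ} {n : GaussianInt} (hn : n ≠ 0) :
    ∑ r ∈ gdivs n, (gnorm r : ℝ) ^ s * mobSum s r = unitCount ^ 2 * (gnorm n : ℝ) ^ s := by
  induction n using UniqueFactorizationMonoid.induction_on_prime with
  | h₁ => exact absurd rfl hn
  | h₂ u hu =>
    have h1 : ∀ d ∈ gball 1, (gnorm d : ℝ) ^ s * mobSum s d = unitCount := fun d hd => by
      have hd' := mem_gball_one.1 hd
      rw [mobSum_unit hd', gnorm_eq_one.2 hd']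
      simp
    rw [gdivs_unit hu, Finset.sum_congr rfl h1, gnorm_eq_one.2 hu]
    simp [unitCount, sq]
  | h₃ n p hn0 hp ih =>
    rw [sum_gdivs_prime_mul hp hn0, Finset.sum_filter, ← Finset.sum_add_distrib, gnorm_mul,
      Nat.cast_mul, Real.mul_rpow (Nat.cast_nonneg _) (Nat.cast_nonneg _), mul_left_comm,
      ← ih hn0, Finset.mul_sum]
    refine Finset.sum_congr rfl fun d hd => ?_
    have hd0 : d ≠ 0 := ne_zero_of_dvd_ne_zero hn0 ((mem_gdivs hn0).1 hd)
    have hp0 : (0 : ℝ) < gnorm p := zero_lt_one.trans (one_lt_gnorm hp)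
    have h5 : (gnorm p : ℝ) ^ s * (gnorm p : ℝ) ^ (-s) = 1 := by
      rw [← Real.rpow_add hp0]; simp
    rw [mobSum_prime_mul hp hd0, gnorm_mul, Nat.cast_mul,
      Real.mul_rpow (Nat.cast_nonneg _) (Nat.cast_nonneg _)]
    split_ifs with h1
    · ring
    · linear_combination (-(gnorm d : ℝ) ^ s * mobSum s d) * h5

/-- The unit square with lower left corner `z`. -/
def unitCell (z : GaussianInt) : Set ℂ := {w | ⌊w.re⌋ = z.re ∧ ⌊w.im⌋ = z.im}

lemma unitCell_eq (z : GaussianInt) : unitCell z = Complex.measurableEquivRealProd ⁻¹'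
    (Set.Ico (z.re : ℝ) (z.re + 1) ×ˢ Set.Ico (z.im : ℝ) (z.im + 1)) := by
  ext w
  simp [unitCell, Int.floor_eq_iff, Complex.measurableEquivRealProd_apply]

lemma measurableSet_unitCell (z : GaussianInt) : MeasurableSet (unitCell z) := by
  rw [unitCell_eq]
  exact Complex.measurableEquivRealProd.measurable
    (measurableSet_Ico.prod measurableSet_Ico)

lemma volume_unitCell (z : GaussianInt) : volume (unitCell z) = 1 := by
  rw [unitCell_eq, Complex.volume_preserving_equiv_real_prod.measure_preimage
    (measurableSet_Ico.prod measurableSet_Ico).nullMeasurableSet,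
    Measure.volume_eq_prod, Measure.prod_prod]
  simp

lemma unitCell_disjoint {z w : GaussianInt} (h : z ≠ w) : Disjoint (unitCell z) (unitCell w) := by
  rw [Set.disjoint_left]
  rintro x ⟨h1, h2⟩ ⟨h3, h4⟩
  exact h (Zsqrtd.ext (h1.symm.trans h3) (h2.symm.trans h4))

lemma norm_sub_le_of_mem_unitCell {z : GaussianInt} {w : ℂ} (h : w ∈ unitCell z) :
    ‖w - toComplex z‖ ≤ √2 := by
  obtain ⟨h1, h2⟩ := h
  rw [Int.floor_eq_iff] at h1 h2
  apply Real.le_sqrt_of_sq_le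
  rw [← Complex.normSq_eq_norm_sq, Complex.normSq_apply]
  simp only [Complex.sub_re, Complex.sub_im, ← GaussianInt.intCast_re, ← GaussianInt.intCast_im]
  nlinarith

lemma volume_iUnion_unitCell (F : Finset GaussianInt) :
    volume (⋃ z ∈ F, unitCell z) = (F.card : ℝ≥0∞) := by
  rw [measure_biUnion_finset (fun z _ w _ h => unitCell_disjoint h)
    (fun z _ => measurableSet_unitCell z)]
  simp [volume_unitCell]

/-- Counting lattice points in a disk. -/
lemma abs_card_gball_sub_le {y : ℝ} (hy : 1 ≤ y) :
    |((gball y).card : ℝ) - π * y| ≤ 20 * √y := by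
  set F : Finset GaussianInt := insert 0 (gball y) with hF
  have hcard : (F.card : ℝ) = (gball y).card + 1 := by
    rw [hF, Finset.card_insert_of_notMem (by simp)]; push_cast; ring
  have hmemF : ∀ z : GaussianInt, z ∈ F ↔ ‖toComplex z‖ ≤ √y := by
    intro z
    rw [hF, Finset.mem_insert, mem_gball, Real.le_sqrt (norm_nonneg _) (by linarith),
      ← gnorm_eq_norm_sq]
    by_cases hz : z = 0
    · subst hz; simp; linarith
    · simp [hz]
  have hs1 : 1 ≤ √y := Real.one_le_sqrt.2 hy
  have hsy : √y * √y = y := Real.mul_self_sqrt (by linarith)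
  have h2 : √2 * √2 = 2 := Real.mul_self_sqrt (by norm_num)
  have h2' : √2 ≤ 1.42 := Real.sqrt_le_iff.2 ⟨by norm_num, by norm_num⟩
  have h20 : 0 ≤ √2 := Real.sqrt_nonneg _
  have hpi : π < 3.15 := Real.pi_lt_d2
  have hpi0 : 3 < π := Real.pi_gt_three
  have hup : (F.card : ℝ) ≤ (√y + √2) ^ 2 * π := by
    have h : volume (⋃ z ∈ F, unitCell z) ≤ volume (Metric.closedBall (0 : ℂ) (√y + √2)) := by
      refine measure_mono (Set.iUnion₂_subset fun z hz w hw => ?_)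
      rw [mem_closedBall_zero_iff]
      calc ‖w‖ = ‖toComplex z + (w - toComplex z)‖ := by ring_nf
        _ ≤ _ := (norm_add_le _ _).trans
          (add_le_add ((hmemF z).1 hz) (norm_sub_le_of_mem_unitCell hw))
    rw [volume_iUnion_unitCell, Complex.volume_closedBall] at h
    have h' := ENNReal.toReal_mono (by finiteness) h
    simpa [ENNReal.toReal_ofReal, show 0 ≤ √y + √2 by positivity] using h'
  have hlow : √2 ≤ √y → (√y - √2) ^ 2 * π ≤ F.card := by
    intro hle
    have h : volume (Metric.ball (0 : ℂ) (√y - √2)) ≤ volume (⋃ z ∈ F, unitCell z) := by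
      refine measure_mono fun w hw => ?_
      rw [mem_ball_zero_iff] at hw
      have hz : w ∈ unitCell ⟨⌊w.re⌋, ⌊w.im⌋⟩ := ⟨rfl, rfl⟩
      refine Set.mem_iUnion₂.2 ⟨⟨⌊w.re⌋, ⌊w.im⌋⟩, (hmemF _).2 ?_, hz⟩
      have h3 := norm_sub_le_of_mem_unitCell hz
      have h4 := norm_sub_norm_le (toComplex ⟨⌊w.re⌋, ⌊w.im⌋⟩) w
      rw [norm_sub_rev] at h4
      linarith
    rw [volume_iUnion_unitCell, Complex.volume_ball] at h
    have h' := ENNReal.toReal_mono (by finiteness) h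
    simpa [ENNReal.toReal_ofReal, hle] using h'
  rw [abs_le]
  constructor
  · by_cases hle : √2 ≤ √y
    · have := hlow hle
      nlinarith [mul_nonneg h20 (zero_le_one.trans hs1)]
    · have : (0 : ℝ) ≤ (gball y).card := Nat.cast_nonneg _
      nlinarith
  · nlinarith [mul_nonneg h20 (zero_le_one.trans hs1)]

lemma le_card_gball {y : ℝ} (hy : 1 ≤ y) : y / 600 ≤ (gball y).card := by
  by_cases h : y ≤ 600
  · have h1 : (1 : GaussianInt) ∈ gball y := gball_mono hy (mem_gball_one.2 isUnit_one)
    have h2 : (1 : ℝ) ≤ (gball y).card := by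
      exact_mod_cast Nat.one_le_iff_ne_zero.2 (Finset.card_ne_zero_of_mem h1)
    linarith
  · push Not at h
    have h1 := (abs_le.1 (abs_card_gball_sub_le hy)).1
    have h3 : 3 < π := Real.pi_gt_three
    have h4 : √y * √y = y := Real.mul_self_sqrt (by linarith)
    have h5 : 20 ≤ √y := Real.le_sqrt_of_sq_le (by linarith)
    nlinarith

/-! ### Partial summation -/

section Abel

variable {ι E : Type*} [NormedAddCommGroup E] [NormedSpace ℝ E]

lemma sum_smul_eq_abel (T : Finset ι) (ν : ι → ℕ) (f : ι → E) (g : ℕ → ℝ) {M : ℕ}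
    (hM : ∀ t ∈ T, ν t ≤ M) :
    ∑ t ∈ T, g (ν t) • f t = g M • ∑ t ∈ T, f t +
      ∑ j ∈ Finset.range M, (g j - g (j + 1)) • ∑ t ∈ T with ν t ≤ j, f t := by
  have h1 : ∀ t ∈ T, g (ν t) • f t = g M • f t +
      ∑ j ∈ Finset.range M, if ν t ≤ j then (g j - g (j + 1)) • f t else 0 := by
    intro t ht
    rw [← Finset.sum_filter, ← Finset.sum_smul, ← add_smul]
    congr 1
    have : (Finset.range M).filter (fun j => ν t ≤ j) = Finset.Ico (ν t) M := by
      ext j; simp; tauto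
    rw [this, Finset.sum_Ico_eq_sum_range]
    have h2 := Finset.sum_range_sub' (fun k => g (ν t + k)) (M - ν t)
    simp only [Nat.add_sub_of_le (hM t ht), add_zero] at h2
    simp only [add_assoc] at h2 ⊢
    rw [h2]; ring
  rw [Finset.sum_congr rfl h1, Finset.sum_add_distrib, Finset.smul_sum, Finset.sum_comm]
  congr 1
  refine Finset.sum_congr rfl fun j _ => ?_
  rw [Finset.smul_sum, Finset.sum_filter]

lemma norm_sum_smul_le_of_antitone (T : Finset ι) (ν : ι → ℕ) (f : ι → E) {g : ℕ → ℝ}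
    (hg : Antitone g) (hg0 : ∀ n, 0 ≤ g n) {B : ℝ}
    (hB : ∀ j : ℕ, ‖∑ t ∈ T with ν t ≤ j, f t‖ ≤ B) :
    ‖∑ t ∈ T, g (ν t) • f t‖ ≤ g 0 * B := by
  set M := T.sup ν
  have hM : ∀ t ∈ T, ν t ≤ M := fun t ht => Finset.le_sup ht
  have hT : ‖∑ t ∈ T, f t‖ ≤ B := by
    have := hB M
    rwa [Finset.filter_true_of_mem hM] at this
  rw [sum_smul_eq_abel T ν f g hM]
  calc _ ≤ g M * B + ∑ j ∈ Finset.range M, (g j - g (j + 1)) * B := by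
        refine (norm_add_le _ _).trans (add_le_add ?_ ?_)
        · rw [norm_smul, Real.norm_of_nonneg (hg0 M)]
          exact mul_le_mul_of_nonneg_left hT (hg0 M)
        · refine (norm_sum_le _ _).trans (Finset.sum_le_sum fun j _ => ?_)
          have h : 0 ≤ g j - g (j + 1) := sub_nonneg.2 (hg (Nat.le_succ j))
          rw [norm_smul, Real.norm_of_nonneg h]
          exact mul_le_mul_of_nonneg_left (hB j) h
    _ = g 0 * B := by
        rw [← Finset.sum_mul, Finset.sum_range_sub']; ring

lemma norm_sum_smul_le_of_monotone (T : Finset ι) (ν : ι → ℕ) (f : ι → E) {h : ℕ → ℝ}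
    (hh : Monotone h) {B H : ℝ} (h0 : 0 ≤ h 0) (hH : ∀ t ∈ T, h (ν t) ≤ H) (hH0 : h 0 ≤ H)
    (hB : ∀ j : ℕ, ‖∑ t ∈ T with ν t ≤ j, f t‖ ≤ B) :
    ‖∑ t ∈ T, h (ν t) • f t‖ ≤ 2 * H * B := by
  set g : ℕ → ℝ := fun n => H - min (h n) H with hg
  have hga : Antitone g := fun a b hab =>
    sub_le_sub_left (min_le_min_right H (hh hab)) H
  have h1 := norm_sum_smul_le_of_antitone T ν f hga
    (fun n => sub_nonneg.2 (min_le_right _ _)) hB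
  have hB0 : 0 ≤ B := (_root_.norm_nonneg _).trans (hB 0)
  have h2 : ∑ t ∈ T, h (ν t) • f t = H • ∑ t ∈ T, f t - ∑ t ∈ T, g (ν t) • f t := by
    rw [Finset.smul_sum, ← Finset.sum_sub_distrib]
    refine Finset.sum_congr rfl fun t ht => ?_
    rw [← sub_smul, hg]
    simp [min_eq_left (hH t ht)]
  have hT : ‖∑ t ∈ T, f t‖ ≤ B := by
    have := hB (T.sup ν)
    rwa [Finset.filter_true_of_mem fun t ht => Finset.le_sup ht] at this
  rw [h2]
  have hH' : 0 ≤ H := h0.trans hH0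
  have h3 : g 0 ≤ H := by simp only [hg, min_eq_left hH0]; linarith
  calc _ ≤ H * B + g 0 * B := by
        refine (norm_sub_le _ _).trans (add_le_add ?_ h1)
        rw [norm_smul, Real.norm_of_nonneg hH']
        exact mul_le_mul_of_nonneg_left hT hH'
    _ ≤ 2 * H * B := by nlinarith

/-- If the counting function of the weights `f` is at most `c j`, then the sum of
`f / ν` is at most `c (1 + log M)`. -/
lemma sum_div_le_of_partial_sum_le (T : Finset ι) (ν : ι → ℕ) (f : ι → ℝ) {M : ℕ} {c : ℝ}
    (hν : ∀ t ∈ T, 1 ≤ ν t ∧ ν t ≤ M) (hM : 1 ≤ M) (hc0 : 0 ≤ c)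
    (hc : ∀ j : ℕ, 1 ≤ j → ∑ t ∈ T with ν t ≤ j, f t ≤ c * j) :
    ∑ t ∈ T, f t / ν t ≤ c * (1 + Real.log M) := by
  have hT : ∑ t ∈ T, f t ≤ c * M := by
    have := hc M hM
    rwa [Finset.filter_true_of_mem fun t ht => (hν t ht).2] at this
  have hM0 : (0 : ℝ) < M := by positivity
  have h1 := sum_smul_eq_abel T ν f (fun n => (n : ℝ)⁻¹) fun t ht => (hν t ht).2
  simp only [smul_eq_mul] at h1
  have h2 : ∑ t ∈ T, f t / ν t = ∑ t ∈ T, (ν t : ℝ)⁻¹ * f t :=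
    Finset.sum_congr rfl fun t _ => by rw [div_eq_inv_mul]
  obtain ⟨m, rfl⟩ : ∃ m, M = m + 1 := ⟨M - 1, by omega⟩
  have h3 : ∑ j ∈ Finset.range (m + 1),
      ((j : ℝ)⁻¹ - ((j + 1 : ℕ) : ℝ)⁻¹) * ∑ t ∈ T with ν t ≤ j, f t ≤
      ∑ j ∈ Finset.range m, c * ((j + 1 + 1 : ℕ) : ℝ)⁻¹ := by
    rw [Finset.sum_range_succ']
    have h0 : ∑ t ∈ T with ν t ≤ 0, f t = 0 := by
      apply Finset.sum_eq_zero
      intro t ht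
      have := hν t (Finset.mem_filter.1 ht).1
      have := (Finset.mem_filter.1 ht).2
      omega
    rw [h0, mul_zero, add_zero]
    refine Finset.sum_le_sum fun j _ => ?_
    have h4 : (0 : ℝ) ≤ ((j + 1 : ℕ) : ℝ)⁻¹ - ((j + 1 + 1 : ℕ) : ℝ)⁻¹ := by
      rw [sub_nonneg]; apply inv_anti₀ <;> [positivity; (push_cast; linarith)]
    refine (mul_le_mul_of_nonneg_left (hc (j + 1) (by omega)) h4).trans (le_of_eq ?_)
    push_cast
    field_simp
    ring
  have h5 := harmonic_le_one_add_log (m + 1)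
  rw [harmonic, Finset.sum_range_succ'] at h5
  push_cast at h5
  rw [h2, h1]
  have h6 : ((m + 1 : ℕ) : ℝ)⁻¹ * ∑ t ∈ T, f t ≤ c := by
    rw [inv_mul_le_iff₀ hM0, mul_comm]; exact hT
  rw [← Finset.mul_sum] at h3
  push_cast at h3 h6 ⊢
  have h7 := mul_le_mul_of_nonneg_left h5 hc0
  norm_num at h7 h3 h6 ⊢
  linarith

end Abel

/-! ### Bounded Möbius sums -/

lemma sum_gball_sqrt_div_le {x : ℝ} (hx : 0 ≤ x) :
    ∑ d ∈ gball x, √(x / gnorm d) ≤ 8 * x := by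
  have h := sum_le_sum_shells (gball x) ⌊√x⌋₊ (fun d => √(x / gnorm d)) (fun k => √x / k)
    (fun z hz => (mem_gball.1 hz).1) (fun z hz => gsup_le_sqrt (mem_gball.1 hz).2)
    (fun z hz => by
      have h0 : 0 < gsup z := Nat.pos_of_ne_zero (mt gsup_eq_zero.1 (mem_gball.1 hz).1)
      rw [Real.sqrt_div hx]
      gcongr
      apply Real.le_sqrt_of_sq_le
      exact_mod_cast gsup_sq_le z)
    (fun _ => by positivity)
  refine h.trans ?_
  calc ∑ k ∈ Finset.Icc 1 ⌊√x⌋₊, 8 * (k : ℝ) * (√x / k)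
      = ∑ k ∈ Finset.Icc 1 ⌊√x⌋₊, 8 * √x := by
        refine Finset.sum_congr rfl fun k hk => ?_
        have : (k : ℝ) ≠ 0 := by
          have := (Finset.mem_Icc.1 hk).1
          positivity
        field_simp
    _ = ⌊√x⌋₊ * (8 * √x) := by simp
    _ ≤ √x * (8 * √x) := by gcongr; exact Nat.floor_le (Real.sqrt_nonneg x)
    _ = 8 * x := by nlinarith [Real.mul_self_sqrt hx]

/-- The Möbius function restricted to the numbers coprime to `r`. -/
def copMob (r d : GaussianInt) : ℝ := if IsRelPrime d r then gmob d else 0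

lemma abs_copMob_le (r d : GaussianInt) : |copMob r d| ≤ 1 := by
  unfold copMob; split_ifs
  · exact abs_gmob_le d
  · simp

lemma abs_sum_copMob_div_le (r : GaussianInt) (x : ℝ) :
    |∑ d ∈ gball x, copMob r d / gnorm d| ≤ 80 := by
  rcases lt_or_ge x 1 with hx | hx
  · simp [gball_eq_empty hx]
  have hx0 : 0 ≤ x := by linarith
  have h1 : ∑ d ∈ gball x, copMob r d * ((gball (x / gnorm d)).card : ℝ) =
      ∑ n ∈ gball x, ∑ d ∈ gdivs n, copMob r d := by
    rw [sum_gball_gdivs x fun d _ => copMob r d]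
    refine Finset.sum_congr rfl fun d _ => ?_
    simp [mul_comm]
  have h2 : |∑ n ∈ gball x, ∑ d ∈ gdivs n, copMob r d| ≤ 64 * x := by
    refine (Finset.abs_sum_le_sum_abs _ _).trans ?_
    calc _ ≤ ∑ n ∈ gball x, (8 : ℝ) := by
          refine Finset.sum_le_sum fun n hn => ?_
          have := sum_gmob_isRelPrime_mem r (mem_gball.1 hn).1
          have h8 := unitCount_le
          unfold copMob
          rw [abs_of_nonneg this.1]
          linarith [this.2]
      _ ≤ 64 * x := by
          simp only [Finset.sum_const, nsmul_eq_mul]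
          have := card_gball_le hx0
          linarith
  have h3 : |∑ d ∈ gball x, copMob r d * ((gball (x / gnorm d)).card - π * (x / gnorm d))| ≤
      160 * x := by
    refine (Finset.abs_sum_le_sum_abs _ _).trans ?_
    calc _ ≤ ∑ d ∈ gball x, 20 * √(x / gnorm d) := by
          refine Finset.sum_le_sum fun d hd => ?_
          rw [mem_gball] at hd
          rw [abs_mul]
          have hd0 := one_le_gnorm hd.1
          have h4 := abs_card_gball_sub_le (y := x / gnorm d) (by
            rw [le_div_iff₀ (by linarith)]; linarith [hd.2])
          have h5 := abs_copMob_le r d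
          nlinarith [abs_nonneg (copMob r d),
            abs_nonneg (((gball (x / gnorm d)).card : ℝ) - π * (x / gnorm d))]
      _ ≤ 160 * x := by
          rw [← Finset.mul_sum]
          have := sum_gball_sqrt_div_le hx0
          linarith
  have h4 : π * x * ∑ d ∈ gball x, copMob r d / gnorm d =
      ∑ d ∈ gball x, copMob r d * ((gball (x / gnorm d)).card : ℝ) -
      ∑ d ∈ gball x, copMob r d * ((gball (x / gnorm d)).card - π * (x / gnorm d)) := by
    rw [← Finset.sum_sub_distrib, Finset.mul_sum]
    refine Finset.sum_congr rfl fun d _ => ?_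
    ring
  have h5 : |π * x * ∑ d ∈ gball x, copMob r d / gnorm d| ≤ 224 * x := by
    rw [h4, h1]
    refine (abs_sub _ _).trans ?_
    linarith
  rw [abs_mul, abs_of_nonneg (by positivity)] at h5
  have h6 := Real.pi_gt_three
  have h7 := abs_nonneg (∑ d ∈ gball x, copMob r d / gnorm d)
  by_contra! h8
  have : 3 * x * 80 ≤ π * x * |∑ d ∈ gball x, copMob r d / gnorm d| := by gcongr
  linarith

lemma filter_gball_gnorm_le (x : ℝ) (j : ℕ) :
    (gball x).filter (fun d => gnorm d ≤ j) = gball (min x j) := by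
  ext d
  simp only [Finset.mem_filter, mem_gball, le_min_iff, Nat.cast_le, and_assoc]

lemma abs_sum_copMob_rpow_le (r : GaussianInt) (x : ℝ) {ε : ℝ} (hε : 0 ≤ ε) :
    |∑ d ∈ gball x, copMob r d * (gnorm d : ℝ) ^ (-(1 + ε))| ≤ 80 := by
  have h := norm_sum_smul_le_of_antitone (gball x) gnorm (fun d => copMob r d / gnorm d)
    (g := fun n => ((max n 1 : ℕ) : ℝ) ^ (-ε)) (B := 80)
    (fun a b hab => by
      apply Real.rpow_le_rpow_of_nonpos (by positivity) _ (by linarith)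
      exact_mod_cast max_le_max_right 1 hab)
    (fun n => by positivity)
    (fun j => by
      rw [filter_gball_gnorm_le]
      exact abs_sum_copMob_div_le r _)
  simp only [zero_le, sup_of_le_right, Nat.cast_one, Real.one_rpow, one_mul, Real.norm_eq_abs] at h
  refine le_trans (le_of_eq ?_) h
  congr 1
  refine Finset.sum_congr rfl fun d hd => ?_
  have h0 := gnorm_pos (mem_gball.1 hd).1
  have h1 : (0 : ℝ) < gnorm d := by exact_mod_cast h0
  rw [max_eq_left (show 1 ≤ gnorm d from h0), smul_eq_mul, neg_add, Real.rpow_add h1,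
    Real.rpow_neg_one]
  ring

lemma abs_sum_gmob_rpow_le {r : GaussianInt} (hr : r ≠ 0) (x : ℝ) {ε : ℝ} (hε : 0 ≤ ε) :
    |∑ d ∈ gball x with r ∣ d, gmob d * (gnorm d : ℝ) ^ (-(1 + ε))| ≤
      80 * (gnorm r : ℝ) ^ (-(1 + ε)) := by
  rw [sum_gball_filter_dvd x hr]
  have h1 : ∀ f : GaussianInt, gmob (r * f) * (gnorm (r * f) : ℝ) ^ (-(1 + ε)) =
      (gmob r * (gnorm r : ℝ) ^ (-(1 + ε))) * (copMob r f * (gnorm f : ℝ) ^ (-(1 + ε))) := by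
    intro f
    have h2 : gmob (r * f) = gmob r * copMob r f := by
      unfold copMob
      split_ifs with h
      · exact gmob_mul h.symm
      · rw [mul_zero]; exact gmob_mul_of_not_isRelPrime fun h' => h h'.symm
    rw [h2, gnorm_mul, Nat.cast_mul, Real.mul_rpow (by positivity) (by positivity)]
    ring
  simp only [h1]
  rw [← Finset.mul_sum, abs_mul, abs_mul, abs_of_nonneg (Real.rpow_nonneg (Nat.cast_nonneg _) _)]
  have h2 := abs_sum_copMob_rpow_le r (x / gnorm r) hε
  have h3 := abs_gmob_le r
  calc _ ≤ 1 * (gnorm r : ℝ) ^ (-(1 + ε)) * 80 := by gcongr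
    _ = _ := by ring

/-! ### The zeta function -/

lemma sum_Icc_rpow_le {δ : ℝ} (hδ : 0 < δ) (K : ℕ) :
    ∑ k ∈ Finset.Icc 1 (K + 1), (k : ℝ) ^ (-(1 + δ)) ≤
      1 + (1 - ((K + 1 : ℕ) : ℝ) ^ (-δ)) / δ := by
  induction K with
  | zero => simp
  | succ K ih =>
    rw [Finset.sum_Icc_succ_top (by omega)]
    set a : ℝ := ((K + 1 : ℕ) : ℝ) with ha
    have ha0 : 0 < a := by positivity
    have hb : (((K + 1 + 1 : ℕ)) : ℝ) = a + 1 := by push_cast [ha]; ring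
    rw [hb]
    have h1 : (a + 1) ^ (-(1 + δ)) = (a + 1) ^ (-δ) * (1 / (a + 1)) := by
      rw [neg_add, Real.rpow_add (by linarith), Real.rpow_neg_one, one_div, mul_comm]
    have h2 : a ^ (-δ) = (a + 1) ^ (-δ) * (a / (a + 1)) ^ (-δ) := by
      rw [← Real.mul_rpow (by linarith) (by positivity)]
      congr 1; field_simp
    have h3 : 1 + δ * (1 / (a + 1)) ≤ (a / (a + 1)) ^ (-δ) := by
      rw [Real.rpow_def_of_pos (by positivity)]
      have h4 := Real.log_le_sub_one_of_pos (show 0 < a / (a + 1) by positivity)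
      have h5 : a / (a + 1) - 1 = -(1 / (a + 1)) := by field_simp; ring
      have h6 := Real.add_one_le_exp (Real.log (a / (a + 1)) * -δ)
      nlinarith
    have h7 : 0 < (a + 1) ^ (-δ) := by positivity
    have h8 : (a + 1) ^ (-(1 + δ)) ≤ (a ^ (-δ) - (a + 1) ^ (-δ)) / δ := by
      rw [le_div_iff₀ hδ, h1, h2]
      nlinarith [mul_le_mul_of_nonneg_left h3 h7.le]
    calc _ ≤ 1 + (1 - a ^ (-δ)) / δ + (a ^ (-δ) - (a + 1) ^ (-δ)) / δ := add_le_add ih h8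
      _ = _ := by ring

lemma sum_gnorm_rpow_le (s : Finset GaussianInt) (h0 : ∀ z ∈ s, z ≠ 0) {ε : ℝ} (hε : 0 < ε)
    (hε1 : ε ≤ 1) :
    ∑ z ∈ s, (gnorm z : ℝ) ^ (-(1 + ε)) ≤ 16 / ε := by
  set K := s.sup gsup
  have h := sum_le_sum_shells s (K + 1) (fun z => (gnorm z : ℝ) ^ (-(1 + ε)))
    (fun k => ((k : ℝ) ^ 2) ^ (-(1 + ε))) h0
    (fun z hz => (Finset.le_sup hz).trans (Nat.le_succ K))
    (fun z hz => by
      have h1 : 0 < gsup z := Nat.pos_of_ne_zero (mt gsup_eq_zero.1 (h0 z hz))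
      apply Real.rpow_le_rpow_of_nonpos (by positivity) _ (by linarith)
      exact_mod_cast gsup_sq_le z)
    (fun k => by positivity)
  refine h.trans ?_
  have h2 : ∀ k ∈ Finset.Icc 1 (K + 1), 8 * (k : ℝ) * ((k : ℝ) ^ 2) ^ (-(1 + ε)) =
      8 * (k : ℝ) ^ (-(1 + 2 * ε)) := by
    intro k hk
    have hk0 : (0 : ℝ) < k := by
      have := (Finset.mem_Icc.1 hk).1
      positivity
    rw [← Real.rpow_natCast, ← Real.rpow_mul hk0.le, mul_assoc]
    congr 1
    nth_rewrite 1 [← Real.rpow_one (k : ℝ)]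
    rw [← Real.rpow_add hk0]
    congr 1; push_cast; ring
  rw [Finset.sum_congr rfl h2, ← Finset.mul_sum]
  have h3 := sum_Icc_rpow_le (δ := 2 * ε) (by linarith) K
  have h4 : (1 - ((K + 1 : ℕ) : ℝ) ^ (-(2 * ε))) / (2 * ε) ≤ 1 / (2 * ε) := by
    gcongr
    have : 0 ≤ ((K + 1 : ℕ) : ℝ) ^ (-(2 * ε)) := by positivity
    linarith
  have h5 : 1 ≤ 1 / ε := by rw [le_div_iff₀ hε]; linarith
  have h6 : 1 / (2 * ε) = 1 / ε / 2 := by field_simp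
  have h7 : 16 / ε = 16 * (1 / ε) := by ring
  rw [h7]
  linarith

/-- The Dirichlet series `∑ N(m)^{-s}`. -/
def gzeta (s : ℝ) : ℝ := ∑' m : GaussianInt, (gnorm m : ℝ) ^ (-s)

lemma gnorm_zero_rpow {s : ℝ} (hs : s ≠ 0) : (gnorm 0 : ℝ) ^ (-s) = 0 := by
  rw [gnorm_zero, Nat.cast_zero, Real.zero_rpow (neg_ne_zero.2 hs)]

lemma sum_gnorm_rpow_le' (s : Finset GaussianInt) {ε : ℝ} (hε : 0 < ε) (hε1 : ε ≤ 1) :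
    ∑ z ∈ s, (gnorm z : ℝ) ^ (-(1 + ε)) ≤ 16 / ε := by
  rw [← Finset.sum_filter_of_ne (p := fun z => z ≠ 0)]
  · exact sum_gnorm_rpow_le _ (fun z hz => (Finset.mem_filter.1 hz).2) hε hε1
  · rintro z _ h rfl
    exact h (gnorm_zero_rpow (by linarith))

lemma hasSum_gzeta {ε : ℝ} (hε : 0 < ε) (hε1 : ε ≤ 1) :
    HasSum (fun m : GaussianInt => (gnorm m : ℝ) ^ (-(1 + ε))) (gzeta (1 + ε)) :=
  (summable_of_sum_le (fun m => by positivity) fun s => sum_gnorm_rpow_le' s hε hε1).hasSum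

lemma gzeta_le {ε : ℝ} (hε : 0 < ε) (hε1 : ε ≤ 1) : gzeta (1 + ε) ≤ 16 / ε :=
  hasSum_le_of_sum_le (hasSum_gzeta hε hε1) fun s => sum_gnorm_rpow_le' s hε hε1

lemma gzeta_nonneg (s : ℝ) : 0 ≤ gzeta s := tsum_nonneg fun m => by positivity

lemma hasSum_ite_dvd {ε : ℝ} (hε : 0 < ε) (hε1 : ε ≤ 1) {L : GaussianInt} (hL : L ≠ 0) :
    HasSum (fun m : GaussianInt => if L ∣ m then (gnorm m : ℝ) ^ (-(1 + ε)) else 0)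
      ((gnorm L : ℝ) ^ (-(1 + ε)) * gzeta (1 + ε)) := by
  rw [← (mul_right_injective₀ hL).hasSum_iff]
  · have : ((fun m : GaussianInt => if L ∣ m then (gnorm m : ℝ) ^ (-(1 + ε)) else 0) ∘
        fun x => L * x) = fun m => (gnorm L : ℝ) ^ (-(1 + ε)) * (gnorm m : ℝ) ^ (-(1 + ε)) := by
      funext m
      simp only [Function.comp, dvd_mul_right, if_true, gnorm_mul, Nat.cast_mul]
      rw [Real.mul_rpow (by positivity) (by positivity)]
    rw [this]
    exact (hasSum_gzeta hε hε1).mul_left _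
  · intro m hm
    rw [if_neg]
    rintro ⟨c, rfl⟩
    exact hm ⟨c, rfl⟩

/-- The truncated Möbius divisor sum. -/
def amob (U : ℝ) (m : GaussianInt) : ℝ := ∑ d ∈ gball U with d ∣ m, gmob d

lemma gnorm_lcm_rpow {s : ℝ} {d₁ d₂ : GaussianInt} (h₁ : d₁ ≠ 0) :
    (gnorm (EuclideanDomain.lcm d₁ d₂) : ℝ) ^ (-s) =
      (gnorm d₁ : ℝ) ^ (-s) * (gnorm d₂ : ℝ) ^ (-s) *
        (gnorm (EuclideanDomain.gcd d₁ d₂) : ℝ) ^ s := by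
  have hg : EuclideanDomain.gcd d₁ d₂ ≠ 0 := fun h => h₁ (EuclideanDomain.gcd_eq_zero_iff.1 h).1
  have h := congrArg (fun z => ((gnorm z : ℕ) : ℝ)) (EuclideanDomain.gcd_mul_lcm d₁ d₂)
  simp only [gnorm_mul, Nat.cast_mul] at h
  have hg' : (0 : ℝ) < gnorm (EuclideanDomain.gcd d₁ d₂) := by exact_mod_cast gnorm_pos hg
  rw [← Real.mul_rpow (by positivity) (by positivity), ← h,
    Real.mul_rpow (by positivity) (by positivity), mul_right_comm, ← Real.rpow_add hg']
  simp

lemma gnorm_gcd_rpow {s U : ℝ} {d₁ d₂ : GaussianInt} (h₁ : d₁ ∈ gball U) :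
    unitCount ^ 2 * (gnorm (EuclideanDomain.gcd d₁ d₂) : ℝ) ^ s =
      ∑ r ∈ gball U, (gnorm r : ℝ) ^ s * mobSum s r *
        ((if r ∣ d₁ then 1 else 0) * (if r ∣ d₂ then 1 else 0)) := by
  have hd₁ := (mem_gball.1 h₁).1
  have hg : EuclideanDomain.gcd d₁ d₂ ≠ 0 := fun h => hd₁ (EuclideanDomain.gcd_eq_zero_iff.1 h).1
  rw [← sum_jordan hg]
  have h : gdivs (EuclideanDomain.gcd d₁ d₂) = (gball U).filter fun r => r ∣ d₁ ∧ r ∣ d₂ := by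
    ext r
    rw [mem_gdivs hg, Finset.mem_filter, mem_gball]
    constructor
    · intro h
      have hr₁ := h.trans (EuclideanDomain.gcd_dvd_left d₁ d₂)
      refine ⟨⟨ne_zero_of_dvd_ne_zero hd₁ hr₁, le_trans ?_ (mem_gball.1 h₁).2⟩, hr₁,
        h.trans (EuclideanDomain.gcd_dvd_right d₁ d₂)⟩
      exact_mod_cast gnorm_le_of_dvd hd₁ hr₁
    · exact fun h => EuclideanDomain.dvd_gcd h.2.1 h.2.2
  rw [h, Finset.sum_filter]
  refine Finset.sum_congr rfl fun r _ => ?_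
  by_cases h1 : r ∣ d₁ <;> by_cases h2 : r ∣ d₂ <;> simp [h1, h2]

lemma hasSum_amob_sq {ε : ℝ} (hε : 0 < ε) (hε1 : ε ≤ 1) (U : ℝ) :
    HasSum (fun m : GaussianInt => amob U m ^ 2 * (gnorm m : ℝ) ^ (-(1 + ε)))
      (gzeta (1 + ε) / unitCount ^ 2 * ∑ r ∈ gball U, (gnorm r : ℝ) ^ (1 + ε) * mobSum (1 + ε) r *
        (∑ d ∈ gball U with r ∣ d, gmob d * (gnorm d : ℝ) ^ (-(1 + ε))) ^ 2) := by
  set s := 1 + ε with hs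
  have h1 : HasSum (fun m : GaussianInt => ∑ d₁ ∈ gball U, ∑ d₂ ∈ gball U, gmob d₁ * gmob d₂ *
      (if EuclideanDomain.lcm d₁ d₂ ∣ m then (gnorm m : ℝ) ^ (-s) else 0))
      (∑ d₁ ∈ gball U, ∑ d₂ ∈ gball U, gmob d₁ * gmob d₂ *
        ((gnorm (EuclideanDomain.lcm d₁ d₂) : ℝ) ^ (-s) * gzeta s)) := by
    refine hasSum_sum fun d₁ h₁ => hasSum_sum fun d₂ h₂ => HasSum.mul_left _ ?_
    refine hasSum_ite_dvd hε hε1 fun h => ?_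
    rcases EuclideanDomain.lcm_eq_zero_iff.1 h with h | h
    · exact (mem_gball.1 h₁).1 h
    · exact (mem_gball.1 h₂).1 h
  convert h1 using 1
  · funext m
    rw [amob, sq, Finset.sum_filter, Finset.sum_mul_sum, Finset.sum_mul]
    refine Finset.sum_congr rfl fun d₁ _ => ?_
    rw [Finset.sum_mul]
    refine Finset.sum_congr rfl fun d₂ _ => ?_
    rw [EuclideanDomain.lcm_dvd_iff]
    by_cases h1 : d₁ ∣ m <;> by_cases h2 : d₂ ∣ m <;> simp [h1, h2]
  · have h2 : ∀ r, (∑ d ∈ gball U with r ∣ d, gmob d * (gnorm d : ℝ) ^ (-s)) ^ 2 =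
        ∑ d₁ ∈ gball U, ∑ d₂ ∈ gball U, gmob d₁ * gmob d₂ * ((gnorm d₁ : ℝ) ^ (-s) *
          (gnorm d₂ : ℝ) ^ (-s)) * ((if r ∣ d₁ then 1 else 0) * (if r ∣ d₂ then 1 else 0)) := by
      intro r
      rw [sq, Finset.sum_filter, Finset.sum_mul_sum]
      refine Finset.sum_congr rfl fun d₁ _ => Finset.sum_congr rfl fun d₂ _ => ?_
      by_cases h1 : r ∣ d₁ <;> by_cases h2 : r ∣ d₂ <;> simp [h1, h2]
      ring
    simp only [h2, Finset.mul_sum]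
    rw [Finset.sum_comm]
    refine Finset.sum_congr rfl fun d₁ h₁ => ?_
    rw [Finset.sum_comm]
    refine Finset.sum_congr rfl fun d₂ _ => ?_
    rw [gnorm_lcm_rpow (mem_gball.1 h₁).1]
    have hw := unitCount_pos
    have h3 : (gnorm (EuclideanDomain.gcd d₁ d₂) : ℝ) ^ s = (unitCount ^ 2)⁻¹ *
        ∑ r ∈ gball U, (gnorm r : ℝ) ^ s * mobSum s r *
        ((if r ∣ d₁ then 1 else 0) * (if r ∣ d₂ then 1 else 0)) := by
      rw [← gnorm_gcd_rpow h₁]; field_simp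
    rw [h3, Finset.mul_sum, Finset.mul_sum, Finset.sum_mul, Finset.mul_sum]
    refine Finset.sum_congr rfl fun r _ => ?_
    ring

lemma sum_amob_sq_rpow_le (F : Finset GaussianInt) {ε : ℝ} (hε : 0 < ε) (hε1 : ε ≤ 1) (U : ℝ) :
    ∑ m ∈ F, amob U m ^ 2 * (gnorm m : ℝ) ^ (-(1 + ε)) ≤ 6400 * (16 / ε) ^ 2 := by
  refine (sum_le_hasSum F (fun m _ => by positivity) (hasSum_amob_sq hε hε1 U)).trans ?_
  have hw := one_le_unitCount
  have hz := gzeta_le hε hε1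
  have hz0 := gzeta_nonneg (1 + ε)
  have h1 : ∑ r ∈ gball U, (gnorm r : ℝ) ^ (1 + ε) * mobSum (1 + ε) r *
      (∑ d ∈ gball U with r ∣ d, gmob d * (gnorm d : ℝ) ^ (-(1 + ε))) ^ 2 ≤
      unitCount * 6400 * (16 / ε) := by
    calc _ ≤ ∑ r ∈ gball U, unitCount * 6400 * (gnorm r : ℝ) ^ (-(1 + ε)) := by
          refine Finset.sum_le_sum fun r hr => ?_
          have hr0 := (mem_gball.1 hr).1
          have h2 := abs_sum_gmob_rpow_le hr0 U hε.le
          have h3 := mobSum_mem (s := 1 + ε) (by linarith) hr0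
          have h4 : (∑ d ∈ gball U with r ∣ d, gmob d * (gnorm d : ℝ) ^ (-(1 + ε))) ^ 2 ≤
              (80 * (gnorm r : ℝ) ^ (-(1 + ε))) ^ 2 := by
            rw [← sq_abs]; gcongr
          have hr1 : (0 : ℝ) < gnorm r := by exact_mod_cast gnorm_pos hr0
          calc _ ≤ (gnorm r : ℝ) ^ (1 + ε) * unitCount * (80 * (gnorm r : ℝ) ^ (-(1 + ε))) ^ 2 := by
                gcongr
                exact h3.2
            _ = unitCount * 6400 * ((gnorm r : ℝ) ^ (1 + ε) * (gnorm r : ℝ) ^ (-(1 + ε))) *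
                (gnorm r : ℝ) ^ (-(1 + ε)) := by ring
            _ = _ := by rw [← Real.rpow_add hr1]; simp
      _ ≤ _ := by
          rw [← Finset.mul_sum]
          gcongr
          exact sum_gnorm_rpow_le' _ hε hε1
  calc _ ≤ gzeta (1 + ε) / unitCount ^ 2 * (unitCount * 6400 * (16 / ε)) := by gcongr
    _ = gzeta (1 + ε) / unitCount * (6400 * (16 / ε)) := by field_simp
    _ ≤ (16 / ε) * (6400 * (16 / ε)) := by
        exact mul_le_mul_of_nonneg_right ((div_le_self hz0 hw).trans hz) (by positivity)
    _ = _ := by ring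

/-- The logarithmic mean square of the truncated Möbius divisor sums. -/
lemma sum_amob_sq_div_le {N : ℝ} (hN : 3 ≤ N) (U : ℝ) :
    ∑ m ∈ gball N, amob U m ^ 2 / gnorm m ≤ 5000000 * Real.log N ^ 2 := by
  have hlog : 1 ≤ Real.log N := by
    rw [Real.le_log_iff_exp_le (by linarith)]
    linarith [Real.exp_one_lt_d9]
  have h := sum_amob_sq_rpow_le (gball N) (ε := 1 / Real.log N) (by positivity)
    (by rw [div_le_one (by linarith)]; exact hlog) U
  have h1 : ∀ m ∈ gball N, amob U m ^ 2 / gnorm m ≤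
      Real.exp 1 * (amob U m ^ 2 * (gnorm m : ℝ) ^ (-(1 + 1 / Real.log N))) := by
    intro m hm
    have hm0 := one_le_gnorm (mem_gball.1 hm).1
    have hm1 : (0 : ℝ) < gnorm m := by linarith
    rw [neg_add, Real.rpow_add hm1, Real.rpow_neg_one]
    have h2 : 1 ≤ Real.exp 1 * (gnorm m : ℝ) ^ (-(1 / Real.log N)) := by
      rw [Real.rpow_def_of_pos hm1, ← Real.exp_add]
      apply Real.one_le_exp
      have h3 := Real.log_le_log hm1 (mem_gball.1 hm).2
      have h4 : Real.log (gnorm m) * (1 / Real.log N) ≤ 1 := by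
        rw [mul_one_div, div_le_one (by linarith)]; exact h3
      linarith
    calc amob U m ^ 2 / gnorm m = amob U m ^ 2 / gnorm m * 1 := by ring
      _ ≤ amob U m ^ 2 / gnorm m * (Real.exp 1 * (gnorm m : ℝ) ^ (-(1 / Real.log N))) := by gcongr
      _ = _ := by ring
  refine (Finset.sum_le_sum h1).trans ?_
  rw [← Finset.mul_sum]
  have h5 := Real.exp_one_lt_d9
  have h6 : (16 / (1 / Real.log N)) = 16 * Real.log N := by field_simp
  rw [h6] at h
  calc _ ≤ 2.8 * (6400 * (16 * Real.log N) ^ 2) := by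
        gcongr; linarith
    _ ≤ _ := by nlinarith [sq_nonneg (Real.log N)]

/-! ### Chebyshev–Mertens bounds -/

lemma gvm_le_log_of_mem {x : ℝ} {d : GaussianInt} (hd : d ∈ gball x) : gvm d ≤ Real.log x := by
  rw [mem_gball] at hd
  have := one_le_gnorm hd.1
  exact (gvm_le_log hd.1).trans (Real.log_le_log (by linarith) hd.2)

lemma sum_gvm_div_le {x : ℝ} (hx : 1 ≤ x) :
    ∑ d ∈ gball x, gvm d / gnorm d ≤ 40000 * Real.log x := by
  have hlog := Real.log_nonneg hx
  have h1 : ∑ n ∈ gball x, unitCount * Real.log (gnorm n) =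
      ∑ d ∈ gball x, gvm d * ((gball (x / gnorm d)).card : ℝ) := by
    calc _ = ∑ n ∈ gball x, ∑ d ∈ gdivs n, gvm d :=
          Finset.sum_congr rfl fun n hn => (sum_gvm (mem_gball.1 hn).1).symm
      _ = _ := by
          rw [sum_gball_gdivs x fun d _ => gvm d]
          simp [mul_comm]
  have h2 : ∑ n ∈ gball x, unitCount * Real.log (gnorm n) ≤ 64 * x * Real.log x := by
    calc _ ≤ ∑ n ∈ gball x, 8 * Real.log x := by
          refine Finset.sum_le_sum fun n hn => ?_
          rw [mem_gball] at hn
          have h3 := one_le_gnorm hn.1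
          have h4 := Real.log_nonneg h3
          have h5 := Real.log_le_log (by linarith) hn.2
          have := unitCount_le
          gcongr
      _ = ((gball x).card : ℝ) * (8 * Real.log x) := by simp
      _ ≤ 8 * x * (8 * Real.log x) := by gcongr; exact card_gball_le (by linarith)
      _ = _ := by ring
  have h3 : x / 600 * ∑ d ∈ gball x, gvm d / gnorm d ≤
      ∑ d ∈ gball x, gvm d * ((gball (x / gnorm d)).card : ℝ) := by
    rw [Finset.mul_sum]
    refine Finset.sum_le_sum fun d hd => ?_
    rw [mem_gball] at hd
    have hd0 := one_le_gnorm hd.1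
    have h4 := le_card_gball (y := x / gnorm d) (by
      rw [le_div_iff₀ (by linarith)]; linarith [hd.2])
    calc x / 600 * (gvm d / gnorm d) = gvm d * (x / gnorm d / 600) := by ring
      _ ≤ _ := by gcongr; exact gvm_nonneg d
  rw [← h1] at h3
  have h4 := h3.trans h2
  have h5 : x * ∑ d ∈ gball x, gvm d / gnorm d ≤ x * (40000 * Real.log x) := by
    nlinarith [mul_nonneg (by linarith : (0 : ℝ) ≤ x) hlog]
  exact le_of_mul_le_mul_left h5 (by linarith)

/-! ### Exponential sums over convex sets -/

lemma e2_add (s t : ℝ) : e2 (s + t) = e2 s * e2 t := by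
  unfold e2; rw [← Complex.exp_add]; congr 1; push_cast; ring

lemma norm_e2 (t : ℝ) : ‖e2 t‖ = 1 := by
  unfold e2
  rw [show 2 * (π : ℂ) * Complex.I * t = ((2 * π * t : ℝ) : ℂ) * Complex.I by push_cast; ring]
  exact Complex.norm_exp_ofReal_mul_I _

lemma e2_int (n : ℤ) : e2 n = 1 := by
  unfold e2
  rw [Complex.exp_eq_one_iff]
  exact ⟨n, by push_cast; ring⟩

lemma conj_e2 (t : ℝ) : (starRingEnd ℂ) (e2 t) = e2 (-t) := by
  unfold e2
  rw [← Complex.exp_conj]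
  congr 1
  simp only [map_mul, map_ofNat, Complex.conj_ofReal, Complex.conj_I, Complex.ofReal_neg]
  ring

/-- The distance to the nearest integer. -/
def dInt (θ : ℝ) : ℝ := |θ - round θ|

lemma dInt_nonneg (θ : ℝ) : 0 ≤ dInt θ := abs_nonneg _

lemma dInt_le (θ : ℝ) : dInt θ ≤ 1 / 2 := abs_sub_round θ

lemma dInt_le_abs_sub (θ : ℝ) (n : ℤ) : dInt θ ≤ |θ - n| := round_le θ n

lemma four_mul_dInt_le (θ : ℝ) : 4 * dInt θ ≤ ‖e2 θ - 1‖ := by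
  have h1 : e2 θ = e2 (θ - round θ) := by
    conv_lhs => rw [show θ = (θ - round θ) + round θ by ring, e2_add, e2_int, mul_one]
  rw [h1]
  set t := θ - round θ with ht
  have h2 : |t| ≤ 1 / 2 := abs_sub_round θ
  have h3 : ‖e2 t - 1‖ = 2 * |Real.sin (π * t)| := by
    have h4 : e2 t - 1 = e2 (t / 2) * (2 * Complex.I * (Real.sin (π * t) : ℂ)) := by
      have h5 : e2 t = e2 (t / 2) * e2 (t / 2) := by rw [← e2_add]; congr 1; ring
      have h6 : (1 : ℂ) = e2 (t / 2) * e2 (-(t / 2)) := by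
        rw [← e2_add, add_neg_cancel]; simp [e2]
      have h7 : e2 (t / 2) - e2 (-(t / 2)) = 2 * Complex.I * (Real.sin (π * t) : ℂ) := by
        rw [Complex.ofReal_sin, Complex.sin, e2, e2]
        have h8 : 2 * (π : ℂ) * Complex.I * ((t / 2 : ℝ) : ℂ) = ((π * t : ℝ) : ℂ) * Complex.I := by
          push_cast; ring
        have h9 : 2 * (π : ℂ) * Complex.I * ((-(t / 2) : ℝ) : ℂ) =
            -((π * t : ℝ) : ℂ) * Complex.I := by
          push_cast; ring
        rw [h8, h9]
        linear_combination (Complex.exp (((π * t : ℝ) : ℂ) * Complex.I) -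
          Complex.exp (-((π * t : ℝ) : ℂ) * Complex.I)) * Complex.I_mul_I
      rw [← h7, mul_sub, ← h5, ← h6]
    rw [h4, norm_mul, norm_e2, norm_mul, norm_mul, Complex.norm_I, Complex.norm_real]
    simp
  rw [h3]
  have hpi := Real.pi_pos
  have h4 := Real.mul_abs_le_abs_sin (x := π * t) (by
    rw [abs_mul, abs_of_pos hpi]; nlinarith)
  rw [abs_mul, abs_of_pos hpi] at h4
  have h5 : 2 / π * (π * |t|) = 2 * |t| := by field_simp
  rw [h5] at h4
  have : dInt θ = |t| := rfl
  linarith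

lemma norm_sum_Ico_e2_mul_dInt_le (a b : ℤ) (θ : ℝ) :
    ‖∑ k ∈ Finset.Ico a b, e2 (k * θ)‖ * dInt θ ≤ 1 / 2 := by
  rcases le_or_gt b a with h | h
  · simp [Finset.Ico_eq_empty_of_le h]
  have h1 : (e2 θ - 1) * ∑ k ∈ Finset.Ico a b, e2 (k * θ) = e2 (b * θ) - e2 (a * θ) := by
    induction b, h.le using Int.leInduction with
    | base => simp
    | succ b hab ih =>
      rcases hab.eq_or_lt with rfl | hab'
      · rw [show Finset.Ico a (a + 1) = {a} by ext; simp; omega]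
        rw [Finset.sum_singleton, sub_mul, one_mul, ← e2_add]
        push_cast; ring_nf
      · have : Finset.Ico a (b + 1) = insert b (Finset.Ico a b) := by ext; simp; omega
        rw [this, Finset.sum_insert (by simp), mul_add, ih hab', sub_mul, one_mul, ← e2_add]
        push_cast; ring_nf
  have h2 := congrArg norm h1
  rw [norm_mul] at h2
  have h3 : ‖e2 (b * θ) - e2 (a * θ)‖ ≤ 2 := by
    refine (norm_sub_le _ _).trans ?_
    rw [norm_e2, norm_e2]; norm_num
  have h4 := four_mul_dInt_le θ
  have h5 : 0 ≤ ‖∑ k ∈ Finset.Ico a b, e2 (k * θ)‖ := _root_.norm_nonneg _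
  nlinarith

lemma norm_sum_e2_mul_dInt_le (F : Finset ℤ)
    (hF : ∀ a ∈ F, ∀ b ∈ F, ∀ x, a ≤ x → x ≤ b → x ∈ F) (θ : ℝ) :
    ‖∑ k ∈ F, e2 (k * θ)‖ * dInt θ ≤ 1 / 2 := by
  rcases F.eq_empty_or_nonempty with rfl | hne
  · simp
  have : F = Finset.Ico (F.min' hne) (F.max' hne + 1) := by
    ext x
    rw [Finset.mem_Ico, Int.lt_add_one_iff]
    exact ⟨fun h => ⟨F.min'_le x h, F.le_max' x h⟩,
      fun h => hF _ (F.min'_mem hne) _ (F.max'_mem hne) x h.1 h.2⟩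
  rw [this]
  exact norm_sum_Ico_e2_mul_dInt_le _ _ θ

lemma card_le_of_abs_le {F : Finset ℤ} {R : ℝ} (hR : 1 ≤ R) (h : ∀ x ∈ F, |(x : ℝ)| ≤ R) :
    (F.card : ℝ) ≤ 3 * R := by
  have h1 : F ⊆ Finset.Icc (-⌊R⌋) ⌊R⌋ := by
    intro x hx
    have := abs_le.1 (h x hx)
    rw [Finset.mem_Icc]
    refine ⟨?_, Int.le_floor.2 this.2⟩
    have : -x ≤ ⌊R⌋ := Int.le_floor.2 (by push_cast; linarith)
    linarith
  have h2 := Finset.card_le_card h1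
  rw [Int.card_Icc] at h2
  have h3 : (0 : ℤ) ≤ ⌊R⌋ := Int.floor_nonneg.2 (by linarith)
  have h4 : (F.card : ℤ) ≤ 2 * ⌊R⌋ + 1 := by omega
  have h5 : (F.card : ℝ) ≤ 2 * (⌊R⌋ : ℝ) + 1 := by exact_mod_cast h4
  have := Int.floor_le R
  linarith

lemma norm_sum_rows_mul_dInt_le (F : Finset (ℤ × ℤ)) {R : ℝ} (hR : 1 ≤ R)
    (hF : ∀ y, ∀ a b x, (a, y) ∈ F → (b, y) ∈ F → a ≤ x → x ≤ b → (x, y) ∈ F)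
    (hFR : ∀ p ∈ F, |(p.2 : ℝ)| ≤ R) (θ φ : ℝ) :
    ‖∑ p ∈ F, e2 (p.1 * θ + p.2 * φ)‖ * dInt θ ≤ 3 / 2 * R := by
  rw [← Finset.sum_fiberwise_of_maps_to (t := F.image Prod.snd) (g := Prod.snd)
    fun p hp => Finset.mem_image_of_mem _ hp]
  have h1 : ∀ y ∈ F.image Prod.snd,
      ‖∑ p ∈ F with p.2 = y, e2 (p.1 * θ + p.2 * φ)‖ * dInt θ ≤ 1 / 2 := by
    intro y _
    have h2 : ∑ p ∈ F with p.2 = y, e2 (p.1 * θ + p.2 * φ) =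
        e2 (y * φ) * ∑ k ∈ (F.filter fun p => p.2 = y).image Prod.fst, e2 (k * θ) := by
      rw [Finset.sum_image, Finset.mul_sum]
      · refine Finset.sum_congr rfl fun p hp => ?_
        rw [← (Finset.mem_filter.1 hp).2, ← e2_add, add_comm]
      · intro p hp r hr h
        simp only [Finset.coe_filter, Set.mem_ofPred_eq] at hp hr
        exact Prod.ext h (hp.2.trans hr.2.symm)
    rw [h2, norm_mul, norm_e2, one_mul]
    apply norm_sum_e2_mul_dInt_le
    intro a ha b hb x hax hxb
    simp only [Finset.mem_image, Finset.mem_filter, Prod.exists, exists_and_right,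
      exists_eq_right] at ha hb ⊢
    exact hF _ a b x ha hb hax hxb
  calc _ ≤ (∑ y ∈ F.image Prod.snd, ‖∑ p ∈ F with p.2 = y, e2 (p.1 * θ + p.2 * φ)‖) * dInt θ := by
        gcongr
        · exact dInt_nonneg θ
        · exact norm_sum_le _ _
    _ ≤ ∑ y ∈ F.image Prod.snd, (1 / 2 : ℝ) := by
        rw [Finset.sum_mul]; exact Finset.sum_le_sum h1
    _ = (F.image Prod.snd).card * (1 / 2) := by simp
    _ ≤ 3 * R * (1 / 2) := by
        gcongr
        refine card_le_of_abs_le hR fun x hx => ?_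
        obtain ⟨p, hp, rfl⟩ := Finset.mem_image.1 hx
        exact hFR p hp
    _ = _ := by ring

/-- The sup-norm distance to the nearest Gaussian integer. -/
def ndist (β : ℂ) : ℝ := max (dInt β.re) (dInt β.im)

lemma ndist_nonneg (β : ℂ) : 0 ≤ ndist β := (dInt_nonneg _).trans (le_max_left _ _)

lemma ndist_le (β : ℂ) : ndist β ≤ 1 / 2 := max_le (dInt_le _) (dInt_le _)

/-- The standard majorant of exponential sums over convex sets in a ball of norm `X`. -/
def majG (X : ℝ) (β : ℂ) : ℝ := X / (1 + √X * ndist β)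

lemma majG_den_pos (X : ℝ) (β : ℂ) : 0 < 1 + √X * ndist β := by
  have := mul_nonneg (Real.sqrt_nonneg X) (ndist_nonneg β)
  linarith

lemma majG_nonneg {X : ℝ} (hX : 0 ≤ X) (β : ℂ) : 0 ≤ majG X β :=
  div_nonneg hX (majG_den_pos X β).le

lemma majG_le_self {X : ℝ} (hX : 0 ≤ X) (β : ℂ) : majG X β ≤ X :=
  div_le_self hX (by have := mul_nonneg (Real.sqrt_nonneg X) (ndist_nonneg β); linarith)

lemma majG_mono {X Y : ℝ} (hX : 0 ≤ X) (hXY : X ≤ Y) (β : ℂ) : majG X β ≤ majG Y β := by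
  unfold majG
  rw [div_le_div_iff₀ (majG_den_pos X β) (majG_den_pos Y β)]
  have h1 : X * √Y ≤ Y * √X := by
    have hx := Real.mul_self_sqrt hX
    have hy := Real.mul_self_sqrt (hX.trans hXY)
    have h := Real.sqrt_le_sqrt hXY
    have := Real.sqrt_nonneg X
    have := Real.sqrt_nonneg Y
    calc X * √Y = (√X * √Y) * √X := by nlinarith
      _ ≤ (√X * √Y) * √Y := by gcongr
      _ = Y * √X := by nlinarith
  nlinarith [mul_le_mul_of_nonneg_right h1 (ndist_nonneg β)]

lemma majG_le_div {X : ℝ} (hX : 0 < X) {β : ℂ} (hβ : 0 < ndist β) :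
    majG X β ≤ √X / ndist β := by
  unfold majG
  have hs := Real.sqrt_pos.2 hX
  rw [div_le_div_iff₀ (majG_den_pos X β) hβ]
  nlinarith [Real.mul_self_sqrt hX.le]

lemma toComplex_mk_mem {T : Set ℂ} (hT : Convex ℝ T) {u v : GaussianInt} {t : ℝ}
    (ht : t ∈ Set.Icc (0 : ℝ) 1) (hu : toComplex u ∈ T) (hv : toComplex v ∈ T) {w : GaussianInt}
    (hre : (w.re : ℝ) = u.re + t * (v.re - u.re)) (him : (w.im : ℝ) = u.im + t * (v.im - u.im)) :
    toComplex w ∈ T := by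
  have := hT.add_smul_sub_mem hu hv ht
  convert this using 1
  apply Complex.ext
  · simpa using hre
  · simpa using him

lemma exists_ratio {a b x : ℤ} (h1 : a ≤ x) (h2 : x ≤ b) :
    ∃ t ∈ Set.Icc (0 : ℝ) 1, (x : ℝ) = a + t * (b - a) := by
  rcases (h1.trans h2).eq_or_lt with rfl | h
  · exact ⟨0, by simp, by simp; exact_mod_cast le_antisymm h2 h1⟩
  have h3 : (0 : ℝ) < b - a := by rw [sub_pos]; exact_mod_cast h
  have h1' : (a : ℝ) ≤ x := by exact_mod_cast h1
  have h2' : (x : ℝ) ≤ b := by exact_mod_cast h2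
  refine ⟨(x - a) / (b - a), ⟨div_nonneg (by linarith) h3.le, (div_le_one h3).2 (by linarith)⟩, ?_⟩
  field_simp
  ring

lemma norm_sum_convex_le {S : Set ℂ} (hS : Convex ℝ S) {X : ℝ} (hX : 1 ≤ X) (β : ℂ) :
    ‖∑ m ∈ gball X with toComplex m ∈ S, e2 (cip (toComplex m) β)‖ ≤ 12 * majG X β := by
  have hX0 : 0 ≤ X := by linarith
  have hX1 : 1 ≤ √X := Real.one_le_sqrt.2 hX
  set T : Set ℂ := S ∩ Metric.closedBall 0 √X with hTdef
  have hT : Convex ℝ T := hS.inter (convex_closedBall 0 √X)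
  set F := (insert 0 (gball X)).filter fun m => toComplex m ∈ S with hFdef
  have hF : ∀ m, m ∈ F ↔ toComplex m ∈ T := by
    intro m
    have h1 : toComplex m ∈ Metric.closedBall 0 √X ↔ (gnorm m : ℝ) ≤ X := by
      rw [mem_closedBall_zero_iff, Real.le_sqrt (_root_.norm_nonneg _) hX0, gnorm_eq_norm_sq]
    rw [hFdef, hTdef, Finset.mem_filter, Finset.mem_insert, mem_gball, Set.mem_inter_iff, h1]
    rcases eq_or_ne m 0 with rfl | hm
    · simp [hX0]
    · simp [hm, and_comm]
  have hmem : ∀ m ∈ F, (gnorm m : ℝ) ≤ X := by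
    intro m hm
    have := ((hF m).1 hm).2
    rwa [mem_closedBall_zero_iff, Real.le_sqrt (_root_.norm_nonneg _) hX0,
      ← gnorm_eq_norm_sq] at this
  have hre : ∀ m ∈ F, |(m.re : ℝ)| ≤ √X ∧ |(m.im : ℝ)| ≤ √X := by
    intro m hm
    have h1 := hmem m hm
    have h2 : (gnorm m : ℝ) = (m.re : ℝ) ^ 2 + (m.im : ℝ) ^ 2 := by
      exact_mod_cast gnorm_eq_sq_add_sq m
    exact ⟨Real.abs_le_sqrt (by nlinarith), Real.abs_le_sqrt (by nlinarith)⟩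
  have hR : ‖∑ m ∈ F, e2 (cip (toComplex m) β)‖ * dInt β.re ≤ 3 / 2 * √X := by
    have h := norm_sum_rows_mul_dInt_le (F.image fun m => (m.re, m.im)) hX1 ?_ ?_ β.re β.im
    · rw [Finset.sum_image] at h
      · simpa [cip] using h
      · intro u _ v _ huv
        simp only [Prod.mk.injEq] at huv
        exact Zsqrtd.ext huv.1 huv.2
    · intro y a b x ha hb hax hxb
      simp only [Finset.mem_image, Prod.mk.injEq] at ha hb ⊢
      obtain ⟨u, hu, rfl, hu2⟩ := ha
      obtain ⟨v, hv, rfl, rfl⟩ := hb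
      obtain ⟨t, ht, htx⟩ := exists_ratio hax hxb
      exact ⟨⟨x, v.im⟩, (hF _).2 (toComplex_mk_mem hT ht ((hF u).1 hu) ((hF v).1 hv) htx
        (by simp [hu2])), rfl, rfl⟩
    · intro p hp
      obtain ⟨m, hm, rfl⟩ := Finset.mem_image.1 hp
      exact (hre m hm).2
  have hI : ‖∑ m ∈ F, e2 (cip (toComplex m) β)‖ * dInt β.im ≤ 3 / 2 * √X := by
    have h := norm_sum_rows_mul_dInt_le (F.image fun m => (m.im, m.re)) hX1 ?_ ?_ β.im β.re
    · rw [Finset.sum_image] at h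
      · simpa [cip, add_comm] using h
      · intro u _ v _ huv
        simp only [Prod.mk.injEq] at huv
        exact Zsqrtd.ext huv.2 huv.1
    · intro y a b x ha hb hax hxb
      simp only [Finset.mem_image, Prod.mk.injEq] at ha hb ⊢
      obtain ⟨u, hu, rfl, hu2⟩ := ha
      obtain ⟨v, hv, rfl, rfl⟩ := hb
      obtain ⟨t, ht, htx⟩ := exists_ratio hax hxb
      exact ⟨⟨v.re, x⟩, (hF _).2 (toComplex_mk_mem hT ht ((hF u).1 hu) ((hF v).1 hv)
        (by simp [hu2]) htx), rfl, rfl⟩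
    · intro p hp
      obtain ⟨m, hm, rfl⟩ := Finset.mem_image.1 hp
      exact (hre m hm).1
  have hcard : ‖∑ m ∈ F, e2 (cip (toComplex m) β)‖ ≤ 9 * X := by
    refine (norm_sum_le _ _).trans ?_
    simp only [norm_e2, Finset.sum_const, nsmul_eq_mul, mul_one]
    have h1 : F.card ≤ (gball X).card + 1 :=
      (Finset.card_filter_le _ _).trans (Finset.card_insert_le _ _)
    have h2 : (F.card : ℝ) ≤ (gball X).card + 1 := by exact_mod_cast h1
    linarith [card_gball_le hX0]
  have hn : ‖∑ m ∈ F, e2 (cip (toComplex m) β)‖ * ndist β ≤ 3 / 2 * √X := by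
    unfold ndist
    rcases max_choice (dInt β.re) (dInt β.im) with h | h <;> rw [h] <;> assumption
  have hdiff : ‖∑ m ∈ gball X with toComplex m ∈ S, e2 (cip (toComplex m) β)‖ ≤
      ‖∑ m ∈ F, e2 (cip (toComplex m) β)‖ + 1 := by
    rw [hFdef, Finset.filter_insert]
    split_ifs with h0
    · rw [Finset.sum_insert (by simp)]
      have := norm_sub_le (e2 (cip (toComplex 0) β) +
        ∑ m ∈ gball X with toComplex m ∈ S, e2 (cip (toComplex m) β)) (e2 (cip (toComplex 0) β))
      rwa [add_sub_cancel_left, norm_e2] at this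
    · linarith
  unfold majG
  rw [mul_div_assoc', le_div_iff₀ (majG_den_pos X β)]
  have hs := Real.mul_self_sqrt hX0
  have hn1 := ndist_le β
  have hn0 := ndist_nonneg β
  set A := ‖∑ m ∈ F, e2 (cip (toComplex m) β)‖
  calc _ ≤ (A + 1) * (1 + √X * ndist β) :=
        mul_le_mul_of_nonneg_right hdiff (majG_den_pos X β).le
    _ = A + √X * (A * ndist β) + 1 + √X * ndist β := by ring
    _ ≤ 9 * X + √X * (3 / 2 * √X) + 1 + √X * (1 / 2) := by gcongr
    _ ≤ 12 * X := by nlinarith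

lemma norm_sum_convex_annulus_le {S : Set ℂ} (hS : Convex ℝ S) (A : ℝ) {X : ℝ} (hX : 1 ≤ X)
    (β : ℂ) :
    ‖∑ m ∈ gball X with A < gnorm m ∧ toComplex m ∈ S, e2 (cip (toComplex m) β)‖ ≤
      24 * majG X β := by
  have hG := majG_nonneg (by linarith : 0 ≤ X) β
  have h1 := norm_sum_convex_le hS hX β
  have h2 : ‖∑ m ∈ gball (min A X) with toComplex m ∈ S, e2 (cip (toComplex m) β)‖ ≤
      12 * majG X β := by
    rcases lt_or_ge (min A X) 1 with h | h
    · simp [gball_eq_empty h, hG]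
    · refine (norm_sum_convex_le hS h β).trans ?_
      gcongr
      exact majG_mono (by linarith) (min_le_right _ _) β
  have h3 : ∑ m ∈ gball X with A < gnorm m ∧ toComplex m ∈ S, e2 (cip (toComplex m) β) =
      ∑ m ∈ gball X with toComplex m ∈ S, e2 (cip (toComplex m) β) -
      ∑ m ∈ gball (min A X) with toComplex m ∈ S, e2 (cip (toComplex m) β) := by
    rw [eq_sub_iff_add_eq, ← Finset.sum_union]
    · refine Finset.sum_congr ?_ fun _ _ => rfl
      ext m
      simp only [Finset.mem_union, Finset.mem_filter, mem_gball, le_min_iff]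
      by_cases h : A < gnorm m
      · simp [h, h.not_ge]
      · simp [h, not_lt.1 h]
    · rw [Finset.disjoint_left]
      intro m hm hm'
      simp only [Finset.mem_filter, mem_gball, le_min_iff] at hm hm'
      linarith [hm.2.1, hm'.1.2.1]
  rw [h3]
  refine (norm_sub_le _ _).trans ?_
  linarith

/-! ### Spacing of dilates of a rational approximation -/

lemma ndist_sub_le (β γ : ℂ) {ρ : ℝ}
    (hre : |(β.re - round β.re) - (γ.re - round γ.re)| ≤ ρ)
    (him : |(β.im - round β.im) - (γ.im - round γ.im)| ≤ ρ) : ndist (β - γ) ≤ ρ := by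
  refine max_le ?_ ?_
  · refine (dInt_le_abs_sub _ (round β.re - round γ.re)).trans (le_trans (le_of_eq ?_) hre)
    congr 1; push_cast; rw [Complex.sub_re]; ring
  · refine (dInt_le_abs_sub _ (round β.im - round γ.im)).trans (le_trans (le_of_eq ?_) him)
    congr 1; push_cast; rw [Complex.sub_im]; ring

/-- Small multiples of `α` stay away from the Gaussian integers. -/
def WellSep (Q : ℝ) (α : ℂ) : Prop :=
  ∀ h : GaussianInt, h ≠ 0 → (gnorm h : ℝ) ≤ Q / 4 → 1 / (3 * √Q) ≤ ndist (toComplex h * α)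

lemma norm_le_two_mul_max (z : ℂ) : ‖z‖ ^ 2 ≤ 2 * (max |z.re| |z.im|) ^ 2 := by
  rw [← Complex.normSq_eq_norm_sq, Complex.normSq_apply]
  have h1 : |z.re| ^ 2 ≤ (max |z.re| |z.im|) ^ 2 := by gcongr; exact le_max_left _ _
  have h2 : |z.im| ^ 2 ≤ (max |z.re| |z.im|) ^ 2 := by gcongr; exact le_max_right _ _
  rw [sq_abs] at h1 h2
  nlinarith

lemma wellSep_of_approx {α : ℂ} {a q : GaussianInt} (hq : q ≠ 0) (haq : IsRelPrime a q)
    (h : Complex.normSq (α - toComplex a / toComplex q) < 1 / (gnorm q : ℝ) ^ 2) :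
    WellSep (gnorm q) α := by
  intro h' hh hhQ
  set Q : ℝ := ((gnorm q : ℕ) : ℝ) with hQ
  have hQ1 : 1 ≤ Q := one_le_gnorm hq
  have hs : 0 < √Q := Real.sqrt_pos.2 (by linarith)
  have hss : √Q * √Q = Q := Real.mul_self_sqrt (by linarith)
  have hq' : toComplex q ≠ 0 := by rwa [Ne, GaussianInt.toComplex_eq_zero]
  have hqn : ‖toComplex q‖ = √Q := by
    rw [hQ, gnorm_eq_norm_sq, Real.sqrt_sq (_root_.norm_nonneg _)]
  have hα : ‖α - toComplex a / toComplex q‖ ≤ 1 / Q := by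
    rw [Complex.normSq_eq_norm_sq, ← one_div_pow] at h
    exact (abs_le_of_sq_le_sq' h.le (by positivity)).2
  have hhn : ‖toComplex h'‖ ≤ √Q / 2 := by
    rw [gnorm_eq_norm_sq] at hhQ
    apply abs_le_of_sq_le_sq' _ (by positivity) |>.2
    nlinarith
  set β := toComplex h' * α
  set z : GaussianInt := ⟨round β.re, round β.im⟩ with hz
  have h1 : 1 / √Q ≤ ‖toComplex h' * (toComplex a / toComplex q) - toComplex z‖ := by
    have hne : h' * a - z * q ≠ 0 := by
      intro h0
      have hd : q ∣ h' * a := ⟨z, by rw [sub_eq_zero.1 h0, mul_comm]⟩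
      have hd' : q ∣ h' := haq.symm.dvd_of_dvd_mul_right hd
      have h2 := gnorm_le_of_dvd hh hd'
      have h3 : Q ≤ gnorm h' := by rw [hQ]; exact_mod_cast h2
      linarith
    have h2 : 1 ≤ ‖toComplex (h' * a - z * q)‖ := by
      have := one_le_gnorm hne
      rw [gnorm_eq_norm_sq] at this
      exact (one_le_sq_iff₀ (_root_.norm_nonneg _)).1 this
    have h3 : toComplex h' * (toComplex a / toComplex q) - toComplex z =
        toComplex (h' * a - z * q) / toComplex q := by
      rw [toComplex_sub, toComplex_mul, toComplex_mul]; field_simp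
    rw [h3, norm_div, hqn]
    gcongr
  have h2 : 1 / √Q ≤ ‖β - toComplex z‖ + 1 / (2 * √Q) := by
    have h3 : toComplex h' * (toComplex a / toComplex q) - toComplex z =
        (β - toComplex z) - toComplex h' * (α - toComplex a / toComplex q) := by ring
    rw [h3] at h1
    refine h1.trans ((norm_sub_le _ _).trans (add_le_add_right ?_ _))
    rw [norm_mul]
    calc _ ≤ √Q / 2 * (1 / Q) := by gcongr
      _ = 1 / (2 * √Q) := by
        rw [← hss]; field_simp
        simp
  have h4 := norm_le_two_mul_max (β - toComplex z)
  have h5 : max |(β - toComplex z).re| |(β - toComplex z).im| = ndist β := by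
    simp [ndist, dInt, hz]
  rw [h5] at h4
  have h6 : 1 / (2 * √Q) ≤ ‖β - toComplex z‖ := by
    have : 1 / √Q = 2 * (1 / (2 * √Q)) := by field_simp
    linarith
  have h7 : (1 / (2 * √Q)) ^ 2 ≤ 2 * ndist β ^ 2 := le_trans (by gcongr) h4
  apply abs_le_of_sq_le_sq' _ (ndist_nonneg β) |>.2
  have h8 : (1 / (3 * √Q)) ^ 2 = 4 / 9 * (1 / (2 * √Q)) ^ 2 := by field_simp; norm_num
  rw [h8]
  nlinarith [sq_nonneg (1 / (2 * √Q))]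

lemma sum_majG_box_le {Q : ℝ} (hQ : 1 ≤ Q) {α : ℂ} (hα : WellSep Q α) {X : ℝ} (hX : 0 < X)
    (B : Finset GaussianInt) (hB : ∀ h ∈ B, ∀ h' ∈ B, (gnorm (h - h') : ℝ) ≤ Q / 4) :
    ∑ h ∈ B, majG X (toComplex h * α) ≤ X + 576 * √X * Q := by
  set ρ : ℝ := 1 / (6 * √Q) with hρ
  have hs : 1 ≤ √Q := Real.one_le_sqrt.2 hQ
  have hss : √Q * √Q = Q := Real.mul_self_sqrt (by linarith)
  have hρ0 : 0 < ρ := by positivity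
  have hρ1 : 1 / ρ = 6 * √Q := by rw [hρ]; field_simp
  have hρ2 : 2 * ρ = 1 / (3 * √Q) := by rw [hρ]; field_simp; norm_num
  set res : ℝ → ℝ := fun t => t - round t with hres
  set c : GaussianInt → GaussianInt := fun h =>
    ⟨round (res (toComplex h * α).re / ρ), round (res (toComplex h * α).im / ρ)⟩ with hc
  have hround : ∀ s t : ℝ, round (s / ρ) = round (t / ρ) → |s - t| ≤ ρ := by
    intro s t hst
    have h1 := abs_le.1 (abs_sub_round (s / ρ))
    have h2 := abs_le.1 (abs_sub_round (t / ρ))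
    rw [hst] at h1
    have h3 : |s / ρ - t / ρ| ≤ 1 := abs_le.2 ⟨by linarith, by linarith⟩
    rwa [← sub_div, abs_div, abs_of_pos hρ0, div_le_one hρ0] at h3
  have hinj : Set.InjOn c B := by
    intro h hh h' hh' heq
    by_contra hne
    have h1 := hα (h - h') (sub_ne_zero.2 hne) (hB h hh h' hh')
    have h2 : ndist (toComplex (h - h') * α) ≤ ρ := by
      rw [toComplex_sub, sub_mul]
      refine ndist_sub_le _ _ (hround _ _ ?_) (hround _ _ ?_)
      · exact congrArg Zsqrtd.re heq
      · exact congrArg Zsqrtd.im heq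
    linarith
  have hcoord : ∀ t : ℝ, ρ * ((round (res t / ρ)).natAbs : ℝ) ≤ dInt t + ρ / 2 := by
    intro t
    have h1 := abs_sub_round (res t / ρ)
    rw [Nat.cast_natAbs, Int.cast_abs]
    have h2 : |(round (res t / ρ) : ℝ)| ≤ |res t / ρ| + 1 / 2 := by
      have h3 := abs_sub_abs_le_abs_sub (round (res t / ρ) : ℝ) (res t / ρ)
      rw [abs_sub_comm] at h3
      linarith
    rw [abs_div, abs_of_pos hρ0] at h2
    have h3 : |res t| = dInt t := rfl
    rw [h3] at h2
    calc _ ≤ ρ * (dInt t / ρ + 1 / 2) := by gcongr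
      _ = _ := by field_simp
  have hsup : ∀ h, ρ * (gsup (c h) : ℝ) ≤ ndist (toComplex h * α) + ρ / 2 := by
    intro h
    have h1 := hcoord (toComplex h * α).re
    have h2 := hcoord (toComplex h * α).im
    have h3 : dInt (toComplex h * α).re ≤ ndist (toComplex h * α) := le_max_left _ _
    have h4 : dInt (toComplex h * α).im ≤ ndist (toComplex h * α) := le_max_right _ _
    rcases max_choice (c h).re.natAbs (c h).im.natAbs with h5 | h5
    · rw [gsup, h5]; linarith
    · rw [gsup, h5]; linarith
  have hpt : ∀ h, majG X (toComplex h * α) ≤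
      if c h = 0 then X else 2 * √X / (ρ * gsup (c h)) := by
    intro h
    split_ifs with h0
    · exact majG_le_self hX.le _
    · have h1 : (1 : ℝ) ≤ gsup (c h) := by
        exact_mod_cast Nat.pos_of_ne_zero (mt gsup_eq_zero.1 h0)
      have h2 : ρ * gsup (c h) / 2 ≤ ndist (toComplex h * α) := by
        have := hsup h
        nlinarith
      have h3 : 0 < ρ * gsup (c h) / 2 := by positivity
      refine (majG_le_div hX (h3.trans_le h2)).trans ?_
      calc √X / ndist (toComplex h * α) ≤ √X / (ρ * gsup (c h) / 2) := by gcongr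
        _ = _ := by field_simp
  have hK : ∀ h, gsup (c h) ≤ ⌊1 / ρ⌋₊ := by
    intro h
    apply Nat.le_floor
    have h1 := hsup h
    have h2 := ndist_le (toComplex h * α)
    rw [le_div_iff₀ hρ0]
    have h3 : ρ ≤ 1 := by
      rw [hρ, div_le_one (by positivity)]; linarith
    linarith
  calc ∑ h ∈ B, majG X (toComplex h * α)
      ≤ ∑ h ∈ B, if c h = 0 then X else 2 * √X / (ρ * gsup (c h)) :=
        Finset.sum_le_sum fun h _ => hpt h
    _ = ∑ w ∈ B.image c, if w = 0 then X else 2 * √X / (ρ * gsup w) := by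
        rw [Finset.sum_image hinj]
    _ = ∑ w ∈ B.image c with w = 0, X +
        ∑ w ∈ B.image c with ¬ w = 0, 2 * √X / (ρ * gsup w) := by
        rw [Finset.sum_ite]
    _ ≤ X + ∑ k ∈ Finset.Icc 1 ⌊1 / ρ⌋₊, 8 * (k : ℝ) * (2 * √X / (ρ * k)) := by
        gcongr
        · rw [Finset.sum_const, nsmul_eq_mul]
          have h1 : ((B.image c).filter fun w => w = 0).card ≤ 1 := by
            rw [Finset.card_le_one]
            intro u hu v hv
            rw [(Finset.mem_filter.1 hu).2, (Finset.mem_filter.1 hv).2]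
          have h2 : (((B.image c).filter fun w => w = 0).card : ℝ) ≤ 1 := by exact_mod_cast h1
          nlinarith
        · refine sum_le_sum_shells _ _ _ (fun k => 2 * √X / (ρ * k))
            (fun w hw => (Finset.mem_filter.1 hw).2) ?_ (fun _ _ => le_rfl)
            (fun k => by positivity)
          intro w hw
          obtain ⟨h, _, rfl⟩ := Finset.mem_image.1 (Finset.mem_filter.1 hw).1
          exact hK h
    _ = X + ⌊1 / ρ⌋₊ * (16 * √X / ρ) := by
        congr 1
        rw [Finset.sum_congr rfl (g := fun _ => 16 * √X / ρ)]
        · simp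
        · intro k hk
          have : (0 : ℝ) < k := by
            have := (Finset.mem_Icc.1 hk).1
            positivity
          field_simp
          norm_num
    _ ≤ X + 1 / ρ * (16 * √X / ρ) := by
        gcongr
        exact Nat.floor_le (by positivity)
    _ = X + 16 * √X * (1 / ρ) ^ 2 := by ring
    _ = X + 576 * √X * Q := by rw [hρ1, mul_pow, sq √Q, hss]; ring

/-- The large sieve type bound for sums of the majorant over a ball. -/
lemma sum_majG_le {Q : ℝ} (hQ : 1 ≤ Q) {α : ℂ} (hα : WellSep Q α) {X : ℝ} (hX : 0 < X) {K : ℝ}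
    (hK : 0 ≤ K) (F : Finset GaussianInt) (hF : ∀ h ∈ F, (gnorm h : ℝ) ≤ K) :
    ∑ h ∈ F, majG X (toComplex h * α) ≤ 288 * (1 + K / Q) * (X + 576 * √X * Q) := by
  have hs : 0 < √Q := Real.sqrt_pos.2 (by linarith)
  have hss : √Q * √Q = Q := Real.mul_self_sqrt (by linarith)
  set L := √Q / 4 with hL
  have hL0 : 0 < L := by positivity
  set b : GaussianInt → ℤ × ℤ := fun h => (⌊(h.re : ℝ) / L⌋, ⌊(h.im : ℝ) / L⌋) with hb
  have hfl : ∀ x y : ℝ, ⌊x / L⌋ = ⌊y / L⌋ → (x - y) ^ 2 ≤ Q / 16 := by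
    intro x y h
    have h1 := Int.abs_sub_lt_one_of_floor_eq_floor h
    rw [← sub_div, abs_div, abs_of_pos hL0, div_lt_one hL0] at h1
    rw [← sq_abs]
    have := abs_nonneg (x - y)
    nlinarith
  have hbox : ∀ w ∈ F.image b, ∑ h ∈ F with b h = w, majG X (toComplex h * α) ≤
      X + 576 * √X * Q := by
    intro w _
    refine sum_majG_box_le hQ hα hX _ fun h hh h' hh' => ?_
    have heq := (Finset.mem_filter.1 hh).2.trans (Finset.mem_filter.1 hh').2.symm
    simp only [hb, Prod.mk.injEq] at heq
    have h1 := hfl _ _ heq.1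
    have h2 := hfl _ _ heq.2
    have h3 : (gnorm (h - h') : ℝ) = ((h.re : ℝ) - h'.re) ^ 2 + ((h.im : ℝ) - h'.im) ^ 2 := by
      have := gnorm_eq_sq_add_sq (h - h')
      rw [Zsqrtd.re_sub, Zsqrtd.im_sub] at this
      exact_mod_cast this
    linarith
  have hR : 1 ≤ √K / L + 1 := by
    have : 0 ≤ √K / L := by positivity
    linarith
  have habs : ∀ x : ℤ, (x : ℝ) ^ 2 ≤ K → |(⌊(x : ℝ) / L⌋ : ℝ)| ≤ √K / L + 1 := by
    intro x hx
    have h1 := Real.abs_le_sqrt hx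
    have h2 : |(x : ℝ) / L| ≤ √K / L := by
      rw [abs_div, abs_of_pos hL0]; gcongr
    have h3 := abs_le.1 h2
    rw [abs_le]
    exact ⟨by linarith [Int.sub_one_lt_floor ((x : ℝ) / L)], by linarith [Int.floor_le ((x : ℝ) / L)]⟩
  have hcoord : ∀ h ∈ F, (h.re : ℝ) ^ 2 ≤ K ∧ (h.im : ℝ) ^ 2 ≤ K := by
    intro h hh
    have h1 := hF h hh
    have h2 : (gnorm h : ℝ) = (h.re : ℝ) ^ 2 + (h.im : ℝ) ^ 2 := by
      exact_mod_cast gnorm_eq_sq_add_sq h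
    constructor <;> nlinarith
  have hcard : ((F.image b).card : ℝ) ≤ 288 * (1 + K / Q) := by
    have h1 : F.image b ⊆ (F.image fun h => ⌊(h.re : ℝ) / L⌋) ×ˢ
        (F.image fun h => ⌊(h.im : ℝ) / L⌋) := by
      intro w hw
      obtain ⟨h, hh, rfl⟩ := Finset.mem_image.1 hw
      exact Finset.mem_product.2 ⟨Finset.mem_image_of_mem _ hh, Finset.mem_image_of_mem _ hh⟩
    have h2 := Finset.card_le_card h1
    rw [Finset.card_product] at h2
    have h3 := card_le_of_abs_le (F := F.image fun h => ⌊(h.re : ℝ) / L⌋) hR (by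
      intro x hx
      obtain ⟨h, hh, rfl⟩ := Finset.mem_image.1 hx
      exact habs _ (hcoord h hh).1)
    have h4 := card_le_of_abs_le (F := F.image fun h => ⌊(h.im : ℝ) / L⌋) hR (by
      intro x hx
      obtain ⟨h, hh, rfl⟩ := Finset.mem_image.1 hx
      exact habs _ (hcoord h hh).2)
    have h5 : ((F.image b).card : ℝ) ≤ (3 * (√K / L + 1)) * (3 * (√K / L + 1)) := by
      refine le_trans (by exact_mod_cast h2) (mul_le_mul h3 h4 (by positivity) (by linarith))
    have h6 : (√K / L) ^ 2 = 16 * (K / Q) := by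
      rw [hL, div_pow, Real.sq_sqrt hK, div_pow, Real.sq_sqrt (by linarith)]
      field_simp; norm_num
    have h7 : 0 ≤ K / Q := by positivity
    nlinarith [sq_nonneg (√K / L - 1)]
  rw [← Finset.sum_fiberwise_of_maps_to (t := F.image b) (g := b)
    fun h hh => Finset.mem_image_of_mem _ hh]
  refine (Finset.sum_le_sum hbox).trans ?_
  rw [Finset.sum_const, nsmul_eq_mul]
  gcongr

lemma sum_majG_star_le {Q : ℝ} (hQ : 1 ≤ Q) {α : ℂ} (hα : WellSep Q α) {X : ℝ} (hX : 0 < X)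
    {K : ℝ} (hK : 0 ≤ K) (F : Finset GaussianInt) (hF : ∀ h ∈ F, (gnorm h : ℝ) ≤ K) :
    ∑ h ∈ F, majG X (toComplex (star h) * α) ≤ 288 * (1 + K / Q) * (X + 576 * √X * Q) := by
  rw [← Finset.sum_image (f := fun h => majG X (toComplex h * α)) star_injective.injOn]
  refine sum_majG_le hQ hα hX hK _ fun h hh => ?_
  obtain ⟨h', hh', rfl⟩ := Finset.mem_image.1 hh
  rw [gnorm_star]; exact hF _ hh'

/-! ### Type I sums -/

lemma sum_majG_typeI_le {Q : ℝ} (hQ : 1 ≤ Q) {α : ℂ} (hα : WellSep Q α) {N D : ℝ} (hD : 1 ≤ D)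
    (hDN : D ≤ N) :
    ∑ f ∈ gball D, majG (N / gnorm f) (toComplex (star f) * α) ≤
      24 * D * √(Q * N) + 1000000 * (N / Q + √(N * D)) * (1 + Real.log N) := by
  have hN : 0 < N := by linarith
  have hs : 0 < √Q := Real.sqrt_pos.2 (by linarith)
  rw [← Finset.sum_filter_add_sum_filter_not (gball D) fun f => (gnorm f : ℝ) ≤ Q / 4]
  refine add_le_add ?_ ?_
  · calc _ ≤ ∑ f ∈ gball D with (gnorm f : ℝ) ≤ Q / 4, 3 * √(Q * N) := by
          refine Finset.sum_le_sum fun f hf => ?_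
          rw [Finset.mem_filter, mem_gball] at hf
          have hf1 := one_le_gnorm hf.1.1
          have hf0 : (0 : ℝ) < gnorm f := by linarith
          have h1 := hα (star f) (by simpa using hf.1.1) (by rw [gnorm_star]; exact hf.2)
          have h2 : 0 < 1 / (3 * √Q) := by positivity
          refine (majG_le_div (by positivity) (h2.trans_le h1)).trans ?_
          calc √(N / gnorm f) / ndist (toComplex (star f) * α) ≤ √N / (1 / (3 * √Q)) := by
                gcongr
                exact div_le_self hN.le hf1
            _ = 3 * (√Q * √N) := by field_simp
            _ = 3 * √(Q * N) := by rw [Real.sqrt_mul (by linarith)]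
      _ = (((gball D).filter fun f => (gnorm f : ℝ) ≤ Q / 4).card : ℝ) * (3 * √(Q * N)) := by simp
      _ ≤ (8 * D) * (3 * √(Q * N)) := by
          gcongr
          refine le_trans ?_ (card_gball_le (by linarith : 0 ≤ D))
          exact_mod_cast Finset.card_filter_le _ _
      _ = _ := by ring
  · set T := (gball D).filter fun f => ¬ (gnorm f : ℝ) ≤ Q / 4 with hT
    have hTm : ∀ f ∈ T, (1 : ℝ) ≤ gnorm f ∧ (gnorm f : ℝ) ≤ D ∧ Q / 4 < gnorm f := by
      intro f hf
      rw [hT, Finset.mem_filter, mem_gball, not_le] at hf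
      exact ⟨one_le_gnorm hf.1.1, hf.1.2, hf.2⟩
    set c := 1440 * (1 / Q) * (N / D + 576 * √(N / D) * Q) with hc
    have hc0 : 0 ≤ c := by positivity
    have h1 := sum_div_le_of_partial_sum_le T gnorm
      (fun f => majG (N / D) (toComplex (star f) * α)) (M := ⌊D⌋₊) (c := c)
      (fun f hf => ⟨by exact_mod_cast (hTm f hf).1, Nat.le_floor (hTm f hf).2.1⟩)
      (Nat.le_floor (by simpa using hD)) hc0 (by
        intro j hj
        rcases le_or_gt (j : ℝ) (Q / 4) with hjQ | hjQ
        · rw [Finset.filter_false_of_mem]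
          · simp; positivity
          · intro f hf hfj
            have h2 : (gnorm f : ℝ) ≤ j := by exact_mod_cast hfj
            linarith [(hTm f hf).2.2]
        · have h2 := sum_majG_star_le hQ hα (X := N / D) (by positivity) (K := j)
            (by positivity) (T.filter fun f => gnorm f ≤ j)
            (fun f hf => by exact_mod_cast (Finset.mem_filter.1 hf).2)
          refine h2.trans ?_
          have h3 : 1 + (j : ℝ) / Q ≤ 5 * (j / Q) := by
            have : 1 / 4 < (j : ℝ) / Q := by rw [lt_div_iff₀ (by linarith)]; linarith
            linarith
          calc _ ≤ 288 * (5 * (j / Q)) * (N / D + 576 * √(N / D) * Q) := by gcongr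
            _ = _ := by rw [hc]; ring)
    have h2 : ∀ f ∈ T, majG (N / gnorm f) (toComplex (star f) * α) ≤
        D * (majG (N / D) (toComplex (star f) * α) / gnorm f) := by
      intro f hf
      obtain ⟨hf1, hfD, -⟩ := hTm f hf
      have hf0 : (0 : ℝ) < gnorm f := by linarith
      unfold majG
      have h3 : √(N / D) ≤ √(N / gnorm f) := by gcongr
      have h4 := ndist_nonneg (toComplex (star f) * α)
      have h5 := majG_den_pos (N / D) (toComplex (star f) * α)
      calc _ ≤ (N / gnorm f) / (1 + √(N / D) * ndist (toComplex (star f) * α)) := by gcongr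
        _ = _ := by field_simp
    have hlog : Real.log ⌊D⌋₊ ≤ Real.log N := by
      apply Real.log_le_log
      · have := Nat.floor_pos.2 hD
        positivity
      · exact (Nat.floor_le (by linarith)).trans hDN
    calc _ ≤ ∑ f ∈ T, D * (majG (N / D) (toComplex (star f) * α) / gnorm f) :=
          Finset.sum_le_sum h2
      _ ≤ D * (c * (1 + Real.log N)) := by
          rw [← Finset.mul_sum]
          gcongr
          exact h1.trans (by gcongr)
      _ = (1440 * (N / Q) + 829440 * √(N * D)) * (1 + Real.log N) := by
          have h3 : D * √(N / D) = √(N * D) := by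
            rw [Real.sqrt_div hN.le, Real.sqrt_mul hN.le]
            have : √D * √D = D := Real.mul_self_sqrt (by linarith)
            have : 0 < √D := Real.sqrt_pos.2 (by linarith)
            field_simp
            nlinarith
          rw [← h3, hc]
          have : Q ≠ 0 := by linarith
          field_simp
          ring
      _ ≤ _ := by
          have : 0 ≤ Real.log N := Real.log_nonneg (by linarith)
          have : 0 ≤ N / Q := by positivity
          have := Real.sqrt_nonneg (N * D)
          gcongr ?_ * _
          linarith

/-- The additive character restricted to a set. -/
def chiS (S : Set ℂ) (α : ℂ) (n : GaussianInt) : ℂ :=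
  if toComplex n ∈ S then e2 (cip (toComplex n) α) else 0

lemma cip_mul (d m : GaussianInt) (α : ℂ) :
    cip (toComplex (d * m)) α = cip (toComplex m) (toComplex (star d) * α) := by
  simp [cip, toComplex_mul, GaussianInt.toComplex_star]
  ring

lemma convex_preimage_mul {S : Set ℂ} (hS : Convex ℝ S) (d : ℂ) :
    Convex ℝ {z : ℂ | d * z ∈ S} :=
  hS.is_linear_preimage (f := fun z => d * z)
    ⟨fun x y => mul_add d x y, fun c x => by simp [mul_left_comm]⟩

lemma sum_chiS_mul {S : Set ℂ} (α : ℂ) (X : ℝ) (d : GaussianInt) :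
    ∑ m ∈ gball X, chiS S α (d * m) =
      ∑ m ∈ gball X with toComplex m ∈ {z : ℂ | toComplex d * z ∈ S},
        e2 (cip (toComplex m) (toComplex (star d) * α)) := by
  rw [Finset.sum_filter]
  refine Finset.sum_congr rfl fun m _ => ?_
  simp only [chiS, cip_mul]
  simp only [toComplex_mul, Set.mem_ofPred_eq]

lemma norm_sum_chiS_mul_le {S : Set ℂ} (hS : Convex ℝ S) (α : ℂ) {X : ℝ} (hX : 1 ≤ X)
    (d : GaussianInt) :
    ‖∑ m ∈ gball X, chiS S α (d * m)‖ ≤ 12 * majG X (toComplex (star d) * α) := by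
  rw [sum_chiS_mul]
  exact norm_sum_convex_le (convex_preimage_mul hS _) hX _

lemma norm_sum_typeI_le {Q : ℝ} (hQ : 1 ≤ Q) {α : ℂ} (hα : WellSep Q α) {N D B : ℝ} (hD : 1 ≤ D)
    (hDN : D ≤ N) (hB : 0 ≤ B) (I : GaussianInt → ℂ)
    (hI : ∀ d ∈ gball D, ‖I d‖ ≤ B * majG (N / gnorm d) (toComplex (star d) * α)) :
    ‖∑ d ∈ gball D, I d‖ ≤
      B * (24 * D * √(Q * N) + 1000000 * (N / Q + √(N * D)) * (1 + Real.log N)) := by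
  refine (norm_sum_le _ _).trans ((Finset.sum_le_sum hI).trans ?_)
  rw [← Finset.mul_sum]
  gcongr
  exact sum_majG_typeI_le hQ hα hD hDN

lemma norm_sum_log_chiS_mul_le {S : Set ℂ} (hS : Convex ℝ S) (α : ℂ) {X : ℝ} (hX : 1 ≤ X)
    (d : GaussianInt) :
    ‖∑ m ∈ gball X, (Real.log (gnorm m) : ℂ) * chiS S α (d * m)‖ ≤
      24 * Real.log X * majG X (toComplex (star d) * α) := by
  have hG := majG_nonneg (by linarith : 0 ≤ X) (toComplex (star d) * α)
  have h := norm_sum_smul_le_of_monotone (gball X) gnorm (fun m => chiS S α (d * m))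
    (h := fun n => Real.log n) (H := Real.log X)
    (B := 12 * majG X (toComplex (star d) * α))
    (fun a b hab => by
      rcases Nat.eq_zero_or_pos a with rfl | ha
      · simp only [Nat.cast_zero, Real.log_zero]; exact Real.log_natCast_nonneg b
      · exact Real.log_le_log (by positivity) (by exact_mod_cast hab))
    (by simp)
    (fun m hm => by
      rw [mem_gball] at hm
      exact Real.log_le_log (by linarith [one_le_gnorm hm.1]) hm.2)
    (by simpa using Real.log_nonneg hX)
    (fun j => by
      rw [filter_gball_gnorm_le]
      rcases lt_or_ge (min X j) 1 with h | h
      · rw [gball_eq_empty h, Finset.sum_empty, norm_zero]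
        linarith
      · refine (norm_sum_chiS_mul_le hS α h d).trans ?_
        gcongr
        exact majG_mono (by linarith) (min_le_left _ _) _)
  simp only [Complex.real_smul] at h
  refine h.trans (le_of_eq ?_)
  ring

/-! ### Type II sums -/

lemma bilinear_weight_le {N K Q U V : ℝ} (hV : 1 ≤ V) (hU : 1 ≤ U) (hVK : V ≤ K)
    (hUX : U ≤ N / K) (hQ : 1 ≤ Q) (hQN : Q ^ 2 ≤ N) :
    (N / K) * ((1 + 4 * K / Q) * (N / K + 576 * √(N / K) * Q)) ≤
      2304 * (1 / Q + 2 / √V + 1 / √U) * (N ^ 2 / K) := by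
  have hK : 0 < K := by linarith
  obtain ⟨X, hX⟩ : ∃ X, X = N / K := ⟨_, rfl⟩
  have hN : N = X * K := by rw [hX]; field_simp
  rw [← hX] at hUX ⊢
  have hX0 : 0 < X := by linarith
  have hN2 : N ^ 2 / K = X ^ 2 * K := by rw [hN]; field_simp
  rw [hN2]
  set s := √X with hs
  have hs0 : 0 < s := Real.sqrt_pos.2 hX0
  have hss : s * s = X := Real.mul_self_sqrt hX0.le
  have hv : 1 ≤ √V := Real.one_le_sqrt.2 hV
  have hvv : √V * √V = V := Real.mul_self_sqrt (by linarith)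
  have hu : 1 ≤ √U := Real.one_le_sqrt.2 hU
  have hus : √U ≤ s := Real.sqrt_le_sqrt hUX
  have hk : 0 < √K := Real.sqrt_pos.2 hK
  have hkk : √K * √K = K := Real.mul_self_sqrt hK.le
  have hvk : √V ≤ √K := Real.sqrt_le_sqrt hVK
  have h1 : X ^ 2 ≤ X ^ 2 * K * (1 / √V) := by
    rw [mul_one_div, le_div_iff₀ (by linarith)]
    gcongr
    nlinarith
  have hQs : Q ≤ s * √K := by
    apply abs_le_of_sq_le_sq' _ (by positivity) |>.2
    calc Q ^ 2 ≤ X * K := hN ▸ hQN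
      _ = (s * √K) ^ 2 := by rw [mul_pow, sq, sq, hss, hkk]
  have h2 : X * s * Q ≤ X ^ 2 * K * (1 / √V) := by
    rw [mul_one_div, le_div_iff₀ (by linarith)]
    calc X * s * Q * √V ≤ X * s * (s * √K) * √K := by gcongr
      _ = X * (s * s) * (√K * √K) := by ring
      _ = X ^ 2 * K := by rw [hss, hkk]; ring
  have h4 : X * s * K ≤ X ^ 2 * K * (1 / √U) := by
    rw [mul_one_div, le_div_iff₀ (by linarith)]
    calc X * s * K * √U ≤ X * s * K * s := by gcongr
      _ = X * (s * s) * K := by ring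
      _ = X ^ 2 * K := by rw [hss]; ring
  have h5 : 0 ≤ X ^ 2 * K * (1 / Q) := by positivity
  have h6 : 0 ≤ X ^ 2 * K * (1 / √V) := by positivity
  have hQ0 : Q ≠ 0 := by linarith
  calc _ = X ^ 2 + 576 * (X * s * Q) + 4 * (X ^ 2 * K * (1 / Q)) + 2304 * (X * s * K) := by
        field_simp; ring
    _ ≤ X ^ 2 * K * (1 / √V) + 576 * (X ^ 2 * K * (1 / √V)) + 4 * (X ^ 2 * K * (1 / Q)) +
        2304 * (X ^ 2 * K * (1 / √U)) := by gcongr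
    _ ≤ 2304 * (X ^ 2 * K * (1 / Q)) + 4608 * (X ^ 2 * K * (1 / √V)) +
        2304 * (X ^ 2 * K * (1 / √U)) := by linarith
    _ = _ := by ring

/-- The character `χ(em)` cut off at `N(em) ≤ N`. -/
def chiN (S : Set ℂ) (α : ℂ) (N : ℝ) (e m : GaussianInt) : ℂ :=
  if (gnorm e : ℝ) * gnorm m ≤ N then chiS S α (e * m) else 0

lemma gnorm_sub_le {e₁ e₂ : GaussianInt} (h : gnorm e₂ ≤ gnorm e₁) :
    (gnorm (e₁ - e₂) : ℝ) ≤ 4 * gnorm e₁ := by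
  have h' : (gnorm e₂ : ℝ) ≤ gnorm e₁ := by exact_mod_cast h
  rw [gnorm_eq_norm_sq, gnorm_eq_norm_sq, toComplex_sub] at *
  have h1 : ‖toComplex e₂‖ ≤ ‖toComplex e₁‖ :=
    abs_le_of_sq_le_sq' h' (_root_.norm_nonneg _) |>.2
  have h2 := norm_sub_le (toComplex e₁) (toComplex e₂)
  have h3 := _root_.norm_nonneg (toComplex e₁ - toComplex e₂)
  nlinarith

lemma norm_sum_weight_convex_le {S : Set ℂ} (hS : Convex ℝ S) (U : ℝ) {X : ℝ} (hX : 1 ≤ X)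
    (β : ℂ) :
    ‖∑ m ∈ gball X with U < gnorm m ∧ toComplex m ∈ S,
      (gnorm m : ℂ) * e2 (cip (toComplex m) β)‖ ≤ 48 * X * majG X β := by
  have hG := majG_nonneg (by linarith : 0 ≤ X) β
  have h := norm_sum_smul_le_of_monotone
    ((gball X).filter fun m => U < gnorm m ∧ toComplex m ∈ S) gnorm
    (fun m => e2 (cip (toComplex m) β)) (h := fun n => (n : ℝ)) (H := X)
    (B := 24 * majG X β) Nat.mono_cast (by simp)
    (fun m hm => (mem_gball.1 (Finset.mem_filter.1 hm).1).2)
    (by simp; linarith)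
    (fun j => by
      rw [Finset.filter_filter]
      simp only [and_comm (b := gnorm _ ≤ j)]
      rw [← Finset.filter_filter, filter_gball_gnorm_le]
      rcases lt_or_ge (min X j) 1 with h | h
      · simp [gball_eq_empty h, hG]
      · refine (norm_sum_convex_annulus_le hS U h β).trans ?_
        gcongr
        exact majG_mono (by linarith) (min_le_left _ _) _)
  simp only [Complex.real_smul, Complex.ofReal_natCast] at h
  refine h.trans (le_of_eq ?_)
  ring

/-- The correlation of two cut-off characters. -/
def corr (S : Set ℂ) (α : ℂ) (N U : ℝ) (e₁ e₂ : GaussianInt) : ℂ :=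
  ∑ m ∈ gball N with U < gnorm m,
    (gnorm m : ℂ) * (chiN S α N e₁ m * (starRingEnd ℂ) (chiN S α N e₂ m))

lemma norm_corr_comm (S : Set ℂ) (α : ℂ) (N U : ℝ) (e₁ e₂ : GaussianInt) :
    ‖corr S α N U e₁ e₂‖ = ‖corr S α N U e₂ e₁‖ := by
  rw [← Complex.norm_conj (corr S α N U e₁ e₂)]
  congr 1
  rw [corr, corr, map_sum]
  refine Finset.sum_congr rfl fun m _ => ?_
  simp only [map_mul, Complex.conj_conj, map_natCast]
  ring

lemma norm_corr_le {S : Set ℂ} (hS : Convex ℝ S) (α : ℂ) {N U : ℝ} (hU : 1 ≤ U)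
    {e₁ e₂ : GaussianInt} (he₁ : e₁ ≠ 0) (h : gnorm e₂ ≤ gnorm e₁) :
    ‖corr S α N U e₁ e₂‖ ≤ if U ≤ N / gnorm e₁ then
      48 * (N / gnorm e₁) * majG (N / gnorm e₁) (toComplex (star (e₁ - e₂)) * α) else 0 := by
  have h1 := one_le_gnorm he₁
  have h0 : (0 : ℝ) < gnorm e₁ := by linarith
  obtain ⟨S', hS'⟩ : ∃ S' : Set ℂ,
    S' = {z : ℂ | toComplex e₁ * z ∈ S} ∩ {z : ℂ | toComplex e₂ * z ∈ S} := ⟨_, rfl⟩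
  have hS'c : Convex ℝ S' := by
    rw [hS']; exact (convex_preimage_mul hS _).inter (convex_preimage_mul hS _)
  have hle : ∀ m : GaussianInt, (gnorm e₁ : ℝ) * gnorm m ≤ N → (gnorm e₂ : ℝ) * gnorm m ≤ N :=
    fun m hm => le_trans (by gcongr) hm
  have hcorr : corr S α N U e₁ e₂ = ∑ m ∈ gball (N / gnorm e₁) with
      U < gnorm m ∧ toComplex m ∈ S',
      (gnorm m : ℂ) * e2 (cip (toComplex m) (toComplex (star (e₁ - e₂)) * α)) := by
    rw [corr, Finset.sum_filter, Finset.sum_filter]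
    symm
    refine Finset.sum_congr_of_eq_on_inter ?_ ?_ ?_
    · intro m hm hm'
      rw [mem_gball] at hm hm'
      have h2 := one_le_gnorm hm.1
      have h3 : (gnorm m : ℝ) * gnorm e₁ ≤ N := (le_div_iff₀ h0).1 hm.2
      exact absurd ⟨hm.1, by nlinarith⟩ hm'
    · intro m hm hm'
      rw [mem_gball] at hm hm'
      have h3 : ¬ (gnorm e₁ : ℝ) * gnorm m ≤ N := fun h3 =>
        hm' ⟨hm.1, (le_div_iff₀' h0).2 h3⟩
      simp [chiN, h3]
    · intro m hm _
      have h3 : (gnorm e₁ : ℝ) * gnorm m ≤ N := (le_div_iff₀' h0).1 (mem_gball.1 hm).2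
      simp only [chiN, h3, hle m h3, if_true, chiS, toComplex_mul, ite_and, hS',
        Set.mem_inter_iff, Set.mem_ofPred_eq]
      split_ifs <;> try simp only [map_zero, mul_zero, zero_mul]
      rw [conj_e2, ← e2_add]
      congr 2
      simp [cip, toComplex_star]
      ring
  rw [hcorr]
  split_ifs with hX
  · exact norm_sum_weight_convex_le hS'c U (hU.trans hX) _
  · rw [Finset.filter_false_of_mem]
    · simp
    · intro m hm hm'
      rw [mem_gball] at hm
      linarith [hm'.1]

/-- Cauchy-Schwarz for a bilinear sum, with weight `gnorm m` on the inner sums. -/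
lemma norm_bilinear_sq_le (E M : Finset GaussianInt) (hM : ∀ m ∈ M, m ≠ 0)
    (b c : GaussianInt → ℝ) (z : GaussianInt → GaussianInt → ℂ) :
    ‖∑ e ∈ E, (b e : ℂ) * ∑ m ∈ M, (c m : ℂ) * z e m‖ ^ 2 ≤
      (∑ m ∈ M, c m ^ 2 / gnorm m) *
        ∑ e₁ ∈ E, ∑ e₂ ∈ E, |b e₁| * |b e₂| *
          ‖∑ m ∈ M, (gnorm m : ℂ) * (z e₁ m * (starRingEnd ℂ) (z e₂ m))‖ := by
  have h1 : ‖∑ e ∈ E, (b e : ℂ) * ∑ m ∈ M, (c m : ℂ) * z e m‖ ≤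
      ∑ m ∈ M, (|c m| / √(gnorm m)) * (√(gnorm m) * ‖∑ e ∈ E, (b e : ℂ) * z e m‖) := by
    calc _ = ‖∑ m ∈ M, (c m : ℂ) * ∑ e ∈ E, (b e : ℂ) * z e m‖ := by
          simp only [Finset.mul_sum]
          rw [Finset.sum_comm]
          congr 1
          refine Finset.sum_congr rfl fun m _ => Finset.sum_congr rfl fun e _ => ?_
          ring
      _ ≤ _ := by
          refine norm_sum_le_of_le _ fun m hm => ?_
          have h2 : (0 : ℝ) < √(gnorm m) :=
            Real.sqrt_pos.2 (by linarith [one_le_gnorm (hM m hm)])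
          rw [norm_mul, Complex.norm_real, Real.norm_eq_abs, ← mul_assoc,
            div_mul_cancel₀ _ h2.ne']
  have h3 : ∑ m ∈ M, (√(gnorm m) * ‖∑ e ∈ E, (b e : ℂ) * z e m‖) ^ 2 ≤
      ∑ e₁ ∈ E, ∑ e₂ ∈ E, |b e₁| * |b e₂| *
          ‖∑ m ∈ M, (gnorm m : ℂ) * (z e₁ m * (starRingEnd ℂ) (z e₂ m))‖ := by
    have h4 : ((∑ m ∈ M, (√(gnorm m) * ‖∑ e ∈ E, (b e : ℂ) * z e m‖) ^ 2 : ℝ) : ℂ) =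
        ∑ e₁ ∈ E, ∑ e₂ ∈ E, ((b e₁ : ℂ) * b e₂) *
          ∑ m ∈ M, (gnorm m : ℂ) * (z e₁ m * (starRingEnd ℂ) (z e₂ m)) := by
      have h5 : ∀ m, (((√(gnorm m) * ‖∑ e ∈ E, (b e : ℂ) * z e m‖) ^ 2 : ℝ) : ℂ) =
          ∑ e₁ ∈ E, ∑ e₂ ∈ E, ((b e₁ : ℂ) * b e₂) *
            ((gnorm m : ℂ) * (z e₁ m * (starRingEnd ℂ) (z e₂ m))) := by
        intro m
        rw [mul_pow, Real.sq_sqrt (by positivity), Complex.ofReal_mul, Complex.ofReal_pow,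
          ← Complex.mul_conj', map_sum, Finset.sum_mul_sum, Finset.mul_sum]
        refine Finset.sum_congr rfl fun e₁ _ => ?_
        rw [Finset.mul_sum]
        refine Finset.sum_congr rfl fun e₂ _ => ?_
        simp only [map_mul, Complex.conj_ofReal, Complex.ofReal_natCast]
        ring
      rw [Complex.ofReal_sum, Finset.sum_congr rfl fun m _ => h5 m, Finset.sum_comm]
      refine Finset.sum_congr rfl fun e₁ _ => ?_
      rw [Finset.sum_comm]
      simp only [Finset.mul_sum]
    have h6 : 0 ≤ ∑ m ∈ M, (√(gnorm m) * ‖∑ e ∈ E, (b e : ℂ) * z e m‖) ^ 2 :=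
      Finset.sum_nonneg fun _ _ => sq_nonneg _
    rw [← abs_of_nonneg h6, ← Real.norm_eq_abs, ← Complex.norm_real, h4]
    refine norm_sum_le_of_le _ fun e₁ _ => norm_sum_le_of_le _ fun e₂ _ => ?_
    simp
  calc _ ≤ (∑ m ∈ M, (|c m| / √(gnorm m)) * (√(gnorm m) * ‖∑ e ∈ E, (b e : ℂ) * z e m‖)) ^ 2 := by
        gcongr
    _ ≤ (∑ m ∈ M, (|c m| / √(gnorm m)) ^ 2) *
        ∑ m ∈ M, (√(gnorm m) * ‖∑ e ∈ E, (b e : ℂ) * z e m‖) ^ 2 :=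
        Finset.sum_mul_sq_le_sq_mul_sq _ _ _
    _ ≤ _ := by
        have h7 : ∑ m ∈ M, (|c m| / √(gnorm m)) ^ 2 = ∑ m ∈ M, c m ^ 2 / gnorm m :=
          Finset.sum_congr rfl fun m _ => by
            rw [div_pow, sq_abs, Real.sq_sqrt (by positivity)]
        rw [h7]
        gcongr

lemma sum_sum_le_two_mul_of_symm {ι : Type*} (E : Finset ι) (ν : ι → ℕ) (F : ι → ι → ℝ)
    (hF : ∀ x y, F x y = F y x) (h0 : ∀ x y, 0 ≤ F x y) :
    ∑ x ∈ E, ∑ y ∈ E, F x y ≤ 2 * ∑ x ∈ E, ∑ y ∈ E with ν y ≤ ν x, F x y := by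
  have h1 : ∑ x ∈ E, ∑ y ∈ E, (if ν x ≤ ν y then F x y else 0) =
      ∑ x ∈ E, ∑ y ∈ E, (if ν y ≤ ν x then F x y else 0) := by
    rw [Finset.sum_comm]
    refine Finset.sum_congr rfl fun x _ => Finset.sum_congr rfl fun y _ => ?_
    rw [hF x y]
  simp only [Finset.sum_filter]
  rw [two_mul]
  nth_rewrite 1 [← h1]
  rw [← Finset.sum_add_distrib]
  refine Finset.sum_le_sum fun x _ => ?_
  rw [← Finset.sum_add_distrib]
  refine Finset.sum_le_sum fun y _ => ?_
  have := h0 x y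
  split_ifs with h h' <;> linarith

/-- The correlations summed against von Mangoldt weights. -/
lemma sum_sum_gvm_corr_le {S : Set ℂ} (hS : Convex ℝ S) {Q : ℝ} (hQ : 1 ≤ Q) {α : ℂ}
    (hα : WellSep Q α) {N U V : ℝ} (hU : 1 ≤ U) (hV : 1 ≤ V) (hQN : Q ^ 2 ≤ N) :
    ∑ e₁ ∈ gball N with V < gnorm e₁, ∑ e₂ ∈ gball N with V < gnorm e₂,
        |gvm e₁| * |gvm e₂| * ‖corr S α N U e₁ e₂‖ ≤
      2600000000000 * Real.log N ^ 2 * N ^ 2 * (1 / Q + 2 / √V + 1 / √U) := by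
  have hN1 : 1 ≤ N := by nlinarith
  have hlog := Real.log_nonneg hN1
  set W := 1 / Q + 2 / √V + 1 / √U with hW
  have hW0 : 0 ≤ W := by positivity
  set E := (gball N).filter fun e => V < gnorm e with hE
  have hin : ∀ e₁ ∈ E, ∑ e₂ ∈ E with gnorm e₂ ≤ gnorm e₁,
      |gvm e₁| * |gvm e₂| * ‖corr S α N U e₁ e₂‖ ≤
      (48 * 288 * 2304) * Real.log N * N ^ 2 * W * (gvm e₁ / gnorm e₁) := by
    intro e₁ he₁
    obtain ⟨he₁b, he₁V⟩ := Finset.mem_filter.1 he₁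
    have he0 := (mem_gball.1 he₁b).1
    have h1 := one_le_gnorm he0
    have hg := gvm_nonneg e₁
    rw [abs_of_nonneg hg]
    set X := N / gnorm e₁ with hX
    have hX0 : 0 < X := by positivity
    have h2 : ∀ e₂ ∈ E.filter fun e₂ => gnorm e₂ ≤ gnorm e₁,
        gvm e₁ * |gvm e₂| * ‖corr S α N U e₁ e₂‖ ≤ gvm e₁ * Real.log N *
          (if U ≤ X then 48 * X * majG X (toComplex (star (e₁ - e₂)) * α) else 0) := by
      intro e₂ he₂
      obtain ⟨he₂E, hle⟩ := Finset.mem_filter.1 he₂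
      have h3 := gvm_le_log_of_mem (Finset.mem_filter.1 he₂E).1
      rw [abs_of_nonneg (gvm_nonneg e₂)]
      gcongr
      exact norm_corr_le hS α hU he0 hle
    refine (Finset.sum_le_sum h2).trans ?_
    rw [← Finset.mul_sum]
    by_cases hUX : U ≤ X
    · simp only [hUX, if_true]
      have h4 : ∑ e₂ ∈ E with gnorm e₂ ≤ gnorm e₁, majG X (toComplex (star (e₁ - e₂)) * α) ≤
          288 * (1 + 4 * gnorm e₁ / Q) * (X + 576 * √X * Q) := by
        rw [← Finset.sum_image (f := fun h => majG X (toComplex (star h) * α))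
          (g := fun e₂ => e₁ - e₂) (fun x _ y _ h => sub_right_injective h)]
        refine sum_majG_star_le hQ hα hX0 (by positivity) _ fun h hh => ?_
        obtain ⟨e₂, he₂, rfl⟩ := Finset.mem_image.1 hh
        exact gnorm_sub_le (Finset.mem_filter.1 he₂).2
      have h5 := bilinear_weight_le hV hU he₁V.le (hX ▸ hUX) hQ hQN
      rw [← hX] at h5
      rw [← Finset.mul_sum]
      calc _ ≤ gvm e₁ * Real.log N * (48 * X *
            (288 * (1 + 4 * gnorm e₁ / Q) * (X + 576 * √X * Q))) := by gcongr
        _ = gvm e₁ * Real.log N * (48 * 288 *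
            (X * ((1 + 4 * gnorm e₁ / Q) * (X + 576 * √X * Q)))) := by ring
        _ ≤ gvm e₁ * Real.log N * (48 * 288 * (2304 * W * (N ^ 2 / gnorm e₁))) := by gcongr
        _ = _ := by ring
    · simp only [hUX, if_false, Finset.sum_const_zero, mul_zero]
      positivity
  have hmert : ∑ e ∈ E, gvm e / gnorm e ≤ 40000 * Real.log N :=
    (Finset.sum_le_sum_of_subset_of_nonneg (Finset.filter_subset _ _) fun e _ _ =>
      div_nonneg (gvm_nonneg e) (by positivity)).trans (sum_gvm_div_le hN1)
  calc _ ≤ 2 * ∑ e₁ ∈ E, ∑ e₂ ∈ E with gnorm e₂ ≤ gnorm e₁,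
        |gvm e₁| * |gvm e₂| * ‖corr S α N U e₁ e₂‖ :=
        sum_sum_le_two_mul_of_symm E gnorm _
          (fun x y => by rw [norm_corr_comm, mul_comm |gvm x|]) fun x y => by positivity
    _ ≤ 2 * ∑ e₁ ∈ E, (48 * 288 * 2304) * Real.log N * N ^ 2 * W * (gvm e₁ / gnorm e₁) := by
        gcongr with e₁ he₁
        exact hin e₁ he₁
    _ ≤ 2 * ((48 * 288 * 2304) * Real.log N * N ^ 2 * W * (40000 * Real.log N)) := by
        rw [← Finset.mul_sum]
        gcongr
    _ ≤ _ := by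
        have : 0 ≤ Real.log N ^ 2 * N ^ 2 * W := by positivity
        nlinarith

lemma norm_sum_typeII_le {S : Set ℂ} (hS : Convex ℝ S) {Q : ℝ} (hQ : 1 ≤ Q) {α : ℂ}
    (hα : WellSep Q α) {N U : ℝ} (hN : 3 ≤ N) (hU : 1 ≤ U) (hQN : Q ^ 2 ≤ N) :
    ‖∑ e ∈ gball N with U < gnorm e, (gvm e : ℂ) *
        ∑ m ∈ gball N with U < gnorm m, (amob U m : ℂ) * chiN S α N e m‖ ≤
      10000000000 * (N * Real.log N ^ 2 * √(1 / Q + 3 / √U)) := by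
  have hW0 : 0 ≤ 1 / Q + 3 / √U := by positivity
  have h1 := norm_bilinear_sq_le ((gball N).filter fun e => U < gnorm e)
    ((gball N).filter fun e => U < gnorm e)
    (fun m hm => (mem_gball.1 (Finset.mem_filter.1 hm).1).1) gvm (amob U) (chiN S α N)
  have h2 := sum_sum_gvm_corr_le hS hQ hα hU hU hQN
  have h3 : ∑ m ∈ gball N with U < gnorm m, amob U m ^ 2 / gnorm m ≤
      5000000 * Real.log N ^ 2 :=
    (Finset.sum_le_sum_of_subset_of_nonneg (Finset.filter_subset _ _) fun e _ _ =>
      by positivity).trans (sum_amob_sq_div_le hN U)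
  refine abs_le_of_sq_le_sq' ?_ (by positivity) |>.2
  refine h1.trans ((mul_le_mul h3 h2 (by positivity) (by positivity)).trans ?_)
  rw [mul_pow, mul_pow, Real.sq_sqrt hW0]
  have : 0 ≤ Real.log N ^ 4 * N ^ 2 * (1 / Q + 3 / √U) := by positivity
  calc _ = 13000000000000000000 * (Real.log N ^ 4 * N ^ 2 * (1 / Q + 3 / √U)) := by ring
    _ ≤ 100000000000000000000 * (Real.log N ^ 4 * N ^ 2 * (1 / Q + 3 / √U)) := by gcongr; norm_num
    _ = _ := by ring

/-! ### The Vaughan identity -/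

lemma gvm_mul_unit (n : GaussianInt) {u : GaussianInt} (hu : IsUnit u) :
    gvm (n * u) = gvm n := by
  by_cases h : ∃ ρ : GaussianInt, Irreducible ρ ∧
      ∃ k : ℕ, 1 ≤ k ∧ ∃ u : GaussianInt, IsUnit u ∧ n = u * ρ ^ k
  · obtain ⟨ρ, hρ, k, hk, v, hv, h⟩ := h
    rw [gvm_eq hρ hk hv h, gvm_eq hρ hk (hv.mul hu) (by rw [h]; ring)]
  · rw [gvm_eq_zero h, gvm_eq_zero]
    rintro ⟨ρ, hρ, k, hk, v, hv, h'⟩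
    obtain ⟨w, hw⟩ := hu.exists_right_inv
    refine h ⟨ρ, hρ, k, hk, v * w, hv.mul (IsUnit.of_mul_eq_one u (by rw [mul_comm, hw])), ?_⟩
    calc n = n * u * w := by rw [mul_assoc, hw, mul_one]
      _ = _ := by rw [h']; ring

lemma sum_gball_mul_unit {M : Type*} [AddCommMonoid M] (x : ℝ) {u : GaussianInt} (hu : IsUnit u)
    (p : ℕ → Prop) (g : GaussianInt → M) :
    ∑ n ∈ gball x with p (gnorm n), g (n * u) = ∑ n ∈ gball x with p (gnorm n), g n := by
  obtain ⟨w, hw⟩ := hu.exists_right_inv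
  have hw' : IsUnit w := IsUnit.of_mul_eq_one u (by rw [mul_comm, hw])
  have hmem : ∀ v, IsUnit v → ∀ n ∈ (gball x).filter fun n => p (gnorm n),
      n * v ∈ (gball x).filter fun n => p (gnorm n) := by
    intro v hv n hn
    rw [Finset.mem_filter, mem_gball] at *
    rw [gnorm_mul, gnorm_eq_one.2 hv, mul_one]
    exact ⟨⟨mul_ne_zero hn.1.1 hv.ne_zero, hn.1.2⟩, hn.2⟩
  refine Finset.sum_bij' (fun n _ => n * u) (fun n _ => n * w) (hmem u hu) (hmem w hw') ?_ ?_ ?_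
  · intro n _; simp only [mul_assoc, hw, mul_one]
  · intro n _; simp only [mul_assoc, mul_comm w u, hw, mul_one]
  · intros; rfl

/-- The inner sum `∑_m a_U(m) χ(em)` of the Vaughan identity. -/
def vaughanInner (χ : GaussianInt → ℂ) (N U : ℝ) (e : GaussianInt) : ℂ :=
  ∑ m ∈ gball (N / gnorm e), (amob U m : ℂ) * χ (e * m)

lemma vaughanInner_eq (χ : GaussianInt → ℂ) (N U : ℝ) (e : GaussianInt) :
    vaughanInner χ N U e = ∑ d ∈ gball U, (gmob d : ℂ) *
      ∑ f ∈ gball (N / gnorm e / gnorm d), χ (e * (d * f)) := by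
  have h : ∀ m, (amob U m : ℂ) * χ (e * m) =
      ∑ d ∈ gball U, if d ∣ m then (gmob d : ℂ) * χ (e * m) else 0 := by
    intro m
    rw [amob, Complex.ofReal_sum, Finset.sum_mul, Finset.sum_filter]
  simp only [vaughanInner, h]
  rw [Finset.sum_comm]
  refine Finset.sum_congr rfl fun d hd => ?_
  rw [← Finset.sum_filter, sum_gball_filter_dvd _ (mem_gball.1 hd).1, Finset.mul_sum]

lemma sum_gmob_log_eq (χ : GaussianInt → ℂ) {N : ℝ} (hN : 0 ≤ N) (U : ℝ) :
    ∑ d ∈ gball U, (gmob d : ℂ) * ∑ m ∈ gball (N / gnorm d),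
      ((unitCount * Real.log (gnorm m) : ℝ) : ℂ) * χ (d * m) =
    ∑ e ∈ gball N, (gvm e : ℂ) * vaughanInner χ N U e := by
  simp only [vaughanInner_eq, Finset.mul_sum]
  rw [Finset.sum_comm (s := gball N)]
  refine Finset.sum_congr rfl fun d hd => ?_
  have hd1 := one_le_gnorm (mem_gball.1 hd).1
  have h1 : ∀ m ∈ gball (N / gnorm d),
      (gmob d : ℂ) * (((unitCount * Real.log (gnorm m) : ℝ) : ℂ) * χ (d * m)) =
      ∑ e ∈ gdivs m, (gvm e : ℂ) * ((gmob d : ℂ) * χ (d * m)) := by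
    intro m hm
    rw [← sum_gvm (mem_gball.1 hm).1, ← Finset.sum_mul, Complex.ofReal_sum]
    ring
  rw [Finset.sum_congr rfl h1,
    sum_gball_gdivs _ fun e m => (gvm e : ℂ) * ((gmob d : ℂ) * χ (d * m))]
  have h2 : gball (N / gnorm d) ⊆ gball N := gball_mono (div_le_self hN hd1)
  refine (Finset.sum_subset_zero_on_sdiff h2 ?_ ?_)
  · intro e he
    rw [Finset.mem_sdiff, mem_gball, mem_gball] at he
    have he1 := one_le_gnorm he.1.1
    rw [gball_eq_empty, Finset.sum_empty]
    have h3 : N / gnorm d < gnorm e := by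
      by_contra! h; exact he.2 ⟨he.1.1, h⟩
    rw [div_lt_iff₀ (by linarith)] at h3 ⊢
    rw [div_lt_iff₀ (by linarith)]
    linarith
  · intro e _
    rw [div_right_comm]
    refine Finset.sum_congr rfl fun f _ => ?_
    rw [mul_left_comm d]

lemma amob_of_le {U : ℝ} {m : GaussianInt} (hm : m ≠ 0) (h : (gnorm m : ℝ) ≤ U) :
    amob U m = if IsUnit m then unitCount else 0 := by
  rw [← sum_gmob hm, amob]
  refine Finset.sum_congr ?_ fun _ _ => rfl
  ext d
  rw [Finset.mem_filter, mem_gdivs hm, mem_gball]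
  refine ⟨fun h => h.2, fun hd => ⟨⟨ne_zero_of_dvd_ne_zero hm hd, le_trans ?_ h⟩, hd⟩⟩
  exact_mod_cast gnorm_le_of_dvd hm hd

lemma vaughanInner_split (S : Set ℂ) (α : ℂ) {N U : ℝ} (hU : 1 ≤ U)
    {e : GaussianInt} (he : e ∈ gball N) :
    vaughanInner (chiS S α) N U e = unitCount * ∑ u ∈ gball 1, chiS S α (e * u) +
      ∑ m ∈ gball N with U < gnorm m, (amob U m : ℂ) * chiN S α N e m := by
  obtain ⟨he0, heN⟩ := mem_gball.1 he
  have h1 := one_le_gnorm he0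
  have h0 : (0 : ℝ) < gnorm e := by linarith
  rw [vaughanInner, ← Finset.sum_filter_not_add_sum_filter _ fun m => U < gnorm m]
  congr 1
  · rw [Finset.mul_sum]
    symm
    refine Finset.sum_subset_zero_on_sdiff ?_ ?_ ?_
    · intro u hu
      have hu' := mem_gball.1 hu
      rw [Finset.mem_filter, mem_gball]
      have : (1 : ℝ) ≤ N / gnorm e := by rwa [one_le_div h0]
      exact ⟨⟨hu'.1, hu'.2.trans this⟩, by linarith [hu'.2]⟩
    · intro m hm
      rw [Finset.mem_sdiff, Finset.mem_filter, mem_gball, mem_gball_one, not_lt] at hm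
      rw [amob_of_le hm.1.1.1 hm.1.2, if_neg hm.2]
      simp
    · intro u hu
      have hu' := mem_gball.1 hu
      rw [amob_of_le hu'.1 (by linarith [hu'.2]), if_pos (mem_gball_one.1 hu)]
  · rw [Finset.sum_filter, Finset.sum_filter]
    refine Finset.sum_subset_zero_on_sdiff ?_ ?_ ?_
    · exact gball_mono (div_le_self (by linarith) h1)
    · intro m hm
      rw [Finset.mem_sdiff, mem_gball, mem_gball] at hm
      have h3 : ¬ (gnorm e : ℝ) * gnorm m ≤ N := fun h3 =>
        hm.2 ⟨hm.1.1, (le_div_iff₀' h0).2 h3⟩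
      simp [chiN, h3]
    · intro m hm
      have h3 : (gnorm e : ℝ) * gnorm m ≤ N := (le_div_iff₀' h0).1 (mem_gball.1 hm).2
      rw [chiN, if_pos h3]

/-- The Vaughan identity for `∑ Λ(n) χ(n)`. -/
lemma vaughan_identity (S : Set ℂ) (α : ℂ) {N U : ℝ} (hU : 1 ≤ U) (hUN : U ≤ N) :
    (unitCount ^ 2 : ℂ) * ∑ n ∈ gball N, (gvm n : ℂ) * chiS S α n =
      (unitCount ^ 2 : ℂ) * ∑ n ∈ gball U, (gvm n : ℂ) * chiS S α n +
      ∑ d ∈ gball U, (gmob d : ℂ) * ∑ m ∈ gball (N / gnorm d),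
        ((unitCount * Real.log (gnorm m) : ℝ) : ℂ) * chiS S α (d * m) -
      ∑ e ∈ gball U, (gvm e : ℂ) * vaughanInner (chiS S α) N U e -
      ∑ e ∈ gball N with U < gnorm e, (gvm e : ℂ) *
        ∑ m ∈ gball N with U < gnorm m, (amob U m : ℂ) * chiN S α N e m := by
  have hfil : (gball N).filter (fun e => ¬ U < gnorm e) = gball U := by
    ext e
    rw [Finset.mem_filter, mem_gball, mem_gball, not_lt]
    exact ⟨fun h => ⟨h.1.1, h.2⟩, fun h => ⟨⟨h.1, h.2.trans hUN⟩, h.2⟩⟩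
  have hmain : ∑ e ∈ gball N with U < gnorm e,
      (gvm e : ℂ) * (unitCount * ∑ u ∈ gball 1, chiS S α (e * u)) =
      (unitCount ^ 2 : ℂ) * ∑ e ∈ gball N with U < gnorm e, (gvm e : ℂ) * chiS S α e := by
    have h1 : ∀ u ∈ gball 1, ∑ e ∈ gball N with U < gnorm e,
        (gvm e : ℂ) * (unitCount * chiS S α (e * u)) =
        unitCount * ∑ e ∈ gball N with U < gnorm e, (gvm e : ℂ) * chiS S α e := by
      intro u hu
      have hu' := mem_gball_one.1 hu
      rw [← sum_gball_mul_unit N hu' (fun n => U < n) fun n => (gvm n : ℂ) * chiS S α n,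
        Finset.mul_sum]
      refine Finset.sum_congr rfl fun e _ => ?_
      rw [gvm_mul_unit e hu']
      ring
    simp only [Finset.mul_sum] at h1 ⊢
    rw [Finset.sum_comm, Finset.sum_congr rfl h1, Finset.sum_const, nsmul_eq_mul, ← Finset.mul_sum,
      ← Finset.mul_sum, unitCount]
    push_cast
    ring
  rw [sum_gmob_log_eq _ (by linarith),
    ← Finset.sum_filter_not_add_sum_filter (gball N) (fun e => U < gnorm e)
      (fun e => (gvm e : ℂ) * vaughanInner (chiS S α) N U e),
    ← Finset.sum_filter_not_add_sum_filter (gball N) (fun e => U < gnorm e)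
      (fun e => (gvm e : ℂ) * chiS S α e), hfil, mul_add, ← hmain]
  have hsplit : ∑ e ∈ gball N with U < gnorm e, (gvm e : ℂ) * vaughanInner (chiS S α) N U e =
      ∑ e ∈ gball N with U < gnorm e,
        (gvm e : ℂ) * (unitCount * ∑ u ∈ gball 1, chiS S α (e * u)) +
      ∑ e ∈ gball N with U < gnorm e, (gvm e : ℂ) *
        ∑ m ∈ gball N with U < gnorm m, (amob U m : ℂ) * chiN S α N e m := by
    rw [← Finset.sum_add_distrib]
    refine Finset.sum_congr rfl fun e he => ?_
    rw [vaughanInner_split S α hU (Finset.mem_filter.1 he).1, mul_add]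
  rw [hsplit]
  ring

/-- The bound coming from `norm_sum_typeI_le`. -/
def typeIBound (N Q D : ℝ) : ℝ :=
  24 * D * √(Q * N) + 1000000 * (N / Q + √(N * D)) * (1 + Real.log N)

lemma norm_sum_gmob_log_le {S : Set ℂ} (hS : Convex ℝ S) {Q : ℝ} (hQ : 1 ≤ Q) {α : ℂ}
    (hα : WellSep Q α) {N U : ℝ} (hU : 1 ≤ U) (hUN : U ≤ N) :
    ‖∑ d ∈ gball U, (gmob d : ℂ) * ∑ m ∈ gball (N / gnorm d),
        ((unitCount * Real.log (gnorm m) : ℝ) : ℂ) * chiS S α (d * m)‖ ≤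
      192 * Real.log N * typeIBound N Q U := by
  have hlog := Real.log_nonneg (hU.trans hUN)
  refine norm_sum_typeI_le hQ hα hU hUN (by positivity) _ fun d hd => ?_
  obtain ⟨hd0, hdU⟩ := mem_gball.1 hd
  have hd1 := one_le_gnorm hd0
  have hX : 1 ≤ N / gnorm d := by rw [one_le_div (by linarith)]; linarith
  have hG := majG_nonneg (by linarith : 0 ≤ N / gnorm d) (toComplex (star d) * α)
  have h1 : ∑ m ∈ gball (N / gnorm d),
      ((unitCount * Real.log (gnorm m) : ℝ) : ℂ) * chiS S α (d * m) =
      unitCount * ∑ m ∈ gball (N / gnorm d), (Real.log (gnorm m) : ℂ) * chiS S α (d * m) := by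
    rw [Finset.mul_sum]
    refine Finset.sum_congr rfl fun m _ => ?_
    push_cast
    ring
  rw [h1, norm_mul, norm_mul, Complex.norm_real, Complex.norm_real, Real.norm_eq_abs,
    Real.norm_eq_abs, abs_of_pos unitCount_pos]
  have h2 : Real.log (N / gnorm d) ≤ Real.log N :=
    Real.log_le_log (by linarith) (div_le_self (by linarith) hd1)
  calc _ ≤ 1 * (8 * (24 * Real.log (N / gnorm d) *
        majG (N / gnorm d) (toComplex (star d) * α))) := by
        have h3 := abs_gmob_le d
        have h4 := unitCount_le
        have := unitCount_pos
        have h5 := norm_sum_log_chiS_mul_le hS α hX d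
        gcongr
    _ ≤ 1 * (8 * (24 * Real.log N * majG (N / gnorm d) (toComplex (star d) * α))) := by gcongr
    _ = _ := by ring

lemma norm_sum_gvm_vaughanInner_le {S : Set ℂ} (hS : Convex ℝ S) {Q : ℝ} (hQ : 1 ≤ Q) {α : ℂ}
    (hα : WellSep Q α) {N U : ℝ} (hU : 1 ≤ U) (hUN : U ^ 2 ≤ N) :
    ‖∑ e ∈ gball U, (gvm e : ℂ) * vaughanInner (chiS S α) N U e‖ ≤
      96 * Real.log N * typeIBound N Q (U ^ 2) := by
  have hU2 : U ≤ U ^ 2 := by nlinarith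
  have hlog := Real.log_nonneg ((hU.trans hU2).trans hUN)
  obtain ⟨H, hH⟩ : ∃ H : GaussianInt → GaussianInt → ℂ, H = fun e k =>
      if (gnorm e : ℝ) ≤ U ∧ (gnorm k : ℝ) ≤ U * gnorm e then
        (gvm e : ℂ) * ((gmob (k / e) : ℂ) * ∑ f ∈ gball (N / gnorm k), chiS S α (k * f))
      else 0 := ⟨_, rfl⟩
  have h1 : ∑ e ∈ gball U, (gvm e : ℂ) * vaughanInner (chiS S α) N U e =
      ∑ k ∈ gball (U ^ 2), ∑ e ∈ gdivs k, H e k := by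
    rw [sum_gball_gdivs]
    refine Finset.sum_subset_zero_on_sdiff (gball_mono hU2) ?_ ?_
    · intro e he
      rw [Finset.mem_sdiff, mem_gball, mem_gball] at he
      have h2 : ¬ (gnorm e : ℝ) ≤ U := fun h => he.2 ⟨he.1.1, h⟩
      simp [hH, h2]
    · intro e he
      obtain ⟨he0, heU⟩ := mem_gball.1 he
      have he1 := one_le_gnorm he0
      have hpos : (0 : ℝ) < gnorm e := by linarith
      rw [vaughanInner_eq, Finset.mul_sum]
      refine Finset.sum_subset_zero_on_sdiff (gball_mono ?_) ?_ ?_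
      · rw [le_div_iff₀ hpos]; nlinarith
      · intro d hd
        rw [Finset.mem_sdiff, mem_gball, mem_gball] at hd
        have h2 : ¬ (gnorm (e * d) : ℝ) ≤ U * gnorm e := fun h => hd.2 ⟨hd.1.1, by
          rw [gnorm_mul] at h; push_cast at h; nlinarith⟩
        simp only [hH, h2, and_false, if_false]
      · intro d hd
        obtain ⟨hd0, hdU⟩ := mem_gball.1 hd
        have h2 : (gnorm (e * d) : ℝ) ≤ U * gnorm e := by
          rw [gnorm_mul]; push_cast; nlinarith
        simp only [hH, heU, h2, and_self, if_true]
        rw [mul_div_cancel_left₀ _ he0, gnorm_mul]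
        push_cast
        rw [div_div]
        simp only [mul_assoc]
  rw [h1]
  refine norm_sum_typeI_le hQ hα (hU.trans hU2) hUN (by positivity) _ fun k hk => ?_
  obtain ⟨hk0, hkU⟩ := mem_gball.1 hk
  have hk1 := one_le_gnorm hk0
  have hX : 1 ≤ N / gnorm k := by rw [one_le_div (by linarith)]; linarith
  have hG := majG_nonneg (by linarith : 0 ≤ N / gnorm k) (toComplex (star k) * α)
  have h2 := norm_sum_chiS_mul_le hS α hX k
  calc _ ≤ ∑ e ∈ gdivs k, gvm e * (12 * majG (N / gnorm k) (toComplex (star k) * α)) := by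
        refine norm_sum_le_of_le _ fun e _ => ?_
        have h3 := gvm_nonneg e
        simp only [hH]
        split_ifs with h
        · rw [norm_mul, norm_mul, Complex.norm_real, Complex.norm_real, Real.norm_eq_abs,
            Real.norm_eq_abs, abs_of_nonneg h3]
          have h4 := abs_gmob_le (k / e)
          calc _ ≤ gvm e * (1 * (12 * majG (N / gnorm k) (toComplex (star k) * α))) := by gcongr
            _ = _ := by ring
        · rw [norm_zero]; positivity
    _ = unitCount * Real.log (gnorm k) * (12 * majG (N / gnorm k) (toComplex (star k) * α)) := by
        rw [← Finset.sum_mul, sum_gvm hk0]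
    _ ≤ 8 * Real.log N * (12 * majG (N / gnorm k) (toComplex (star k) * α)) := by
        have h5 := unitCount_le
        have h6 : Real.log (gnorm k) ≤ Real.log N :=
          Real.log_le_log (by linarith) (hkU.trans hUN)
        have h7 := Real.log_nonneg hk1
        gcongr
    _ = _ := by ring

lemma norm_chiS_le (S : Set ℂ) (α : ℂ) (n : GaussianInt) : ‖chiS S α n‖ ≤ 1 := by
  rw [chiS]
  split_ifs
  · rw [norm_e2]
  · simp

lemma norm_sum_gvm_chiS_trivial (S : Set ℂ) (α : ℂ) {U : ℝ} (hU : 1 ≤ U) :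
    ‖∑ n ∈ gball U, (gvm n : ℂ) * chiS S α n‖ ≤ 8 * U * Real.log U := by
  have hlog := Real.log_nonneg hU
  calc _ ≤ ∑ n ∈ gball U, Real.log U := by
        refine norm_sum_le_of_le _ fun n hn => ?_
        rw [norm_mul, Complex.norm_real, Real.norm_eq_abs, abs_of_nonneg (gvm_nonneg n)]
        exact (mul_le_of_le_one_right (gvm_nonneg n) (norm_chiS_le S α n)).trans
          (gvm_le_log_of_mem hn)
    _ ≤ _ := by
        rw [Finset.sum_const, nsmul_eq_mul]
        gcongr
        exact card_gball_le (by linarith)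

lemma norm_le_of_mul_eq {w A B L J T : ℂ} (hw : 1 ≤ ‖w‖) (h : w * A = w * B + L - J - T) :
    ‖A‖ ≤ ‖B‖ + ‖L‖ + ‖J‖ + ‖T‖ := by
  have h1 : ‖A - B‖ ≤ ‖w * (A - B)‖ := by
    rw [norm_mul]
    exact le_mul_of_one_le_left (_root_.norm_nonneg _) hw
  have h2 : w * (A - B) = L - J - T := by rw [mul_sub, h]; ring
  rw [h2] at h1
  have h3 := norm_sub_le (L - J) T
  have h4 := norm_sub_le L J
  have h5 := norm_le_insert' A B
  linarith

lemma norm_sum_gvm_chiS_le {S : Set ℂ} (hS : Convex ℝ S) {Q : ℝ} (hQ : 1 ≤ Q) {α : ℂ}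
    (hα : WellSep Q α) {N U : ℝ} (hN : 3 ≤ N) (hU : 1 ≤ U) (hUN : U ^ 2 ≤ N) (hQN : Q ^ 2 ≤ N) :
    ‖∑ n ∈ gball N, (gvm n : ℂ) * chiS S α n‖ ≤
      8 * U * Real.log N + 288 * Real.log N * typeIBound N Q (U ^ 2) +
        10000000000 * (N * Real.log N ^ 2 * √(1 / Q + 3 / √U)) := by
  have hU2 : U ≤ U ^ 2 := by nlinarith
  have hlog : 0 ≤ Real.log N := Real.log_nonneg (by linarith)
  have hid := vaughan_identity S α hU (hU2.trans hUN)
  have hw : 1 ≤ ‖(unitCount ^ 2 : ℂ)‖ := by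
    rw [norm_pow, Complex.norm_real, Real.norm_eq_abs, abs_of_pos unitCount_pos]
    exact one_le_pow₀ one_le_unitCount
  have h1 := norm_sum_gmob_log_le hS hQ hα hU (hU2.trans hUN)
  have h2 := norm_sum_gvm_vaughanInner_le hS hQ hα hU hUN
  have h3 := norm_sum_typeII_le hS hQ hα hN hU hQN
  have h4 := norm_sum_gvm_chiS_trivial S α hU
  have h5 : 8 * U * Real.log U ≤ 8 * U * Real.log N := by
    gcongr
    linarith
  have h6 : 192 * Real.log N * typeIBound N Q U ≤ 192 * Real.log N * typeIBound N Q (U ^ 2) := by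
    unfold typeIBound
    gcongr
  have h7 := norm_le_of_mul_eq hw hid
  linarith

/-! ### Choice of parameters -/

lemma norm_sum_gvm_chiS_le_main {S : Set ℂ} (hS : Convex ℝ S) {Q : ℝ} (hQ : 1 ≤ Q) {α : ℂ}
    (hα : WellSep Q α) {N : ℝ} (hN : 3 ≤ N) (hQN : Q ≤ √N) :
    ‖∑ n ∈ gball N, (gvm n : ℂ) * chiS S α n‖ ≤
      10000000000000000 * (N * Real.log N ^ 2 / Q ^ ((1 : ℝ) / 2) + N ^ ((99 : ℝ) / 100)) := by
  have hN0 : 0 < N := by linarith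
  have hN1 : 1 ≤ N := by linarith
  have hlog1 : 1 ≤ Real.log N := by
    rw [Real.le_log_iff_exp_le hN0]
    linarith [Real.exp_one_lt_d9]
  have hlog0 : 0 ≤ Real.log N := by linarith
  have hQ2 : Q ^ 2 ≤ N := by
    calc Q ^ 2 ≤ √N ^ 2 := by gcongr
      _ = N := Real.sq_sqrt hN0.le
  have hU : 1 ≤ N ^ ((1 : ℝ) / 10) := Real.one_le_rpow hN1 (by norm_num)
  have hUU : (N ^ ((1 : ℝ) / 10)) ^ 2 = N ^ ((1 : ℝ) / 5) := by
    rw [← Real.rpow_natCast, ← Real.rpow_mul hN0.le]; norm_num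
  have hpow : ∀ {r s : ℝ}, r ≤ s → N ^ r ≤ N ^ s := fun h =>
    Real.rpow_le_rpow_of_exponent_le hN1 h
  have hadd : ∀ r s : ℝ, N ^ r * N ^ s = N ^ (r + s) := fun r s => (Real.rpow_add hN0 r s).symm
  have hUN : (N ^ ((1 : ℝ) / 10)) ^ 2 ≤ N := by
    rw [hUU]
    conv_rhs => rw [← Real.rpow_one N]
    exact hpow (by norm_num)
  have hmain := norm_sum_gvm_chiS_le hS hQ hα hN hU hUN hQ2
  rw [hUU, typeIBound] at hmain
  set L := Real.log N with hL
  set P := N ^ ((99 : ℝ) / 100) with hP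
  set M := N * L ^ 2 / Q ^ ((1 : ℝ) / 2) with hM
  have hP0 : 0 ≤ P := by positivity
  have hM0 : 0 ≤ M := by positivity
  have hLle : L ≤ 200 * N ^ ((1 : ℝ) / 200) := by
    have := Real.log_le_rpow_div hN0.le (ε := 1 / 200) (by norm_num)
    linarith
  have hL2 : L ^ 2 ≤ 40000 * N ^ ((1 : ℝ) / 100) := by
    calc L ^ 2 ≤ (200 * N ^ ((1 : ℝ) / 200)) ^ 2 := by gcongr
      _ = 40000 * (N ^ ((1 : ℝ) / 200) * N ^ ((1 : ℝ) / 200)) := by ring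
      _ = _ := by rw [hadd]; norm_num
  have hQs : √Q ≤ Q := Real.sqrt_le_iff.2 ⟨by linarith, by nlinarith⟩
  have hQs0 : 0 < √Q := Real.sqrt_pos.2 (by linarith)
  have hMs : M = N * L ^ 2 / √Q := by rw [hM, Real.sqrt_eq_rpow]
  have t1 : N ^ ((1 : ℝ) / 10) * L ≤ 200 * P := by
    calc _ ≤ N ^ ((1 : ℝ) / 10) * (200 * N ^ ((1 : ℝ) / 200)) := by gcongr
      _ = 200 * N ^ ((1 : ℝ) / 10 + 1 / 200) := by rw [← hadd]; ring
      _ ≤ _ := by gcongr; exact hpow (by norm_num)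
  have hs1 : √(Q * N) ≤ N ^ ((3 : ℝ) / 4) := by
    calc √(Q * N) ≤ √(N ^ ((1 : ℝ) / 2) * N ^ (1 : ℝ)) := by
          rw [Real.rpow_one, ← Real.sqrt_eq_rpow]; gcongr
      _ = _ := by rw [hadd, Real.sqrt_eq_rpow, ← Real.rpow_mul hN0.le]; norm_num
  have t2 : L * (N ^ ((1 : ℝ) / 5) * √(Q * N)) ≤ 200 * P := by
    calc _ ≤ 200 * N ^ ((1 : ℝ) / 200) * (N ^ ((1 : ℝ) / 5) * N ^ ((3 : ℝ) / 4)) := by gcongr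
      _ = 200 * N ^ ((1 : ℝ) / 200 + (1 / 5 + 3 / 4)) := by rw [hadd, mul_assoc, hadd]
      _ ≤ _ := by gcongr; exact hpow (by norm_num)
  have t3 : L * (N / Q * (1 + L)) ≤ 2 * M := by
    calc _ ≤ L * (N / √Q * (L + L)) := by gcongr
      _ = 2 * M := by rw [hMs]; ring
  have hs2 : √(N * N ^ ((1 : ℝ) / 5)) = N ^ ((3 : ℝ) / 5) := by
    nth_rewrite 1 [← Real.rpow_one N]
    rw [hadd, Real.sqrt_eq_rpow, ← Real.rpow_mul hN0.le]; norm_num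
  have t4 : L * (√(N * N ^ ((1 : ℝ) / 5)) * (1 + L)) ≤ 80000 * P := by
    rw [hs2]
    calc _ ≤ L * (N ^ ((3 : ℝ) / 5) * (L + L)) := by gcongr
      _ = 2 * N ^ ((3 : ℝ) / 5) * L ^ 2 := by ring
      _ ≤ 2 * N ^ ((3 : ℝ) / 5) * (40000 * N ^ ((1 : ℝ) / 100)) := by gcongr
      _ = 80000 * N ^ ((3 : ℝ) / 5 + 1 / 100) := by rw [← hadd]; ring
      _ ≤ _ := by gcongr; exact hpow (by norm_num)
  have hs3 : √(1 / Q + 3 / √(N ^ ((1 : ℝ) / 10))) ≤ 1 / √Q + 2 * N ^ (-((1 : ℝ) / 40)) := by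
    have h1 : 3 / √(N ^ ((1 : ℝ) / 10)) ≤ (2 * N ^ (-((1 : ℝ) / 40))) ^ 2 := by
      have h2 : √(N ^ ((1 : ℝ) / 10)) = (N ^ ((1 : ℝ) / 20)) := by
        rw [Real.sqrt_eq_rpow, ← Real.rpow_mul hN0.le]; norm_num
      have h3 : (N ^ (-((1 : ℝ) / 40))) ^ 2 = (N ^ ((1 : ℝ) / 20))⁻¹ := by
        rw [← Real.rpow_natCast, ← Real.rpow_mul hN0.le, ← Real.rpow_neg hN0.le]; norm_num
      rw [h2, mul_pow, h3, div_eq_mul_inv]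
      gcongr
      norm_num
    have h4 : 1 / Q = (1 / √Q) ^ 2 := by rw [div_pow, Real.sq_sqrt (by linarith), one_pow]
    apply Real.sqrt_le_iff.2 ⟨by positivity, _⟩
    rw [h4]
    have h5 : 0 ≤ 1 / √Q * (2 * N ^ (-((1 : ℝ) / 40))) := by positivity
    linarith [add_sq (1 / √Q) (2 * N ^ (-((1 : ℝ) / 40)))]
  have t5 : N * L ^ 2 * √(1 / Q + 3 / √(N ^ ((1 : ℝ) / 10))) ≤ M + 80000 * P := by
    calc _ ≤ N * L ^ 2 * (1 / √Q + 2 * N ^ (-((1 : ℝ) / 40))) := by gcongr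
      _ = M + 2 * N ^ (1 : ℝ) * N ^ (-((1 : ℝ) / 40)) * L ^ 2 := by
          rw [hMs, Real.rpow_one]; ring
      _ ≤ M + 2 * N ^ (1 : ℝ) * N ^ (-((1 : ℝ) / 40)) * (40000 * N ^ ((1 : ℝ) / 100)) := by
          gcongr
      _ = M + 80000 * N ^ ((1 : ℝ) + -(1 / 40) + 1 / 100) := by
          rw [← hadd, ← hadd]; ring
      _ ≤ _ := by gcongr; exact hpow (by norm_num)
  refine hmain.trans ?_
  linarith

/-! ### Sectors -/

/-- The signed area form `Im (z e^{-ib})`. -/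
def rotIm (b : ℝ) (z : ℂ) : ℝ := z.im * Real.cos b - z.re * Real.sin b

lemma isLinearMap_rotIm (b : ℝ) : IsLinearMap ℝ (rotIm b) :=
  ⟨fun x y => by simp [rotIm]; ring, fun c x => by simp [rotIm]; ring⟩

/-- A convex sector. -/
def sector (b c : ℝ) : Set ℂ := {z | 0 ≤ rotIm b z} ∩ {z | rotIm c z < 0}

lemma convex_sector (b c : ℝ) : Convex ℝ (sector b c) :=
  (convex_halfSpace_ge (isLinearMap_rotIm b) 0).inter (convex_halfSpace_lt (isLinearMap_rotIm c) 0)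

lemma rotIm_eq {z : ℂ} {θ : ℝ} (h : (θ : Real.Angle) = Complex.arg z) (b : ℝ) :
    rotIm b z = ‖z‖ * Real.sin (θ - b) := by
  have h1 : Real.cos θ = Real.cos (Complex.arg z) := by
    rw [← Real.Angle.cos_coe, h, Real.Angle.cos_coe]
  have h2 : Real.sin θ = Real.sin (Complex.arg z) := by
    rw [← Real.Angle.sin_coe, h, Real.Angle.sin_coe]
  rw [Real.sin_sub, h1, h2, rotIm]
  nth_rewrite 1 [← Complex.norm_mul_sin_arg z]
  nth_rewrite 1 [← Complex.norm_mul_cos_arg z]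
  ring

lemma mem_sector_iff {z : ℂ} (hz : z ≠ 0) {θ : ℝ} (h : (θ : Real.Angle) = Complex.arg z)
    (b c : ℝ) : z ∈ sector b c ↔ 0 ≤ Real.sin (θ - b) ∧ Real.sin (θ - c) < 0 := by
  have hz' : 0 < ‖z‖ := norm_pos_iff.2 hz
  rw [sector, Set.mem_inter_iff, Set.mem_ofPred_eq, Set.mem_ofPred_eq, rotIm_eq h, rotIm_eq h,
    mul_nonneg_iff_of_pos_left hz', ← neg_pos, ← mul_neg, mul_pos_iff_of_pos_left hz', neg_pos]

lemma sin_neg_of_pi_lt {x : ℝ} (h1 : π < x) (h2 : x < 2 * π) : Real.sin x < 0 := by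
  rw [← Real.sin_sub_two_pi]
  exact Real.sin_neg_of_neg_of_neg_pi_lt (by linarith) (by linarith)

lemma sin_sector_left_iff {φ t : ℝ} (h0 : 0 ≤ φ) (h1 : φ < 2 * π) (ht0 : 0 < t) (ht : t < π) :
    0 ≤ Real.sin φ ∧ Real.sin (φ - t) < 0 ↔ φ < t := by
  constructor
  · rintro ⟨h2, h3⟩
    by_contra! h4
    have h5 : φ ≤ π := by
      by_contra! h; exact absurd h2 (not_le.2 (sin_neg_of_pi_lt h h1))
    exact absurd h3 (not_lt.2 (Real.sin_nonneg_of_nonneg_of_le_pi (by linarith) (by linarith)))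
  · intro h
    exact ⟨Real.sin_nonneg_of_nonneg_of_le_pi h0 (by linarith),
      Real.sin_neg_of_neg_of_neg_pi_lt (by linarith) (by linarith)⟩

lemma sin_sector_right_iff {φ t : ℝ} (h0 : 0 ≤ φ) (h1 : φ < 2 * π) (ht0 : 0 < t) (ht : t < π) :
    0 ≤ Real.sin (φ - t) ∧ Real.sin (φ - 2 * t) < 0 ↔ t ≤ φ ∧ φ < 2 * t := by
  constructor
  · rintro ⟨h2, h3⟩
    have h4 : t ≤ φ := by
      by_contra! h
      exact absurd h2 (not_le.2 (Real.sin_neg_of_neg_of_neg_pi_lt (by linarith) (by linarith)))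
    refine ⟨h4, ?_⟩
    by_contra! h5
    have h6 : φ - t ≤ π := by
      by_contra! h; exact absurd h2 (not_le.2 (sin_neg_of_pi_lt h (by linarith)))
    exact absurd h3 (not_lt.2 (Real.sin_nonneg_of_nonneg_of_le_pi (by linarith) (by linarith)))
  · rintro ⟨h2, h3⟩
    exact ⟨Real.sin_nonneg_of_nonneg_of_le_pi (by linarith) (by linarith),
      Real.sin_neg_of_neg_of_neg_pi_lt (by linarith) (by linarith)⟩

lemma argIn_arc_iff {z : ℂ} {a l θ : ℝ} (hθ : (θ : Real.Angle) = Complex.arg z)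
    (hθ0 : a ≤ θ) (hθ1 : θ < a + 2 * π) (hl : l ≤ 2 * π) :
    argIn z ((fun θ : ℝ => (θ : Real.Angle)) '' Set.Ico a (a + l)) ↔ θ < a + l := by
  rw [argIn, Set.mem_image]
  constructor
  · rintro ⟨x, ⟨hx0, hx1⟩, hx⟩
    rw [← hθ] at hx
    simp only [Real.Angle.angle_eq_iff_two_pi_dvd_sub] at hx
    obtain ⟨k, hk⟩ := hx
    have hπ := Real.pi_pos
    have h1 : k = 0 := by
      have h2 : (k : ℝ) < 1 := by by_contra! h; nlinarith
      have h3 : (-1 : ℝ) < k := by by_contra! h; nlinarith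
      have h2' : k < 1 := by exact_mod_cast h2
      have h3' : -1 < k := by exact_mod_cast h3
      omega
    rw [h1] at hk
    simp at hk
    linarith
  · intro h
    exact ⟨θ, ⟨hθ0, h⟩, hθ⟩

/-- An arc is the disjoint union of two convex sectors. -/
lemma exists_convex_of_isArc {ω : Set Real.Angle} {l : ℝ} (hω : IsArc ω l) :
    ∃ S₁ S₂ : Set ℂ, Convex ℝ S₁ ∧ Convex ℝ S₂ ∧ ∀ z : ℂ, z ≠ 0 →
      (argIn z ω ↔ z ∈ S₁ ∨ z ∈ S₂) ∧ ¬ (z ∈ S₁ ∧ z ∈ S₂) := by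
  obtain ⟨a, rfl⟩ := hω
  have hθ : ∀ z : ℂ, ∃ θ : ℝ, (θ : Real.Angle) = Complex.arg z ∧ a ≤ θ ∧ θ < a + 2 * π := by
    intro z
    have h := toIcoMod_mem_Ico Real.two_pi_pos a (Complex.arg z)
    exact ⟨_, Real.Angle.coe_toIcoMod _ _, h.1, h.2⟩
  rcases le_or_gt l 0 with hl | hl
  · refine ⟨∅, ∅, convex_empty, convex_empty, fun z _ => ?_⟩
    simp [argIn, Set.Ico_eq_empty (not_lt.2 (by linarith : a + l ≤ a))]
  rcases le_or_gt (2 * π) l with hl2 | hl2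
  · refine ⟨Set.univ, ∅, convex_univ, convex_empty, fun z _ => ?_⟩
    obtain ⟨θ, h, h0, h1⟩ := hθ z
    simp only [Set.mem_univ, Set.mem_empty_iff_false, or_false, iff_true, and_false,
      not_false_eq_true, and_true]
    exact ⟨θ, ⟨h0, by linarith⟩, h⟩
  · refine ⟨sector a (a + l / 2), sector (a + l / 2) (a + l), convex_sector _ _,
      convex_sector _ _, fun z hz => ?_⟩
    obtain ⟨θ, h, h0, h1⟩ := hθ z
    rw [argIn_arc_iff h h0 h1 hl2.le, mem_sector_iff hz h, mem_sector_iff hz h]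
    have e1 : θ - (a + l / 2) = θ - a - l / 2 := by ring
    have e2 : θ - (a + l) = θ - a - 2 * (l / 2) := by ring
    rw [e1, e2, sin_sector_left_iff (by linarith) (by linarith) (by linarith) (by linarith),
      sin_sector_right_iff (by linarith) (by linarith) (by linarith) (by linarith)]
    constructor
    · constructor
      · intro h
        rcases lt_or_ge (θ - a) (l / 2) with h' | h'
        · exact Or.inl h'
        · exact Or.inr ⟨h', by linarith⟩
      · rintro (h | h) <;> linarith
    · rintro ⟨h2, h3, -⟩
      linarith

lemma tsum_gvm_eq_sum (N : ℕ) (α : ℂ) (ω : Set Real.Angle) :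
    ∑' n : {m : GaussianInt // Zsqrtd.norm m < (N : ℤ) ∧ argIn (toComplex m) ω},
        (gvm (n : GaussianInt) : ℂ) * e2 (cip (toComplex (n : GaussianInt)) α) =
      ∑ n ∈ gball N, (gvm n : ℂ) *
        if gnorm n < N ∧ argIn (toComplex n) ω then e2 (cip (toComplex n) α) else 0 := by
  have h := tsum_subtype {m : GaussianInt | Zsqrtd.norm m < (N : ℤ) ∧ argIn (toComplex m) ω}
    fun n => (gvm n : ℂ) * e2 (cip (toComplex n) α)
  refine h.trans ?_
  have hn : ∀ n : GaussianInt, Zsqrtd.norm n < (N : ℤ) ↔ gnorm n < N := fun n => by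
    rw [← gnorm_cast_int]; exact Nat.cast_lt
  rw [tsum_eq_sum (s := gball N)]
  · refine Finset.sum_congr rfl fun n _ => ?_
    rw [Set.indicator_apply]
    simp only [Set.mem_ofPred_eq, hn, mul_ite, mul_zero]
  · intro n hnN
    rw [Set.indicator_apply]
    split_ifs with h1
    · rw [Set.mem_ofPred_eq, hn] at h1
      rw [mem_gball] at hnN
      have : n = 0 := by
        by_contra h0
        exact hnN ⟨h0, by exact_mod_cast h1.1.le⟩
      rw [this, gvm_zero]
      simp
    · rfl

theorem vinogradov_inequality (ω : Set Real.Angle) (l : ℝ) (hω : IsArc ω l) :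
    ∃ C : ℝ, ∃ N₀ : ℕ, ∀ N : ℕ, N > N₀ → ∀ (α : ℂ) (a q : GaussianInt),
      0 < Zsqrtd.norm a → Zsqrtd.norm a < Zsqrtd.norm q →
      (Zsqrtd.norm q : ℝ) < Real.sqrt N →
      IsUnit (EuclideanDomain.gcd a q) →
      Complex.normSq (α - toComplex a / toComplex q) < 1 / (Zsqrtd.norm q : ℝ) ^ 2 →
      ‖∑' n : {m : GaussianInt // Zsqrtd.norm m < (N : ℤ) ∧ argIn (toComplex m) ω},
          (gvm (n : GaussianInt) : ℂ) * e2 (cip (toComplex (n : GaussianInt)) α)‖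
        ≤ C * ((N : ℝ) * (Real.log N) ^ 2 / (Zsqrtd.norm q : ℝ) ^ ((1 : ℝ)/2)
            + (N : ℝ) ^ ((99 : ℝ)/100)) := by
  obtain ⟨S₁, S₂, hS₁, hS₂, hS⟩ := exists_convex_of_isArc hω
  refine ⟨2 * 10000000000000000, 3, fun N hN α a q ha haq hqN hgcd happ => ?_⟩
  have hq : q ≠ 0 := by
    rintro rfl
    simp at haq
    linarith
  have hrel : IsRelPrime a q := fun d hda hdq =>
    isUnit_of_dvd_unit (EuclideanDomain.dvd_gcd hda hdq) hgcd
  have hQ : (Zsqrtd.norm q : ℝ) = gnorm q := (gnorm_cast_real q).symm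
  rw [hQ] at happ hqN ⊢
  have hsep := wellSep_of_approx hq hrel happ
  have hN3 : (3 : ℝ) ≤ N := by exact_mod_cast hN.le
  have hball : Convex ℝ (Metric.ball (0 : ℂ) √N) := convex_ball _ _
  have hmem : ∀ n : GaussianInt, toComplex n ∈ Metric.ball (0 : ℂ) √N ↔ gnorm n < N := by
    intro n
    rw [mem_ball_zero_iff, Real.lt_sqrt (_root_.norm_nonneg _), ← gnorm_eq_norm_sq, Nat.cast_lt]
  have hb₁ := norm_sum_gvm_chiS_le_main (hS₁.inter hball) (one_le_gnorm hq) hsep hN3 hqN.le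
  have hb₂ := norm_sum_gvm_chiS_le_main (hS₂.inter hball) (one_le_gnorm hq) hsep hN3 hqN.le
  have hsplit : ∑' n : {m : GaussianInt // Zsqrtd.norm m < (N : ℤ) ∧ argIn (toComplex m) ω},
        (gvm (n : GaussianInt) : ℂ) * e2 (cip (toComplex (n : GaussianInt)) α) =
      ∑ n ∈ gball N, (gvm n : ℂ) * chiS (S₁ ∩ Metric.ball 0 √N) α n +
      ∑ n ∈ gball N, (gvm n : ℂ) * chiS (S₂ ∩ Metric.ball 0 √N) α n := by
    rw [tsum_gvm_eq_sum, ← Finset.sum_add_distrib]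
    refine Finset.sum_congr rfl fun n hn => ?_
    have hn0 : toComplex n ≠ 0 := toComplex_eq_zero.not.2 (mem_gball.1 hn).1
    obtain ⟨h1, h2⟩ := hS _ hn0
    rw [← mul_add]
    congr 1
    simp only [chiS, Set.mem_inter_iff, hmem, h1]
    by_cases h3 : toComplex n ∈ S₁
    · have h4 : toComplex n ∉ S₂ := fun h4 => h2 ⟨h3, h4⟩
      simp [h3, h4]
    · by_cases h4 : toComplex n ∈ S₂ <;> simp [h3, h4]
  rw [hsplit]
  refine (norm_add_le _ _).trans ?_
  linarith

end
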